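/- arXiv:2210.05627 — 3 statements merged into one kernel-verified Lean document; each statement's English description precedes it below -/
import Mathlib

section
/- For every t ∈ [0,1] and every integer s ≥ 0, the pair correlation C_s(t) := ℙ(O_0(t) ∩ O_s(t)) − ℙ(O_0(t))·ℙ(O_s(t)) satisfies C_s(t) = −(1/2) e^{−2t} ∑_{n=0}^{∞} (−2t)^{2n+s+1}/(2n+s+1)!. -/
open MeasureTheory Set

/-- `P` is the infinite product over `ℤ` of the uniform probability measure on `[0,1]`,
characterized by its values on cylinder sets. -/
def IsUniformProduct (P : Measure (ℤ → ℝ)) : Prop :=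
  ∀ (F : Finset ℤ) (A : ℤ → Set ℝ), (∀ i ∈ F, MeasurableSet (A i)) →
    P {T | ∀ i ∈ F, T i ∈ A i} = ∏ i ∈ F, (volume.restrict (Icc (0 : ℝ) 1)) (A i)

/-- The event `G_{jk}^s(t)`. -/
def G (t : ℝ) (s : ℤ) (j k : ℕ) : Set (ℤ → ℝ) :=
  {T | T s < t ∧
    (∀ i : ℕ, i < 2 * j → T (s - i - 1) < T (s - i)) ∧
    T (s - 2 * j) < T (s - 2 * j - 1) ∧
    (∀ i : ℕ, i < 2 * k → T (s + i + 1) < T (s + i)) ∧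
    T (s + 2 * k) < T (s + 2 * k + 1)}

/-- The event that site `s` is occupied by time `t`. -/
def O (t : ℝ) (s : ℤ) : Set (ℤ → ℝ) := ⋃ (j : ℕ) (k : ℕ), G t s j k

namespace RSA

noncomputable section

abbrev lam : Measure ℝ := volume.restrict (Icc (0 : ℝ) 1)

instance lam_prob : IsProbabilityMeasure lam := ⟨by simp [lam]⟩

lemma cyl_meas (F : Finset ℤ) (A : ℤ → Set ℝ) (hA : ∀ i ∈ F, MeasurableSet (A i)) :
    MeasurableSet {T : ℤ → ℝ | ∀ i ∈ F, T i ∈ A i} := by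
  have : {T : ℤ → ℝ | ∀ i ∈ F, T i ∈ A i} = Set.pi F A := by ext; simp [Set.mem_pi]
  rw [this]
  exact MeasurableSet.pi F.countable_toSet hA

lemma eq_inf {P : Measure (ℤ → ℝ)} (hP : IsUniformProduct P) :
    P = Measure.infinitePi (fun _ : ℤ => lam) := by
  apply Measure.eq_infinitePi
  intro s A hA
  rw [← hP s A (fun i _ => hA i)]
  congr 1

lemma prob {P : Measure (ℤ → ℝ)} (hP : IsUniformProduct P) : IsProbabilityMeasure P := by
  rw [eq_inf hP]; infer_instance

lemma mp_update {P : Measure (ℤ → ℝ)} (hP : IsUniformProduct P) (i : ℤ) :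
    MeasurePreserving (fun p : ℝ × (ℤ → ℝ) => Function.update p.2 i p.1) (lam.prod P) P := by
  have := prob hP
  have hm : Measurable (fun p : ℝ × (ℤ → ℝ) => Function.update p.2 i p.1) := by
    rw [measurable_pi_iff]
    intro j
    by_cases h : j = i
    · subst h; simpa using measurable_fst
    · simp only [Function.update_of_ne h]; fun_prop
  refine ⟨hm, ?_⟩
  have key : IsUniformProduct (Measure.map (fun p : ℝ × (ℤ → ℝ) => Function.update p.2 i p.1)
      (lam.prod P)) := by
    intro F A hA
    rw [Measure.map_apply hm (cyl_meas F A hA)]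
    by_cases hi : i ∈ F
    · have : (fun p : ℝ × (ℤ → ℝ) => Function.update p.2 i p.1) ⁻¹'
          {T : ℤ → ℝ | ∀ i ∈ F, T i ∈ A i} =
          A i ×ˢ {T : ℤ → ℝ | ∀ j ∈ F.erase i, T j ∈ A j} := by
        ext ⟨x, T⟩
        simp only [mem_preimage, mem_ofPred_eq, mem_prod, Finset.mem_erase]
        constructor
        · intro h
          refine ⟨by simpa using h i hi, fun j hj => by simpa [hj.1] using h j hj.2⟩
        · rintro ⟨h1, h2⟩ j hj
          by_cases hji : j = i
          · subst hji; simpa using h1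
          · simpa [hji] using h2 j ⟨hji, hj⟩
      rw [this, Measure.prod_prod, hP _ _ (fun j hj => hA j (Finset.mem_of_mem_erase hj)),
        Finset.mul_prod_erase _ (fun j => lam (A j)) hi]
    · have : (fun p : ℝ × (ℤ → ℝ) => Function.update p.2 i p.1) ⁻¹'
          {T : ℤ → ℝ | ∀ i ∈ F, T i ∈ A i} =
          univ ×ˢ {T : ℤ → ℝ | ∀ j ∈ F, T j ∈ A j} := by
        ext ⟨x, T⟩
        simp only [mem_preimage, mem_ofPred_eq, mem_prod, mem_univ, true_and]
        refine forall₂_congr fun j hj => ?_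
        have : j ≠ i := fun h => hi (h ▸ hj)
        simp [this]
      rw [this, Measure.prod_prod, hP _ _ hA, measure_univ, one_mul]
  rw [eq_inf key, eq_inf hP]

open Classical in
lemma mp_piecewise {P : Measure (ℤ → ℝ)} (hP : IsUniformProduct P) (S : Set ℤ) :
    MeasurePreserving (fun p : (ℤ → ℝ) × (ℤ → ℝ) => S.piecewise p.1 p.2) (P.prod P) P := by
  have := prob hP
  have hm : Measurable (fun p : (ℤ → ℝ) × (ℤ → ℝ) => S.piecewise p.1 p.2) := by
    rw [measurable_pi_iff]
    intro j
    by_cases h : j ∈ S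
    · simp only [Set.piecewise_eq_of_mem _ _ _ h]; fun_prop
    · simp only [Set.piecewise_eq_of_notMem _ _ _ h]; fun_prop
  refine ⟨hm, ?_⟩
  have key : IsUniformProduct (Measure.map (fun p : (ℤ → ℝ) × (ℤ → ℝ) => S.piecewise p.1 p.2)
      (P.prod P)) := by
    intro F A hA
    rw [Measure.map_apply hm (cyl_meas F A hA)]
    have : (fun p : (ℤ → ℝ) × (ℤ → ℝ) => S.piecewise p.1 p.2) ⁻¹'
          {T : ℤ → ℝ | ∀ i ∈ F, T i ∈ A i} =
          {T : ℤ → ℝ | ∀ j ∈ F.filter (· ∈ S), T j ∈ A j} ×ˢ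
          {T : ℤ → ℝ | ∀ j ∈ F.filter (¬ · ∈ S), T j ∈ A j} := by
        ext ⟨x, T⟩
        simp only [mem_preimage, mem_ofPred_eq, mem_prod, Finset.mem_filter]
        constructor
        · intro h
          refine ⟨fun j hj => by simpa [hj.2] using h j hj.1,
            fun j hj => by simpa [hj.2] using h j hj.1⟩
        · rintro ⟨h1, h2⟩ j hj
          by_cases hji : j ∈ S
          · simpa [hji] using h1 j ⟨hj, hji⟩
          · simpa [hji] using h2 j ⟨hj, hji⟩
    rw [this, Measure.prod_prod, hP _ _ (fun j hj => hA j (Finset.mem_of_mem_filter _ hj)),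
        hP _ _ (fun j hj => hA j (Finset.mem_of_mem_filter _ hj)),
        Finset.prod_filter_mul_prod_filter_not]
  rw [eq_inf key, eq_inf hP]

lemma integral_peel {P : Measure (ℤ → ℝ)} (hP : IsUniformProduct P) (i : ℤ)
    {F : (ℤ → ℝ) → ℝ} (hF : Measurable F) {C : ℝ} (hb : ∀ T, |F T| ≤ C) :
    ∫ T, F T ∂P = ∫ x, ∫ T, F (Function.update T i x) ∂P ∂lam := by
  have := prob hP
  have mp := mp_update hP i
  conv_lhs => rw [← mp.map_eq]
  rw [integral_map mp.measurable.aemeasurable hF.aestronglyMeasurable, integral_prod]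
  exact Integrable.of_bound (hF.comp mp.measurable).aestronglyMeasurable C
    (Filter.Eventually.of_forall fun p => hb _)

lemma ae_peel {P : Measure (ℤ → ℝ)} (hP : IsUniformProduct P) (i : ℤ)
    {p : (ℤ → ℝ) → Prop} (hp : ∀ᵐ T ∂P, p T) :
    ∀ᵐ x ∂lam, ∀ᵐ T ∂P, p (Function.update T i x) := by
  have := prob hP
  exact Measure.ae_ae_of_ae_prod ((mp_update hP i).quasiMeasurePreserving.ae hp)

lemma integral_indep {P : Measure (ℤ → ℝ)} (hP : IsUniformProduct P) (S : Set ℤ)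
    {F H : (ℤ → ℝ) → ℝ} (hF : Measurable F) (hH : Measurable H)
    (dF : DependsOn F S) (dH : DependsOn H Sᶜ) :
    ∫ T, F T * H T ∂P = (∫ T, F T ∂P) * ∫ T, H T ∂P := by
  classical
  have := prob hP
  have mp := mp_piecewise hP S
  conv_lhs => rw [← mp.map_eq]
  have hFH : Measurable (fun T => F T * H T) := hF.mul hH
  rw [integral_map mp.measurable.aemeasurable hFH.aestronglyMeasurable,
    ← integral_prod_mul]
  congr 1 with p
  congr 1
  · apply dF; intro i hi; simp [hi]
  · apply dH; intro i hi; simp only [mem_compl_iff] at hi; simp [hi]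

def c (a b : ℝ) : ℝ := if a < b then 1 else 0

lemma c_nonneg (a b : ℝ) : 0 ≤ c a b := by unfold c; split_ifs <;> norm_num
lemma c_le (a b : ℝ) : c a b ≤ 1 := by unfold c; split_ifs <;> norm_num

@[fun_prop]
lemma meas_c {α : Type*} [MeasurableSpace α] {f g : α → ℝ} (hf : Measurable f)
    (hg : Measurable g) : Measurable (fun a => c (f a) (g a)) := by
  unfold c
  exact Measurable.ite (measurableSet_lt hf hg) measurable_const measurable_const

lemma int_c (g : ℝ → ℝ) {x : ℝ} (hx : x ∈ Icc (0 : ℝ) 1) :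
    ∫ z, c z x * g z ∂lam = ∫ z in (0 : ℝ)..x, g z := by
  have : (fun z => c z x * g z) = (Iio x).indicator g := by
    ext z; simp [c, indicator]
  rw [this, integral_indicator measurableSet_Iio, Measure.restrict_restrict measurableSet_Iio,
    intervalIntegral.integral_of_le hx.1, integral_Ioc_eq_integral_Ioo]
  rw [← integral_Ico_eq_integral_Ioo]
  congr 2
  ext z; simp only [mem_inter_iff, mem_Iio, mem_Icc, mem_Ico]
  constructor
  · rintro ⟨a, b, d⟩; exact ⟨b, a⟩
  · rintro ⟨a, b⟩; exact ⟨b, a, b.le.trans hx.2⟩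

lemma lam_mem : ∀ᵐ x ∂lam, x ∈ Icc (0 : ℝ) 1 := ae_restrict_mem measurableSet_Icc

lemma lam_ne (y : ℝ) : ∀ᵐ x ∂lam, x ≠ y := by
  apply ae_restrict_of_ae
  exact Measure.ae_ne volume y

/-- chain indicator -/
def D (ε : ℤ) : ℤ → ℕ → (ℤ → ℝ) → ℝ
  | _, 0, _ => 1
  | i, k + 1, T => c (T (i + ε)) (T i) * D ε (i + ε) k T

@[fun_prop]
lemma meas_D (ε i : ℤ) (k : ℕ) : Measurable (D ε i k) := by
  induction k generalizing i with
  | zero => exact measurable_const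
  | succ k ih =>
    have := ih (i + ε)
    show Measurable (fun T : ℤ → ℝ => c (T (i + ε)) (T i) * D ε (i + ε) k T)
    fun_prop

lemma D_nonneg (ε i : ℤ) (k : ℕ) (T) : 0 ≤ D ε i k T := by
  induction k generalizing i with
  | zero => simp [D]
  | succ k ih => exact mul_nonneg (c_nonneg _ _) (ih _)

lemma D_le (ε i : ℤ) (k : ℕ) (T) : D ε i k T ≤ 1 := by
  induction k generalizing i with
  | zero => simp [D]
  | succ k ih => exact mul_le_one₀ (c_le _ _) (D_nonneg _ _ _ _) (ih _)

lemma D_abs (ε i : ℤ) (k : ℕ) (T) : |D ε i k T| ≤ 1 := by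
  rw [abs_of_nonneg (D_nonneg _ _ _ _)]; exact D_le _ _ _ _

lemma D_dep (ε i : ℤ) (k : ℕ) : DependsOn (D ε i k) {j | ∃ m : ℕ, m ≤ k ∧ j = i + ε * m} := by
  induction k generalizing i with
  | zero => intro x y _; rfl
  | succ k ih =>
    intro x y h
    have h0 := h i ⟨0, by omega, by simp⟩
    have h1 := h (i + ε) ⟨1, by omega, by simp⟩
    have h2 : D ε (i + ε) k x = D ε (i + ε) k y := by
      apply ih
      rintro j ⟨m, hm, rfl⟩
      exact h _ ⟨m + 1, by omega, by push_cast; ring⟩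
    simp only [D, h0, h1, h2]

/-- peel the last factor -/
lemma D_succ_right (ε i : ℤ) (k : ℕ) (T) :
    D ε i (k + 1) T = D ε i k T * c (T (i + ε * (k + 1))) (T (i + ε * k)) := by
  induction k generalizing i with
  | zero => simp [D]
  | succ k ih =>
    rw [D, ih, D]
    have e1 : i + ε + ε * (k + 1) = i + ε * ((k + 1 : ℕ) + 1) := by push_cast; ring
    have e2 : i + ε + ε * k = i + ε * ((k + 1 : ℕ)) := by push_cast; ring
    rw [e1, e2]; ring

end

end RSA
namespace RSA

noncomputable section

@[fun_prop]
lemma meas_upd (i : ℤ) (x : ℝ) : Measurable (fun T : ℤ → ℝ => Function.update T i x) := by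
  rw [measurable_pi_iff]
  intro j
  by_cases h : j = i
  · subst h; simp
  · simp only [Function.update_of_ne h]; fun_prop

lemma D_upd {ε : ℤ} (i j : ℤ) (k : ℕ) (T) (x : ℝ)
    (h : ∀ m : ℕ, m ≤ k → j ≠ i + ε * m) :
    D ε i k (Function.update T j x) = D ε i k T := by
  apply D_dep
  rintro l ⟨m, hm, rfl⟩
  rw [Function.update_of_ne]
  exact (h m hm).symm

lemma exp_D {P : Measure (ℤ → ℝ)} (hP : IsUniformProduct P) {ε : ℤ} (hε : ε = 1 ∨ ε = -1)
    (i : ℤ) (k : ℕ) {x : ℝ} (hx : x ∈ Icc (0 : ℝ) 1) :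
    ∫ T, D ε i k (Function.update T i x) ∂P = x ^ k / (Nat.factorial k) := by
  have := prob hP
  induction k generalizing i x with
  | zero => simp [D]
  | succ k ih =>
    have h1 : ∀ T : ℤ → ℝ, D ε i (k + 1) (Function.update T i x) =
        c (T (i + ε)) x * D ε (i + ε) k T := by
      intro T
      have hne : i + ε ≠ i := by rcases hε with rfl | rfl <;> omega
      rw [D, D_upd, Function.update_self, Function.update_of_ne hne]
      intro m _
      rcases hε with rfl | rfl <;> omega
    simp only [h1]
    rw [integral_peel hP (i + ε) (F := fun T => c (T (i + ε)) x * D ε (i + ε) k T) (C := 1)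
      (by fun_prop)]
    · simp only [Function.update_self, integral_const_mul]
      have : ∀ᵐ z ∂lam, c z x * ∫ T, D ε (i + ε) k (Function.update T (i + ε) z) ∂P
          = c z x * (z ^ k / (Nat.factorial k)) := by
        filter_upwards [lam_mem] with z hz
        rw [ih _ hz]
      rw [integral_congr_ae this, int_c _ hx, intervalIntegral.integral_div, integral_pow,
        Nat.factorial_succ]
      push_cast
      have : (k : ℝ) + 1 ≠ 0 := by positivity
      field_simp
      simp
    · intro T
      rw [abs_mul, abs_of_nonneg (c_nonneg _ _)]
      exact mul_le_one₀ (c_le _ _) (abs_nonneg _) (D_abs _ _ _ _)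

lemma w_int (n : ℕ) {x y : ℝ} (hx : 0 ≤ x) (hy : 0 ≤ y) :
    ∫ z in (0 : ℝ)..y, (if x < z then (z - x) ^ n / (Nat.factorial n : ℝ) else 0) =
      if x < y then (y - x) ^ (n + 1) / (Nat.factorial (n + 1) : ℝ) else 0 := by
  have h : (fun z => (if x < z then (z - x) ^ n / (Nat.factorial n : ℝ) else 0)) =
      (Ioi x).indicator (fun z => (z - x) ^ n / (Nat.factorial n : ℝ)) := by
    ext z; simp [indicator]
  rw [h, intervalIntegral.integral_of_le hy, setIntegral_indicator measurableSet_Ioi,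
    Ioc_inter_Ioi, max_eq_right hx]
  split_ifs with hxy
  · rw [← intervalIntegral.integral_of_le hxy.le, intervalIntegral.integral_div,
      intervalIntegral.integral_comp_sub_right (fun z => z ^ n), integral_pow, Nat.factorial_succ]
    push_cast
    have : (n : ℝ) + 1 ≠ 0 := by positivity
    field_simp
    simp
  · rw [Ioc_eq_empty hxy]; simp

lemma exp_W {P : Measure (ℤ → ℝ)} (hP : IsUniformProduct P) {ε : ℤ} (hε : ε = 1 ∨ ε = -1)
    (i : ℤ) (n : ℕ) {x y : ℝ} (hx : x ∈ Icc (0 : ℝ) 1) (hy : y ∈ Icc (0 : ℝ) 1) :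
    ∫ T, D ε i (n + 1) (Function.update (Function.update T i y) (i + ε * (n + 1)) x) ∂P =
      if x < y then (y - x) ^ n / (Nat.factorial n : ℝ) else 0 := by
  have := prob hP
  induction n generalizing i y with
  | zero =>
    have hne : i + ε ≠ i := by rcases hε with rfl | rfl <;> omega
    simp [D, c, Function.update_of_ne hne.symm]
  | succ n ih =>
    have h1 : ∀ T : ℤ → ℝ, D ε i (n + 1 + 1)
        (Function.update (Function.update T i y) (i + ε * ((n + 1 : ℕ) + 1)) x) =
        c (T (i + ε)) y * D ε (i + ε) (n + 1)
          (Function.update T (i + ε + ε * (n + 1)) x) := by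
      intro T
      have hne : i + ε ≠ i := by rcases hε with rfl | rfl <;> omega
      have hne2 : i + ε + ε * (n + 1) ≠ i := by rcases hε with rfl | rfl <;> omega
      have hne3 : i + ε ≠ i + ε + ε * (n + 1) := by rcases hε with rfl | rfl <;> omega
      have e : i + ε * ((n + 1 : ℕ) + 1) = i + ε + ε * (n + 1) := by push_cast; ring
      rw [D, e, Function.update_of_ne hne3, Function.update_of_ne hne,
        Function.update_of_ne hne2.symm, Function.update_self, Function.update_comm hne2.symm,
        D_upd]
      intro m _
      rcases hε with rfl | rfl <;> omega
    simp only [h1]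
    rw [integral_peel hP (i + ε) (F := fun T => c (T (i + ε)) y * D ε (i + ε) (n + 1)
          (Function.update T (i + ε + ε * (n + 1)) x)) (C := 1)
      (by fun_prop)]
    · simp only [Function.update_self, integral_const_mul]
      have : ∀ᵐ z ∂lam, c z y * ∫ T, D ε (i + ε) (n + 1) (Function.update
          (Function.update T (i + ε) z) (i + ε + ε * (n + 1)) x) ∂P
          = c z y * (if x < z then (z - x) ^ n / (Nat.factorial n : ℝ) else 0) := by
        filter_upwards [lam_mem] with z hz
        rw [ih _ hz]
      rw [integral_congr_ae this, int_c _ hy, w_int n hx.1 hy.1]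
    · intro T
      rw [abs_mul, abs_of_nonneg (c_nonneg _ _)]
      exact mul_le_one₀ (c_le _ _) (abs_nonneg _) (D_abs _ _ _ _)

/-- even-run event -/
def Ev (ε i : ℤ) : Set (ℤ → ℝ) :=
  {T | ∃ k : ℕ, (∀ j : ℕ, j < 2 * k → T (i + ε * (j + 1)) < T (i + ε * j)) ∧
    T (i + ε * (2 * k)) < T (i + ε * (2 * k + 1))}

lemma meas_Ev (ε i : ℤ) : MeasurableSet (Ev ε i) := by
  have : Ev ε i = ⋃ k : ℕ, ((⋂ j : ℕ, ⋂ _ : j < 2 * k,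
      {T : ℤ → ℝ | T (i + ε * (j + 1)) < T (i + ε * j)}) ∩
      {T : ℤ → ℝ | T (i + ε * (2 * k)) < T (i + ε * (2 * k + 1))}) := by
    ext T; simp [Ev]
  rw [this]
  refine MeasurableSet.iUnion fun k => MeasurableSet.inter ?_
    (measurableSet_lt (by fun_prop) (by fun_prop))
  exact MeasurableSet.iInter fun j => MeasurableSet.iInter fun _ =>
    (measurableSet_lt (by fun_prop) (by fun_prop))

def e (ε i : ℤ) : (ℤ → ℝ) → ℝ := (Ev ε i).indicator 1

@[fun_prop]
lemma meas_e (ε i : ℤ) : Measurable (e ε i) := measurable_one.indicator (meas_Ev ε i)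

lemma e_nonneg (ε i : ℤ) (T) : 0 ≤ e ε i T := by
  unfold e indicator; split_ifs <;> simp
lemma e_le (ε i : ℤ) (T) : e ε i T ≤ 1 := by
  unfold e indicator; split_ifs <;> simp
lemma e_abs (ε i : ℤ) (T) : |e ε i T| ≤ 1 := by
  rw [abs_of_nonneg (e_nonneg _ _ _)]; exact e_le _ _ _
lemma e_idem (ε i : ℤ) (T) : e ε i T * e ε i T = e ε i T := by
  unfold e indicator; split_ifs <;> simp

lemma e_dep (ε i : ℤ) : DependsOn (e ε i) {j | ∃ m : ℕ, j = i + ε * m} := by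
  intro x y h
  have h' : ∀ m : ℕ, x (i + ε * m) = y (i + ε * m) := fun m => h _ ⟨m, rfl⟩
  have h1 : ∀ m : ℕ, x (i + ε * (m + 1)) = y (i + ε * (m + 1)) := fun m => by
    exact_mod_cast h' (m + 1)
  have h2 : ∀ m : ℕ, x (i + ε * (2 * m)) = y (i + ε * (2 * m)) := fun m => by
    exact_mod_cast h' (2 * m)
  have h3 : ∀ m : ℕ, x (i + ε * (2 * m + 1)) = y (i + ε * (2 * m + 1)) := fun m => by
    exact_mod_cast h' (2 * m + 1)
  have : x ∈ Ev ε i ↔ y ∈ Ev ε i := by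
    simp only [Ev, mem_ofPred_eq, h', h1, h2, h3]
  unfold e indicator
  by_cases hx : x ∈ Ev ε i
  · simp [hx, this.1 hx]
  · have hy : y ∉ Ev ε i := fun h => hx (this.2 h)
    simp [hx, hy]

def Good (ε : ℤ) (T : ℤ → ℝ) : Prop :=
  ∀ i, T i ≠ T (i + ε) ∧ ∃ k : ℕ, ¬ T (i + ε * (k + 1)) < T (i + ε * k)

lemma D_eq_one {ε i : ℤ} {T : ℤ → ℝ} (h : ∀ k : ℕ, T (i + ε * (k + 1)) < T (i + ε * k)) (k : ℕ) :
    D ε i k T = 1 := by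
  induction k with
  | zero => rfl
  | succ k ih => rw [D_succ_right, ih, c, if_pos (h k), one_mul]

lemma ae_ne_coord {P : Measure (ℤ → ℝ)} (hP : IsUniformProduct P) (j : ℤ) (x : ℝ) :
    ∀ᵐ T ∂P, T j ≠ x := by
  rw [eq_inf hP]
  exact (measurePreserving_eval_infinitePi (fun _ : ℤ => lam) j).quasiMeasurePreserving.ae
    (lam_ne x)

lemma ae_good {P : Measure (ℤ → ℝ)} (hP : IsUniformProduct P) {ε : ℤ} (hε : ε = 1 ∨ ε = -1) :
    ∀ᵐ T ∂P, Good ε T := by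
  have := prob hP
  unfold Good
  rw [ae_all_iff]
  intro i
  have hne : i + ε ≠ i := by rcases hε with rfl | rfl <;> omega
  refine Filter.Eventually.and ?_ ?_
  · have mp := mp_update hP i
    have hs : MeasurableSet {T : ℤ → ℝ | T i ≠ T (i + ε)} :=
      (measurableSet_eq_fun (by fun_prop) (by fun_prop)).compl
    rw [← mp.map_eq, ae_map_iff mp.measurable.aemeasurable hs]
    rw [Measure.ae_prod_iff_ae_ae]
    · refine Filter.Eventually.of_forall fun x => ?_
      filter_upwards [ae_ne_coord hP (i + ε) x] with T hT
      simpa [Function.update_of_ne hne] using hT.symm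
    · exact mp.measurable hs
  · rw [ae_iff]
    push Not
    set B := {T : ℤ → ℝ | ∀ k : ℕ, T (i + ε * (k + 1)) < T (i + ε * k)} with hB
    have hBm : MeasurableSet B := by
      have : B = ⋂ k : ℕ, {T : ℤ → ℝ | T (i + ε * (k + 1)) < T (i + ε * k)} := by
        ext T; simp [B]
      rw [this]
      exact MeasurableSet.iInter fun k => measurableSet_lt (by fun_prop) (by fun_prop)
    have hle : ∀ k : ℕ, P.real B ≤ 1 ^ k / (Nat.factorial k : ℝ) := by
      intro k
      rw [← integral_indicator_one hBm]
      calc ∫ T, B.indicator 1 T ∂P ≤ ∫ T, D ε i k T ∂P := by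
            apply integral_mono
            · exact (integrable_const (1 : ℝ)).indicator hBm
            · exact Integrable.of_bound (meas_D ε i k).aestronglyMeasurable 1
                (Filter.Eventually.of_forall fun T => D_abs _ _ _ _)
            · intro T
              by_cases hT : T ∈ B
              · rw [D_eq_one hT]; simp [hT]
              · simpa [hT] using D_nonneg _ _ _ _
        _ = ∫ x, ∫ T, D ε i k (Function.update T i x) ∂P ∂lam :=
            integral_peel hP i (meas_D ε i k) (C := 1) (fun T => D_abs _ _ _ _)
        _ = ∫ x, x ^ k / (Nat.factorial k : ℝ) ∂lam := by
            apply integral_congr_ae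
            filter_upwards [lam_mem] with x hx
            exact exp_D hP hε i k hx
        _ ≤ ‖∫ x, x ^ k / (Nat.factorial k : ℝ) ∂lam‖ := Real.le_norm_self _
        _ ≤ 1 ^ k / (Nat.factorial k : ℝ) * lam.real univ := by
            apply norm_integral_le_of_norm_le_const
            filter_upwards [lam_mem] with x hx
            rw [Real.norm_of_nonneg (by have := hx.1; positivity)]
            have := hx.1
            have := hx.2
            gcongr
        _ = _ := by simp
    have h0 : P.real B ≤ 0 :=
      ge_of_tendsto' (FloorSemiring.tendsto_pow_div_factorial_atTop (1 : ℝ)) hle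
    have h1 : P.real B = 0 := le_antisymm h0 measureReal_nonneg
    exact (measureReal_eq_zero_iff).1 h1

lemma seq_even {a : ℕ → ℝ} (hne : ∀ k, a k ≠ a (k + 1)) (hf : ∃ k, ¬ a (k + 1) < a k)
    (h1 : a 1 < a 0) :
    (∃ k, (∀ j < 2 * k, a (j + 1) < a j) ∧ a (2 * k) < a (2 * k + 1)) ↔
    ¬ (∃ k, (∀ j < 2 * k, a (j + 1 + 1) < a (j + 1)) ∧ a (2 * k + 1) < a (2 * k + 1 + 1)) := by
  constructor
  · rintro ⟨k, hk, hk'⟩ ⟨l, hl, hl'⟩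
    rcases lt_trichotomy (2 * k) (2 * l + 1) with h | h | h
    · rcases Nat.eq_zero_or_pos k with rfl | hk0
      · simp at hk'; linarith
      · have := hl (2 * k - 1) (by omega)
        rw [show 2 * k - 1 + 1 = 2 * k by omega] at this
        linarith
    · omega
    · have := hk (2 * l + 1) h; linarith
  · intro h
    classical
    set r := Nat.find hf with hr
    have hr1 : ¬ a (r + 1) < a r := Nat.find_spec hf
    have hr2 : ∀ j < r, a (j + 1) < a j := fun j hj => not_not.1 (Nat.find_min hf hj)
    have hr3 : a r < a (r + 1) := lt_of_le_of_ne (not_lt.1 hr1) (hne r)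
    rcases Nat.even_or_odd' r with ⟨k, hk | hk⟩
    · exact ⟨k, fun j hj => hr2 j (by omega), by rw [← hk]; exact hr3⟩
    · exact absurd ⟨k, fun j hj => hr2 (j + 1) (by omega), by rw [← hk]; exact hr3⟩ h

lemma e_rec {ε : ℤ} {T : ℤ → ℝ} (hT : Good ε T) (i : ℤ) :
    e ε i T = 1 - c (T (i + ε)) (T i) * e ε (i + ε) T := by
  unfold c
  split_ifs with h
  · have key := seq_even (a := fun k : ℕ => T (i + ε * k))
      (fun k => by
        have := (hT (i + ε * k)).1
        rwa [show i + ε * k + ε = i + ε * ((k + 1 : ℕ) : ℤ) by push_cast; ring] at this)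
      (by simpa using (hT i).2) (by simpa using h)
    have h1 : T ∈ Ev ε i ↔ ¬ T ∈ Ev ε (i + ε) := by
      simp only [Ev, mem_ofPred_eq]
      convert key using 6 <;> push_cast <;> ring_nf
    unfold e indicator
    by_cases h2 : T ∈ Ev ε (i + ε)
    · simp [h1, h2]
    · simp [h1, h2]
  · have : T i < T (i + ε) := lt_of_le_of_ne (not_lt.1 h) (hT i).1
    have h1 : T ∈ Ev ε i := ⟨0, by simp, by simpa using this⟩
    simp [e, h1]

lemma e_expand {ε : ℤ} {T : ℤ → ℝ} (hT : Good ε T) (i : ℤ) (M : ℕ) :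
    e ε i T = ∑ k ∈ Finset.range M, (-1) ^ k * D ε i k T +
      (-1) ^ M * D ε i M T * e ε (i + ε * M) T := by
  induction M with
  | zero => simp [D]
  | succ M ih =>
    rw [ih, Finset.sum_range_succ, D_succ_right, e_rec hT (i + ε * M)]
    have : i + ε * M + ε = i + ε * (M + 1) := by ring
    rw [this]
    push_cast
    ring

lemma exp_e {P : Measure (ℤ → ℝ)} (hP : IsUniformProduct P) {ε : ℤ} (hε : ε = 1 ∨ ε = -1)
    (i : ℤ) : ∀ᵐ x ∂lam, ∫ T, e ε i (Function.update T i x) ∂P = Real.exp (-x) := by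
  have := prob hP
  filter_upwards [lam_mem, ae_peel hP i (ae_good hP hε)] with x hx hg
  have hD : ∀ k, Integrable (fun T => D ε i k (Function.update T i x)) P := fun k =>
    Integrable.of_bound (Measurable.aestronglyMeasurable (by fun_prop)) 1 (Filter.Eventually.of_forall fun T => D_abs _ _ _ _)
  have hE : Integrable (fun T => e ε i (Function.update T i x)) P :=
    Integrable.of_bound (Measurable.aestronglyMeasurable (by fun_prop)) 1 (Filter.Eventually.of_forall fun T => e_abs _ _ _)
  have hb : ∀ M : ℕ, ‖∫ T, e ε i (Function.update T i x) ∂P -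
      ∑ k ∈ Finset.range M, (-x) ^ k / (Nat.factorial k : ℝ)‖ ≤ x ^ M / (Nat.factorial M : ℝ) := by
    intro M
    have h1 : ∑ k ∈ Finset.range M, (-x) ^ k / (Nat.factorial k : ℝ) =
        ∫ T, ∑ k ∈ Finset.range M, (-1) ^ k * D ε i k (Function.update T i x) ∂P := by
      rw [integral_finsetSum _ (fun k _ => (hD k).const_mul _)]
      refine Finset.sum_congr rfl fun k _ => ?_
      rw [integral_const_mul, exp_D hP hε i k hx, neg_pow]; ring
    rw [h1, ← integral_sub hE (integrable_finsetSum _ fun k _ => (hD k).const_mul _),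
      ← exp_D hP hε i M hx]
    apply norm_integral_le_of_norm_le (hD M)
    filter_upwards [hg] with T hT
    rw [e_expand hT i M, add_sub_cancel_left, norm_mul, norm_mul]
    simp only [norm_pow, norm_neg, norm_one, one_pow, one_mul, Real.norm_eq_abs]
    rw [abs_of_nonneg (D_nonneg _ _ _ _)]
    exact mul_le_of_le_one_right (D_nonneg _ _ _ _) (e_abs _ _ _)
  have l1 : Filter.Tendsto (fun M => ∑ k ∈ Finset.range M, (-x) ^ k / (Nat.factorial k : ℝ))
      Filter.atTop (nhds (Real.exp (-x))) := by
    rw [Real.exp_eq_exp_ℝ]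
    exact (NormedSpace.expSeries_div_hasSum_exp (-x)).tendsto_sum_nat
  have l2 := squeeze_zero_norm hb (FloorSemiring.tendsto_pow_div_factorial_atTop x)
  have l3 := l1.const_sub (∫ T, e ε i (Function.update T i x) ∂P)
  have := tendsto_nhds_unique l2 l3
  linarith

end

end RSA
namespace RSA

noncomputable section

def q (k : ℕ) (v : ℝ) : ℝ := (-v) ^ k / (Nat.factorial k : ℝ)

def p (n : ℕ) (v : ℝ) : ℝ := ∑ k ∈ Finset.range n, q k v

def kap (N : ℕ) (x y : ℝ) : ℝ := p (N + 1) (x + y) - 1 / 2 * q N (x + y) - 1 / 2 * q N |x - y|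

@[fun_prop]
lemma cont_q (k : ℕ) : Continuous (q k) := by unfold q; fun_prop

@[fun_prop]
lemma cont_p (k : ℕ) : Continuous (p k) := by unfold p; fun_prop

lemma q_succ_zero (k : ℕ) : q (k + 1) 0 = 0 := by simp [q]

lemma p_succ (n : ℕ) (v : ℝ) : p (n + 1) v = p n v + q n v := Finset.sum_range_succ _ _

lemma p_succ_zero (n : ℕ) : p (n + 1) 0 = 1 := by
  unfold p
  rw [Finset.sum_range_succ', Finset.sum_eq_zero]
  · simp [q]
  · intro k _; exact q_succ_zero k

lemma deriv_q (k : ℕ) (v : ℝ) : HasDerivAt (q (k + 1)) (-(q k v)) v := by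
  unfold q
  have h := (((hasDerivAt_id v).neg).pow (k + 1)).div_const (Nat.factorial (k + 1) : ℝ)
  refine HasDerivAt.congr_deriv (h) ?_
  simp only [Nat.factorial_succ]
  push_cast
  have : (k : ℝ) + 1 ≠ 0 := by positivity
  simp
  field_simp

lemma deriv_p (n : ℕ) (v : ℝ) : HasDerivAt (p (n + 1)) (-(p n v)) v := by
  induction n with
  | zero =>
    have : p (0 + 1) = fun _ => 1 := by ext; simp [p, q]
    rw [this]
    simpa [p] using hasDerivAt_const v (1 : ℝ)
  | succ n ih =>
    have : p (n + 1 + 1) = fun v => p (n + 1) v + q (n + 1) v := by ext; rw [p_succ]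
    rw [this]
    refine HasDerivAt.congr_deriv (ih.add (deriv_q n v)) ?_
    rw [p_succ]; ring

def RR (N : ℕ) (y z : ℝ) : ℝ := if y ≤ z then -(q (N + 1) (z - y)) else q (N + 1) (y - z)

lemma cont_RR (N : ℕ) (y : ℝ) : Continuous (RR N y) := by
  unfold RR
  apply Continuous.if_le (by fun_prop) (by fun_prop) (by fun_prop) (by fun_prop)
  rintro z rfl
  simp [q_succ_zero]

lemma deriv_RR (N : ℕ) {y z : ℝ} (h : z ≠ y) : HasDerivAt (RR N y) (q N |z - y|) z := by
  rcases lt_or_gt_of_ne h with h | h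
  · have h1 : HasDerivAt (fun z => q (N + 1) (y - z)) (q N |z - y|) z := by
      have := (deriv_q N (y - z)).comp z ((hasDerivAt_id z).const_sub y)
      refine HasDerivAt.congr_deriv (this) ?_
      rw [abs_of_neg (by linarith)]; simp
    refine h1.congr_of_eventuallyEq ?_
    filter_upwards [Iio_mem_nhds h] with w hw
    simp only [RR, if_neg (not_le.2 (mem_Iio.1 hw))]
  · have h1 : HasDerivAt (fun z => -(q (N + 1) (z - y))) (q N |z - y|) z := by
      have := ((deriv_q N (z - y)).comp z ((hasDerivAt_id z).sub_const y)).neg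
      refine HasDerivAt.congr_deriv (this) ?_
      rw [abs_of_pos (by linarith)]; simp
    refine h1.congr_of_eventuallyEq ?_
    filter_upwards [Ioi_mem_nhds h] with w hw
    simp only [RR, if_pos (le_of_lt (mem_Ioi.1 hw))]

@[fun_prop]
lemma cont_kap (N : ℕ) : Continuous (fun z : ℝ × ℝ => kap N z.1 z.2) := by
  unfold kap; fun_prop

lemma kap_int (N : ℕ) {x y : ℝ} (hy : 0 ≤ y) :
    ∫ z in (0 : ℝ)..x, kap N z y =
      (-(p (N + 2) (x + y)) + 1 / 2 * q (N + 1) (x + y) - 1 / 2 * RR N y x) + p (N + 2) y := by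
  have hd : ∀ z, z ≠ y → HasDerivAt
      (fun z => -(p (N + 2) (z + y)) + 1 / 2 * q (N + 1) (z + y) - 1 / 2 * RR N y z)
      (kap N z y) z := by
    intro z hz
    have h1 := ((deriv_p (N + 1) (z + y)).comp z ((hasDerivAt_id z).add_const y)).neg
    have h2 := ((deriv_q N (z + y)).comp z ((hasDerivAt_id z).add_const y)).const_mul (1 / 2)
    have h3 := (deriv_RR N hz).const_mul (1 / 2)
    refine HasDerivAt.congr_deriv ((h1.add h2).sub h3) ?_
    simp only [kap]; ring
  have hc := cont_RR N y
  rw [integral_eq_of_hasDerivAt_off_countable _ _ (countable_singleton y) (by fun_prop)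
    (fun z hz => hd z hz.2)]
  · have : RR N y 0 = q (N + 1) y := by
      unfold RR
      split_ifs with h
      · have : y = 0 := le_antisymm h hy
        subst this; simp [q_succ_zero]
      · simp
    rw [this]; simp only [zero_add]; ring
  · apply Continuous.intervalIntegrable
    exact (cont_kap N).comp (by fun_prop : Continuous fun z : ℝ => (z, y))

lemma kap_rec (N : ℕ) {x y : ℝ} (hy : 0 ≤ y) :
    kap (N + 1) x y = (p (N + 2) y +
      (-1) ^ (N + 2) * (if x < y then (y - x) ^ (N + 1) / (Nat.factorial (N + 1) : ℝ) else 0)) -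
      ∫ z in (0 : ℝ)..x, kap N z y := by
  rw [kap_int N hy, kap, RR]
  by_cases h : x < y
  · rw [if_pos h, if_neg (not_le.2 h), abs_of_neg (by linarith)]
    have : (-1) ^ (N + 2) * ((y - x) ^ (N + 1) / (Nat.factorial (N + 1) : ℝ)) =
      -(q (N + 1) (y - x)) := by
      unfold q; rw [neg_pow (y - x)]; ring
    rw [this, neg_sub]; ring
  · rw [if_neg h, if_pos (not_lt.1 h), abs_of_nonneg (by linarith)]
    ring

lemma kap_symm (N : ℕ) (x y : ℝ) : kap N x y = kap N y x := by
  unfold kap; rw [add_comm x y, abs_sub_comm]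

lemma inner_int (N : ℕ) {x : ℝ} (hx : 0 ≤ x) :
    2 * ∫ y in (0 : ℝ)..x, Real.exp (-x) * Real.exp (-y) * kap N x y =
      Real.exp (-2 * x) * (1 - p (N + 1) (2 * x)) := by
  have hd : ∀ y, HasDerivAt
      (fun y => Real.exp (-x - y) * (p (N + 1) (x - y) - p (N + 1) (x + y)))
      (2 * (Real.exp (-x) * Real.exp (-y) *
        (p (N + 1) (x + y) - 1 / 2 * q N (x + y) - 1 / 2 * q N (x - y)))) y := by
    intro y
    have h0 := ((hasDerivAt_id y).const_sub (-x)).exp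
    have h1 := (deriv_p N (x - y)).comp y ((hasDerivAt_id y).const_sub x)
    have h2 := (deriv_p N (x + y)).comp y ((hasDerivAt_id y).const_add x)
    refine HasDerivAt.congr_deriv (h0.mul (h1.sub h2)) ?_
    simp
    rw [← Real.exp_add, p_succ, p_succ, ← sub_eq_add_neg]; ring
  rw [← intervalIntegral.integral_const_mul]
  have e : ∫ y in (0 : ℝ)..x, 2 * (Real.exp (-x) * Real.exp (-y) * kap N x y) =
      ∫ y in (0 : ℝ)..x, 2 * (Real.exp (-x) * Real.exp (-y) *
        (p (N + 1) (x + y) - 1 / 2 * q N (x + y) - 1 / 2 * q N (x - y))) := by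
    apply intervalIntegral.integral_congr
    intro y hy
    rw [uIcc_of_le hx] at hy
    simp only [kap]
    rw [abs_of_nonneg (by linarith [hy.2])]
  rw [e, intervalIntegral.integral_eq_sub_of_hasDerivAt (fun y _ => hd y)]
  · simp only [sub_self, p_succ_zero, sub_zero, add_zero, mul_zero]
    ring_nf
  · apply Continuous.intervalIntegrable
    fun_prop

lemma lam_prod_mem : ∀ᵐ z ∂(lam.prod lam), z ∈ Icc (0 : ℝ) 1 ×ˢ Icc (0 : ℝ) 1 := by
  rw [lam, Measure.prod_restrict]
  exact ae_restrict_mem (measurableSet_Icc.prod measurableSet_Icc)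

lemma sym_int {h : ℝ → ℝ → ℝ} (hc : Continuous (fun z : ℝ × ℝ => h z.1 z.2))
    (hs : ∀ x y, h x y = h y x) {t : ℝ} (ht : t ∈ Icc (0 : ℝ) 1) :
    ∫ x, ∫ y, c x t * c y t * h x y ∂lam ∂lam =
      ∫ x in (0 : ℝ)..t, 2 * ∫ y in (0 : ℝ)..x, h x y := by
  obtain ⟨C, hC⟩ := (isCompact_Icc.prod isCompact_Icc).exists_bound_of_continuousOn
    (s := Icc (0 : ℝ) 1 ×ˢ Icc (0 : ℝ) 1) hc.continuousOn
  have hm : Measurable (fun z : ℝ × ℝ => h z.1 z.2) := hc.measurable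
  have int1 : Integrable (fun z : ℝ × ℝ => c z.1 t * (c z.2 z.1 * h z.1 z.2)) (lam.prod lam) := by
    apply Integrable.of_bound (Measurable.aestronglyMeasurable (by fun_prop)) C
    filter_upwards [lam_prod_mem] with z hz
    have := hC z hz
    rw [norm_mul, norm_mul, Real.norm_of_nonneg (c_nonneg _ _), Real.norm_of_nonneg (c_nonneg _ _)]
    calc _ ≤ 1 * (1 * C) := by
          have := c_nonneg z.2 z.1
          gcongr
          · exact c_le _ _
          · exact c_le _ _
      _ = C := by ring
  have int2 : Integrable (fun z : ℝ × ℝ => c z.2 t * (c z.1 z.2 * h z.1 z.2)) (lam.prod lam) := by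
    have := int1.swap
    refine this.congr (Filter.Eventually.of_forall fun z => ?_)
    simp only [Function.comp, Prod.fst_swap, Prod.snd_swap]
    rw [hs]
  have e1 : ∫ x, ∫ y, c x t * c y t * h x y ∂lam ∂lam =
      ∫ x, ∫ y, (c x t * (c y x * h x y) + c y t * (c x y * h x y)) ∂lam ∂lam := by
    congr 1 with x
    apply integral_congr_ae
    filter_upwards [lam_ne x] with y hy
    unfold c
    rcases lt_or_gt_of_ne hy with h | h
    · have := h.not_gt
      split_ifs <;> linarith
    · have := h.not_gt
      split_ifs <;> linarith
  have e2 : ∫ x, ∫ y, c y t * (c x y * h x y) ∂lam ∂lam =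
      ∫ x, ∫ y, c x t * (c y x * h x y) ∂lam ∂lam := by
    rw [integral_integral_swap int2]
    congr 1 with x
    congr 1 with y
    rw [hs]
  have e3 : ∫ x, ∫ y, c x t * (c y x * h x y) ∂lam ∂lam =
      ∫ x in (0 : ℝ)..t, ∫ y in (0 : ℝ)..x, h x y := by
    rw [← int_c _ ht]
    apply integral_congr_ae
    filter_upwards [lam_mem] with x hx
    rw [integral_const_mul, int_c _ hx]
  rw [e1, integral_integral_add int1 int2, e2, e3, intervalIntegral.integral_const_mul]
  ring

def FF (s : ℕ) (t : ℝ) : ℝ := -(1 / 2) * Real.exp (-2 * t) *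
        ∑' n : ℕ, (-2 * t) ^ (2 * n + s + 1) / (Nat.factorial (2 * n + s + 1))

lemma FF_at_zero (s : ℕ) : FF s 0 = 0 := by simp [FF]

lemma FF_zero (t : ℝ) : FF 0 t = (1 - Real.exp (-4 * t)) / 4 := by
  unfold FF
  simp only [add_zero]
  rw [(Real.hasSum_sinh (-2 * t)).tsum_eq, Real.sinh_eq]
  have h1 : Real.exp (-4 * t) = Real.exp (-2 * t) * Real.exp (-2 * t) := by
    rw [← Real.exp_add]; ring_nf
  have h2 : Real.exp (-2 * t) * Real.exp (-(-2 * t)) = 1 := by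
    rw [← Real.exp_add]; simp
  rw [h1]
  linear_combination (1 / 4) * h2

lemma tail_split {g : ℕ → ℝ} {a : ℝ} (hs : HasSum g a) (s : ℕ) :
    ∑' n : ℕ, g (2 * n + (s + 1) + 1) =
      -(∑' n : ℕ, g (2 * n + s + 1)) + (a - ∑ i ∈ Finset.range (s + 1), g i) := by
  have h1 := hs.summable.sum_add_tsum_nat_add (s + 1)
  have hsm := (summable_nat_add_iff (s + 1)).2 hs.summable
  have he : Summable (fun n => g (2 * n + (s + 1))) :=
    hsm.comp_injective (i := fun n : ℕ => 2 * n) (fun a b h => by simpa using h)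
  have ho : Summable (fun n => g (2 * n + 1 + (s + 1))) :=
    hsm.comp_injective (i := fun n : ℕ => 2 * n + 1) (fun a b h => by simpa using h)
  have h2 := tsum_even_add_odd (f := fun n => g (n + (s + 1))) he ho
  rw [hs.tsum_eq, ← h2] at h1
  have e1 : ∀ n, 2 * n + 1 + (s + 1) = 2 * n + (s + 1) + 1 := fun n => by ring
  have e2 : ∀ n, 2 * n + (s + 1) = 2 * n + s + 1 := fun n => by ring
  simp only [e1] at h1
  simp only [e2] at h1 ⊢
  linarith

lemma FF_succ (s : ℕ) (t : ℝ) : FF (s + 1) t = -(FF s t) -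
    1 / 2 * Real.exp (-2 * t) * (Real.exp (-2 * t) - p (s + 1) (2 * t)) := by
  have hs : HasSum (fun k => (-2 * t) ^ k / (Nat.factorial k : ℝ)) (Real.exp (-2 * t)) := by
    rw [Real.exp_eq_exp_ℝ]
    exact NormedSpace.expSeries_div_hasSum_exp (-2 * t)
  have hp : p (s + 1) (2 * t) = ∑ i ∈ Finset.range (s + 1), (-2 * t) ^ i / (Nat.factorial i : ℝ) := by
    unfold p q; simp only [neg_mul]
  have := tail_split hs s
  rw [FF, FF, this, hp]
  ring

lemma FF_deriv (s : ℕ) (t : ℝ) : HasDerivAt (FF s)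
    (Real.exp (-2 * t) * (Real.exp (-2 * t) - p s (2 * t))) t := by
  have hE : HasDerivAt (fun t => Real.exp (-2 * t)) (Real.exp (-2 * t) * (-2)) t := by
    simpa using ((hasDerivAt_id t).const_mul (-2)).exp
  induction s with
  | zero =>
    rw [show FF 0 = fun t => (1 - Real.exp (-4 * t)) / 4 from funext FF_zero]
    have h1 : Real.exp (-4 * t) = Real.exp (-2 * t) * Real.exp (-2 * t) := by
      rw [← Real.exp_add]; ring_nf
    have := ((((hasDerivAt_id t).const_mul (-4)).exp).const_sub 1).div_const 4
    refine HasDerivAt.congr_deriv (this) ?_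
    simp only [id, h1, p, Finset.range_zero, Finset.sum_empty]
    ring
  | succ s ih =>
    rw [show FF (s + 1) = _ from funext (FF_succ s)]
    have hp := (deriv_p s (2 * t)).comp t ((hasDerivAt_id t).const_mul 2)
    have := ih.neg.sub ((hE.const_mul (1 / 2)).mul (hE.sub hp))
    refine HasDerivAt.congr_deriv (this) ?_
    simp
    ring

lemma final_int (N : ℕ) (t : ℝ) :
    ∫ x in (0 : ℝ)..t, Real.exp (-2 * x) * (1 - p (N + 1) (2 * x)) =
      FF (N + 1) t + ((1 - Real.exp (-2 * t)) / 2) ^ 2 := by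
  have hE : ∀ t, HasDerivAt (fun t => Real.exp (-2 * t)) (Real.exp (-2 * t) * (-2)) t := by
    intro t
    simpa using ((hasDerivAt_id t).const_mul (-2)).exp
  have hd : ∀ x, HasDerivAt (fun t => FF (N + 1) t + ((1 - Real.exp (-2 * t)) / 2) ^ 2)
      (Real.exp (-2 * x) * (1 - p (N + 1) (2 * x))) x := by
    intro x
    have := (FF_deriv (N + 1) x).add ((((hE x).const_sub 1).div_const 2).pow 2)
    refine HasDerivAt.congr_deriv (this) ?_
    simp
    ring
  rw [intervalIntegral.integral_eq_sub_of_hasDerivAt (fun y _ => hd y)]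
  · simp [FF_at_zero]
  · apply Continuous.intervalIntegrable
    fun_prop

lemma rho_int (t : ℝ) :
    ∫ x in (0 : ℝ)..t, Real.exp (-x) * Real.exp (-x) = (1 - Real.exp (-2 * t)) / 2 := by
  have hd : ∀ x, HasDerivAt (fun t => (1 - Real.exp (-2 * t)) / 2)
      (Real.exp (-x) * Real.exp (-x)) x := by
    intro x
    have := (((((hasDerivAt_id x).const_mul (-2)).exp)).const_sub 1).div_const 2
    refine HasDerivAt.congr_deriv (this) ?_
    rw [← Real.exp_add]
    simp only [id]
    ring_nf
  rw [intervalIntegral.integral_eq_sub_of_hasDerivAt (fun y _ => hd y)]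
  · simp
  · apply Continuous.intervalIntegrable
    fun_prop

end

end RSA
namespace RSA

noncomputable section

def aa (n : ℕ) (i : ℤ) (T : ℤ → ℝ) : ℝ := ∑ k ∈ Finset.range (n + 1), (-1) ^ k * D 1 i k T

def AA (n : ℕ) (i : ℤ) (T : ℤ → ℝ) : ℝ :=
  ∑ k ∈ Finset.range (n + 1), (-1) ^ k * D (-1) (i + n) k T

def mid (n : ℕ) (i : ℤ) (T : ℤ → ℝ) : ℝ := aa n i T * AA n i T

@[fun_prop]
lemma meas_aa (n : ℕ) (i : ℤ) : Measurable (aa n i) := by unfold aa; fun_prop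
@[fun_prop]
lemma meas_AA (n : ℕ) (i : ℤ) : Measurable (AA n i) := by unfold AA; fun_prop
@[fun_prop]
lemma meas_mid (n : ℕ) (i : ℤ) : Measurable (mid n i) := by unfold mid; fun_prop

lemma alt_bound (n : ℕ) (ε i : ℤ) (T) :
    |∑ k ∈ Finset.range (n + 1), (-1) ^ k * D ε i k T| ≤ n + 1 := by
  refine (Finset.abs_sum_le_sum_abs _ _).trans ?_
  calc _ ≤ ∑ k ∈ Finset.range (n + 1), (1 : ℝ) := by
        apply Finset.sum_le_sum
        intro k _
        rw [abs_mul, abs_pow, abs_neg, abs_one, one_pow, one_mul]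
        exact D_abs _ _ _ _
    _ = _ := by simp

lemma aa_bound (n : ℕ) (i : ℤ) (T) : |aa n i T| ≤ n + 1 := alt_bound _ _ _ _
lemma AA_bound (n : ℕ) (i : ℤ) (T) : |AA n i T| ≤ n + 1 := alt_bound _ _ _ _
lemma mid_bound (n : ℕ) (i : ℤ) (T) : |mid n i T| ≤ (n + 1) * (n + 1) := by
  unfold mid; rw [abs_mul]
  exact mul_le_mul (aa_bound _ _ _) (AA_bound _ _ _) (abs_nonneg _) (by positivity)

lemma mid_dep (n : ℕ) (i : ℤ) : DependsOn (mid n i) (Icc i (i + n)) := by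
  intro x y h
  unfold mid aa AA
  congr 1
  · refine Finset.sum_congr rfl fun k hk => ?_
    rw [Finset.mem_range] at hk
    congr 1
    apply D_dep
    rintro j ⟨m, hm, rfl⟩
    apply h; constructor <;> omega
  · refine Finset.sum_congr rfl fun k hk => ?_
    rw [Finset.mem_range] at hk
    congr 1
    apply D_dep
    rintro j ⟨m, hm, rfl⟩
    apply h; constructor <;> omega

lemma aa_rec (n : ℕ) (i : ℤ) (T) :
    aa (n + 1) i T = 1 - c (T (i + 1)) (T i) * aa n (i + 1) T := by
  unfold aa
  rw [Finset.sum_range_succ', Finset.mul_sum]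
  simp only [D, pow_zero, mul_one]
  rw [sub_eq_neg_add, ← Finset.sum_neg_distrib]
  congr 1
  refine Finset.sum_congr rfl fun k _ => ?_
  ring

lemma AA_rec (n : ℕ) (i : ℤ) (T) :
    ∃ r, AA (n + 1) i T = AA n (i + 1) T + c (T i) (T (i + 1)) * r := by
  unfold AA
  have e : i + 1 + (n : ℤ) = i + (n + 1 : ℕ) := by push_cast; ring
  rw [Finset.sum_range_succ, D_succ_right, e]
  refine ⟨(-1) ^ (n + 1) * D (-1) (i + (n + 1 : ℕ)) n T, ?_⟩
  have e1 : i + ((n + 1 : ℕ) : ℤ) + -1 * (n + 1) = i := by push_cast; ring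
  have e2 : i + ((n + 1 : ℕ) : ℤ) + -1 * n = i + 1 := by push_cast; ring
  rw [e1, e2]; ring

lemma c_mul_c (a b : ℝ) : c a b * c b a = 0 := by
  unfold c
  split_ifs <;> first | linarith | simp

lemma mid_rec (n : ℕ) (i : ℤ) (T) :
    mid (n + 1) i T = AA (n + 1) i T - c (T (i + 1)) (T i) * mid n (i + 1) T := by
  obtain ⟨r, hr⟩ := AA_rec n i T
  unfold mid
  rw [aa_rec, hr]
  have := c_mul_c (T (i + 1)) (T i)
  linear_combination (-(aa n (i + 1) T * r)) * this

lemma integrable_bdd {P : Measure (ℤ → ℝ)} [IsProbabilityMeasure P] {F : (ℤ → ℝ) → ℝ}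
    (hF : Measurable F) (C : ℝ) (hb : ∀ T, |F T| ≤ C) : Integrable F P :=
  Integrable.of_bound hF.aestronglyMeasurable C (Filter.Eventually.of_forall fun T => hb T)

lemma exp_AA {P : Measure (ℤ → ℝ)} (hP : IsUniformProduct P) (i : ℤ) (n : ℕ) {x y : ℝ}
    (hx : x ∈ Icc (0 : ℝ) 1) (hy : y ∈ Icc (0 : ℝ) 1) :
    ∫ T, AA (n + 1) i (Function.update (Function.update T (i + (n + 1 : ℕ)) y) i x) ∂P =
      p (n + 1) y +
        (-1) ^ (n + 1) * (if x < y then (y - x) ^ n / (Nat.factorial n : ℝ) else 0) := by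
  have := prob hP
  have hi : ∀ k, Integrable (fun T => (-1) ^ k * D (-1) (i + (n + 1 : ℕ)) k
      (Function.update (Function.update T (i + (n + 1 : ℕ)) y) i x)) P := fun k =>
    (integrable_bdd (by fun_prop) 1 (fun T => D_abs _ _ _ _)).const_mul _
  unfold AA
  rw [integral_finsetSum _ (fun k _ => hi k), Finset.sum_range_succ]
  congr 1
  · unfold p
    refine Finset.sum_congr rfl fun k hk => ?_
    rw [Finset.mem_range] at hk
    rw [integral_const_mul]
    have : ∀ T : ℤ → ℝ, D (-1) (i + (n + 1 : ℕ)) k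
      (Function.update (Function.update T (i + (n + 1 : ℕ)) y) i x) = D (-1) (i + (n + 1 : ℕ)) k
      (Function.update T (i + (n + 1 : ℕ)) y) := by
      intro T
      apply D_upd
      intro m hm
      push_cast
      omega
    simp only [this]
    rw [exp_D hP (Or.inr rfl) _ k hy, q, neg_pow y]
    ring
  · rw [integral_const_mul]
    have := exp_W hP (Or.inr rfl) (i + (n + 1 : ℕ)) n hx hy
    rw [show i + ((n + 1 : ℕ) : ℤ) + -1 * (n + 1) = i by push_cast; ring] at this
    rw [this]

lemma exp_mid {P : Measure (ℤ → ℝ)} (hP : IsUniformProduct P) (i : ℤ) (n : ℕ) {x y : ℝ}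
    (hx : x ∈ Icc (0 : ℝ) 1) (hy : y ∈ Icc (0 : ℝ) 1) (hxy : x ≠ y) :
    ∫ T, mid (n + 1) i (Function.update (Function.update T (i + (n + 1 : ℕ)) y) i x) ∂P =
      kap n x y := by
  have := prob hP
  induction n generalizing i x with
  | zero =>
    have h0 : ∀ T : ℤ → ℝ, mid (0 + 1) i
        (Function.update (Function.update T (i + (0 + 1 : ℕ)) y) i x) =
        AA (0 + 1) i (Function.update (Function.update T (i + (0 + 1 : ℕ)) y) i x) - c y x := by
      intro T
      rw [mid_rec]
      have : mid 0 (i + 1)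
          (Function.update (Function.update T (i + (0 + 1 : ℕ)) y) i x) = 1 := by
        simp [mid, aa, AA, D]
      rw [this]
      simp
    simp only [h0]
    rw [integral_sub (integrable_bdd (by fun_prop) _ (fun T => AA_bound _ _ _))
      (integrable_const _), exp_AA hP i 0 hx hy]
    simp only [p, q, kap, c]
    rcases lt_or_gt_of_ne hxy with h | h
    · simp [h, h.not_gt]; norm_num
    · simp [h, h.not_gt]; norm_num
  | succ n ih =>
    have e : i + 1 + ((n + 1 : ℕ) : ℤ) = i + ((n + 1 + 1 : ℕ) : ℤ) := by push_cast; ring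
    have h0 : ∀ T : ℤ → ℝ, mid (n + 1 + 1) i
        (Function.update (Function.update T (i + (n + 1 + 1 : ℕ)) y) i x) =
        AA (n + 1 + 1) i (Function.update (Function.update T (i + (n + 1 + 1 : ℕ)) y) i x) -
        c (T (i + 1)) x * mid (n + 1) (i + 1)
          (Function.update T (i + 1 + (n + 1 : ℕ)) y) := by
      intro T
      rw [mid_rec, e]
      congr 2
      · rw [Function.update_self, Function.update_of_ne (by omega),
          Function.update_of_ne (by push_cast; omega)]
      · apply mid_dep
        intro j hj
        rw [Function.update_of_ne]
        have := hj.1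
        omega
    have hm : Measurable (fun T : ℤ → ℝ => c (T (i + 1)) x * mid (n + 1) (i + 1)
          (Function.update T (i + 1 + (n + 1 : ℕ)) y)) := by fun_prop
    have hb : ∀ T : ℤ → ℝ, |c (T (i + 1)) x * mid (n + 1) (i + 1)
          (Function.update T (i + 1 + (n + 1 : ℕ)) y)| ≤
          1 * ((((n + 1 : ℕ) : ℝ) + 1) * (((n + 1 : ℕ) : ℝ) + 1)) := by
      intro T
      rw [abs_mul, abs_of_nonneg (c_nonneg _ _)]
      exact mul_le_mul (c_le _ _) (mid_bound _ _ _) (abs_nonneg _) zero_le_one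
    simp only [h0]
    rw [integral_sub (integrable_bdd (by fun_prop) _ (fun T => AA_bound _ _ _))
      (integrable_bdd hm _ hb), exp_AA hP i (n + 1) hx hy, integral_peel hP (i + 1) hm hb,
      kap_rec n hy.1, ← int_c _ hx]
    congr 1
    apply integral_congr_ae
    filter_upwards [lam_mem, lam_ne y] with z hz hzy
    simp only [Function.update_self]
    rw [integral_const_mul, ← ih (i + 1) hz hzy]
    congr 2 with T
    rw [Function.update_comm]
    push_cast
    omega

/-- Occupation indicator. -/
def occ (t : ℝ) (s : ℤ) (T : ℤ → ℝ) : ℝ := c (T s) t * (e (-1) s T * e 1 s T)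

lemma O_eq (t : ℝ) (s : ℤ) : O t s = {T | T s < t} ∩ (Ev (-1) s ∩ Ev 1 s) := by
  ext T
  simp only [O, G, mem_iUnion, mem_ofPred_eq, Ev, mem_inter_iff]
  have a1 : ∀ j : ℕ, s + -1 * ((j : ℤ) + 1) = s - j - 1 := fun j => by ring
  have a2 : ∀ j : ℕ, s + -1 * (j : ℤ) = s - j := fun j => by ring
  have a3 : ∀ j : ℕ, s + -1 * (2 * (j : ℤ)) = s - 2 * j := fun j => by ring
  have a4 : ∀ j : ℕ, s + -1 * (2 * (j : ℤ) + 1) = s - 2 * j - 1 := fun j => by ring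
  have b1 : ∀ j : ℕ, s + 1 * ((j : ℤ) + 1) = s + j + 1 := fun j => by ring
  have b2 : ∀ j : ℕ, s + 1 * (j : ℤ) = s + j := fun j => by ring
  have b3 : ∀ j : ℕ, s + 1 * (2 * (j : ℤ)) = s + 2 * j := fun j => by ring
  have b4 : ∀ j : ℕ, s + 1 * (2 * (j : ℤ) + 1) = s + 2 * j + 1 := fun j => by ring
  simp only [a1, a2, a3, a4, b1, b2, b3, b4]
  constructor
  · rintro ⟨j, k, h1, h2, h3, h4, h5⟩
    exact ⟨h1, ⟨j, h2, h3⟩, ⟨k, h4, h5⟩⟩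
  · rintro ⟨h1, ⟨j, h2, h3⟩, ⟨k, h4, h5⟩⟩
    exact ⟨j, k, h1, h2, h3, h4, h5⟩

lemma meas_O (t : ℝ) (s : ℤ) : MeasurableSet (O t s) := by
  rw [O_eq]
  exact (measurableSet_lt (by fun_prop) (by fun_prop)).inter ((meas_Ev _ _).inter (meas_Ev _ _))

lemma occ_eq (t : ℝ) (s : ℤ) (T) : (O t s).indicator 1 T = occ t s T := by
  rw [O_eq, Set.inter_indicator_one, Set.inter_indicator_one]
  simp only [Pi.mul_apply, occ, e, c]
  congr 1

lemma PO (P : Measure (ℤ → ℝ)) (t : ℝ) (s : ℤ) : (P (O t s)).toReal = ∫ T, occ t s T ∂P := by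
  have := integral_indicator_one (μ := P) (meas_O t s)
  rw [Measure.real] at this
  rw [← this]
  congr 1 with T
  exact occ_eq t s T

lemma POO (P : Measure (ℤ → ℝ)) (t : ℝ) (s r : ℤ) :
    (P (O t s ∩ O t r)).toReal = ∫ T, occ t s T * occ t r T ∂P := by
  have := integral_indicator_one (μ := P) ((meas_O t s).inter (meas_O t r))
  rw [Measure.real] at this
  rw [← this]
  congr 1 with T
  rw [Set.inter_indicator_one, Pi.mul_apply, occ_eq, occ_eq]

lemma mul_bdd {a b A B : ℝ} (ha : |a| ≤ A) (hb : |b| ≤ B) : |a * b| ≤ A * B := by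
  rw [abs_mul]
  exact mul_le_mul ha hb (abs_nonneg _) ((abs_nonneg _).trans ha)

lemma c_abs (a b : ℝ) : |c a b| ≤ 1 := by
  rw [abs_of_nonneg (c_nonneg _ _)]; exact c_le _ _

lemma eupd_dep {ε : ℤ} (i : ℤ) (x : ℝ) :
    DependsOn (fun T : ℤ → ℝ => e ε i (Function.update T i x))
      {j | j ≠ i ∧ ∃ m : ℕ, j = i + ε * m} := by
  intro T T' h
  apply e_dep
  rintro j hj
  by_cases hji : j = i
  · subst hji; simp
  · rw [Function.update_of_ne hji, Function.update_of_ne hji]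
    exact h j ⟨hji, hj⟩

lemma rho {P : Measure (ℤ → ℝ)} (hP : IsUniformProduct P) {t : ℝ} (ht : t ∈ Icc (0 : ℝ) 1)
    (s : ℤ) : (P (O t s)).toReal = (1 - Real.exp (-2 * t)) / 2 := by
  rw [PO, integral_peel hP s (F := occ t s) (C := 1 * (1 * 1)) (by unfold occ; fun_prop)
    (fun T => mul_bdd (c_abs _ _) (mul_bdd (e_abs _ _ _) (e_abs _ _ _))), ← rho_int,
    ← int_c _ ht]
  apply integral_congr_ae
  filter_upwards [exp_e hP (Or.inl rfl) s, exp_e hP (Or.inr rfl) s] with x h1 h2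
  simp only [occ, Function.update_self]
  rw [integral_const_mul, integral_indep hP (Iio s) (by fun_prop) (by fun_prop), h1, h2]
  · refine (eupd_dep s x).mono ?_
    rintro j ⟨hj, m, rfl⟩
    simp only [mem_Iio]; omega
  · refine (eupd_dep s x).mono ?_
    rintro j ⟨hj, m, rfl⟩
    simp only [mem_compl_iff, mem_Iio]; omega

lemma pair_expand {n : ℕ} {t : ℝ} {T : ℤ → ℝ} (h1 : Good 1 T) (h2 : Good (-1) T) :
    occ t 0 T * occ t n T =
      c (T 0) t * (c (T n) t * (e (-1) 0 T * (mid n 0 T * e 1 n T))) := by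
  have a1 : e 1 0 T * e 1 n T = aa n 0 T * e 1 n T := by
    have := e_expand h1 0 n
    rw [this, aa, Finset.sum_range_succ, add_mul, add_mul]
    simp only [zero_add, one_mul]
    rw [mul_assoc, e_idem]
  have a2 : e (-1) n T * e (-1) 0 T = AA n 0 T * e (-1) 0 T := by
    have := e_expand h2 n n
    rw [this, AA, Finset.sum_range_succ, add_mul, add_mul]
    simp only [zero_add]
    rw [show (n : ℤ) + -1 * n = 0 by ring, mul_assoc, e_idem]
  unfold occ mid
  calc _ = c (T 0) t * c (T n) t * (e 1 0 T * e 1 n T) * (e (-1) n T * e (-1) 0 T) := by ring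
    _ = _ := by rw [a1, a2]; ring

lemma pair_int {P : Measure (ℤ → ℝ)} (hP : IsUniformProduct P) {t : ℝ} (N : ℕ) :
    (P (O t 0 ∩ O t (N + 1 : ℕ))).toReal =
      ∫ x, ∫ y, c x t * c y t * (Real.exp (-x) * Real.exp (-y) * kap N x y) ∂lam ∂lam := by
  have := prob hP
  have hN : (0 : ℤ) ≠ ((N + 1 : ℕ) : ℤ) := by push_cast; omega
  rw [POO]
  have h0 : ∀ᵐ T ∂P, occ t 0 T * occ t (N + 1 : ℕ) T = c (T 0) t * (c (T (N + 1 : ℕ)) t *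
      (e (-1) 0 T * (mid (N + 1) 0 T * e 1 (N + 1 : ℕ) T))) := by
    filter_upwards [ae_good hP (Or.inl rfl), ae_good hP (Or.inr rfl)] with T h1 h2
    exact pair_expand h1 h2
  have hb : ∀ T : ℤ → ℝ, |c (T 0) t * (c (T (N + 1 : ℕ)) t *
      (e (-1) 0 T * (mid (N + 1) 0 T * e 1 (N + 1 : ℕ) T)))| ≤ _ := fun T =>
    mul_bdd (c_abs _ _) (mul_bdd (c_abs _ _) (mul_bdd (e_abs _ _ _)
      (mul_bdd (mid_bound _ _ _) (e_abs _ _ _))))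
  rw [integral_congr_ae h0, integral_peel hP 0 (by fun_prop) hb]
  apply integral_congr_ae
  filter_upwards [lam_mem, exp_e hP (Or.inr rfl) 0] with x hx hex
  rw [integral_peel hP (N + 1 : ℕ) (by fun_prop) (fun T => hb (Function.update T 0 x))]
  apply integral_congr_ae
  filter_upwards [lam_mem, lam_ne x, exp_e hP (Or.inl rfl) (N + 1 : ℕ)] with y hy hyx hey
  have h1 : ∀ T : ℤ → ℝ, e (-1) 0
      (Function.update (Function.update T ((N + 1 : ℕ) : ℤ) y) 0 x) =
      e (-1) 0 (Function.update T 0 x) := by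
    intro T
    rw [Function.update_comm hN.symm]
    apply e_dep
    rintro j ⟨m, rfl⟩
    rw [Function.update_of_ne]
    push_cast; omega
  have h2 : ∀ T : ℤ → ℝ, e 1 (N + 1 : ℕ)
      (Function.update (Function.update T ((N + 1 : ℕ) : ℤ) y) 0 x) =
      e 1 (N + 1 : ℕ) (Function.update T ((N + 1 : ℕ) : ℤ) y) := by
    intro T
    apply e_dep
    rintro j ⟨m, rfl⟩
    rw [Function.update_of_ne]
    push_cast; omega
  have hmid := exp_mid hP 0 N hx hy hyx.symm
  rw [zero_add] at hmid
  have dm : DependsOn (fun T : ℤ → ℝ => mid (N + 1) 0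
      (Function.update (Function.update T ((N + 1 : ℕ) : ℤ) y) 0 x)) (Ioo 0 ((N + 1 : ℕ) : ℤ)) := by
    intro T T' h
    apply mid_dep
    intro j hj
    by_cases hj0 : j = 0
    · subst hj0; simp
    · by_cases hj1 : j = ((N + 1 : ℕ) : ℤ)
      · subst hj1; rw [Function.update_of_ne hj0, Function.update_of_ne hj0, Function.update_self, Function.update_self]
      · simp only [Function.update_of_ne hj0, Function.update_of_ne hj1]
        apply h
        have := hj.1
        have := hj.2
        constructor <;> omega
  have de : DependsOn (fun T : ℤ → ℝ => e 1 (N + 1 : ℕ)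
      (Function.update T ((N + 1 : ℕ) : ℤ) y)) (Ioi ((N + 1 : ℕ) : ℤ)) := by
    refine (eupd_dep _ y).mono ?_
    rintro j ⟨hj, m, rfl⟩
    simp only [mem_Ioi]; omega
  simp only [h1, h2, Function.update_self, Function.update_of_ne hN.symm]
  rw [integral_const_mul, integral_const_mul, integral_indep hP (Iio 0) (by fun_prop)
    (by fun_prop), integral_indep hP (Iio ((N + 1 : ℕ) : ℤ)) (by fun_prop)
    (by fun_prop), hmid, hex, hey]
  · ring
  · refine dm.mono ?_
    intro j hj
    exact hj.2
  · refine de.mono ?_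
    intro j hj
    simp only [mem_compl_iff, mem_Iio]
    have := mem_Ioi.1 hj
    omega
  · refine (eupd_dep 0 x).mono ?_
    rintro j ⟨hj, m, rfl⟩
    simp only [mem_Iio]; omega
  · intro T T' h
    have k1 := dm (x := T) (y := T') (fun j hj => h j (by
      have := hj.1
      simp only [mem_compl_iff, mem_Iio]; omega))
    have k2 := de (x := T) (y := T') (fun j hj => h j (by
      have := mem_Ioi.1 hj
      simp only [mem_compl_iff, mem_Iio]; omega))
    simp only at k1 k2 ⊢
    rw [k1, k2]

end

end RSA

theorem pair_correlation (P : Measure (ℤ → ℝ)) (hP : IsUniformProduct P)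
    (t : ℝ) (ht : t ∈ Icc (0 : ℝ) 1) (s : ℕ) :
    (P (O t 0 ∩ O t s)).toReal - (P (O t 0)).toReal * (P (O t s)).toReal =
      -(1 / 2) * Real.exp (-2 * t) *
        ∑' n : ℕ, (-2 * t) ^ (2 * n + s + 1) / (Nat.factorial (2 * n + s + 1)) := by
  change _ = RSA.FF s t
  rw [RSA.rho hP ht, RSA.rho hP ht]
  cases s with
  | zero =>
    rw [Nat.cast_zero, inter_self, RSA.rho hP ht, RSA.FF_zero]
    have h1 : Real.exp (-4 * t) = Real.exp (-2 * t) * Real.exp (-2 * t) := by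
      rw [← Real.exp_add]; ring_nf
    rw [h1]; ring
  | succ N =>
    rw [RSA.pair_int hP N, RSA.sym_int (h := fun x y => Real.exp (-x) * Real.exp (-y) *
      RSA.kap N x y) _ _ ht]
    · have : ∫ x in (0 : ℝ)..t, 2 * ∫ y in (0 : ℝ)..x,
          Real.exp (-x) * Real.exp (-y) * RSA.kap N x y =
          ∫ x in (0 : ℝ)..t, Real.exp (-2 * x) * (1 - RSA.p (N + 1) (2 * x)) := by
        apply intervalIntegral.integral_congr
        intro x hx
        rw [uIcc_of_le ht.1] at hx
        exact RSA.inner_int N hx.1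
      rw [this, RSA.final_int]
      ring
    · fun_prop
    · intro x y
      rw [RSA.kap_symm]; ring
end

section
/- For every t ∈ [0,1] and every even integer s ≥ 2, the probability γ_s(t) := ℙ(O_{−1}(t)^c ∩ O_0(t)^c ∩ O_s(t)) that sites −1 and 0 are vacant and site s is occupied at time t satisfies γ_s(t) = −(1/2) e^{−2t} ∑_{i=1}^{s} (−2t)^i/i!. -/
open MeasureTheory Set

open Filter Topology

/-- The uniform measure on the unit interval. -/
noncomputable def mu : Measure ℝ := volume.restrict (Icc (0 : ℝ) 1)

instance : IsProbabilityMeasure mu := ⟨by simp [mu]⟩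

lemma isProb (P : Measure (ℤ → ℝ)) (hP : IsUniformProduct P) : IsProbabilityMeasure P := by
  constructor
  have := hP ∅ (fun _ => univ) (by simp)
  simpa using this

lemma ae_mem (P : Measure (ℤ → ℝ)) (hP : IsUniformProduct P) :
    ∀ᵐ T ∂P, ∀ i, T i ∈ Icc (0 : ℝ) 1 := by
  rw [ae_all_iff]
  intro i
  have := hP {i} (fun _ => (Icc (0 : ℝ) 1)ᶜ) (by simp)
  rw [ae_iff]
  simpa using this

lemma eq_inf (P : Measure (ℤ → ℝ)) (hP : IsUniformProduct P) :
    P = Measure.infinitePi (fun _ : ℤ => mu) := by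
  apply Measure.eq_infinitePi
  intro F A hA
  exact hP F A (fun i _ => hA i)

lemma resample_map (P : Measure (ℤ → ℝ)) (hP : IsUniformProduct P) (i : ℤ) :
    (P.prod mu).map (fun p : (ℤ → ℝ) × ℝ => Function.update p.1 i p.2) = P := by
  have := isProb P hP
  have hm : Measurable (fun p : (ℤ → ℝ) × ℝ => Function.update p.1 i p.2) := by
    rw [measurable_pi_iff]
    intro j
    by_cases h : j = i
    · subst h; simpa using measurable_snd
    · simp only [Function.update_of_ne h]; fun_prop
  rw [eq_inf P hP]
  apply Measure.eq_infinitePi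
  intro F A hA
  rw [← eq_inf P hP, Measure.map_apply hm (MeasurableSet.pi F.countable_toSet (fun i _ => hA i))]
  have : (fun p : (ℤ → ℝ) × ℝ => Function.update p.1 i p.2) ⁻¹' (Set.pi F A) =
      {T | ∀ j ∈ F.erase i, T j ∈ A j} ×ˢ (if i ∈ F then A i else univ) := by
    ext ⟨T, x⟩
    simp only [mem_preimage, Set.mem_pi, mem_prod, Set.mem_ofPred_eq, Finset.mem_erase, Finset.mem_coe]
    constructor
    · intro h
      refine ⟨fun j hj => ?_, ?_⟩
      · have := h j hj.2
        rwa [Function.update_of_ne hj.1] at this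
      · split_ifs with hi
        · simpa using h i hi
        · trivial
    · rintro ⟨h1, h2⟩ j hj
      by_cases hji : j = i
      · subst hji
        simpa [hj] using h2
      · rw [Function.update_of_ne hji]; exact h1 j ⟨hji, hj⟩
  rw [this, Measure.prod_prod, hP _ _ (fun i _ => hA i)]
  by_cases hi : i ∈ F
  · simp only [hi, if_true]
    exact Finset.prod_erase_mul F (fun j => mu (A j)) hi
  · simp only [hi, if_false, measure_univ, mul_one, Finset.erase_eq_of_notMem hi]
    rfl

/-- Measurable functions which are bounded on the unit cube. -/
def Nice (F : (ℤ → ℝ) → ℝ) : Prop :=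
  Measurable F ∧ ∃ C, ∀ T : ℤ → ℝ, (∀ i, T i ∈ Icc (0 : ℝ) 1) → |F T| ≤ C

lemma Nice.integrable {P : Measure (ℤ → ℝ)} (hP : IsUniformProduct P) {F : (ℤ → ℝ) → ℝ}
    (hF : Nice F) : Integrable F P := by
  have := isProb P hP
  obtain ⟨hm, C, hC⟩ := hF
  apply Integrable.of_bound hm.aestronglyMeasurable C
  filter_upwards [ae_mem P hP] with T hT
  exact hC T hT

lemma Nice.mul {F H : (ℤ → ℝ) → ℝ} (hF : Nice F) (hH : Nice H) : Nice (fun T => F T * H T) := by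
  obtain ⟨hm, C, hC⟩ := hF
  obtain ⟨hm', C', hC'⟩ := hH
  refine ⟨hm.mul hm', C * C', fun T hT => ?_⟩
  rw [abs_mul]
  exact mul_le_mul (hC T hT) (hC' T hT) (abs_nonneg _) ((abs_nonneg _).trans (hC T hT))

lemma Nice.add {F H : (ℤ → ℝ) → ℝ} (hF : Nice F) (hH : Nice H) : Nice (fun T => F T + H T) := by
  obtain ⟨hm, C, hC⟩ := hF
  obtain ⟨hm', C', hC'⟩ := hH
  exact ⟨hm.add hm', C + C', fun T hT => (abs_add_le _ _).trans (add_le_add (hC T hT) (hC' T hT))⟩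

lemma Nice.const (c : ℝ) : Nice (fun _ => c) := ⟨measurable_const, |c|, fun _ _ => le_rfl⟩

lemma Nice.sub {F H : (ℤ → ℝ) → ℝ} (hF : Nice F) (hH : Nice H) : Nice (fun T => F T - H T) := by
  have := hF.add ((Nice.const (-1)).mul hH)
  simpa [sub_eq_add_neg] using this

lemma Nice.sum {ι : Type*} (S : Finset ι) {F : ι → (ℤ → ℝ) → ℝ} (hF : ∀ i ∈ S, Nice (F i)) :
    Nice (fun T => ∑ i ∈ S, F i T) := by
  classical
  induction S using Finset.induction_on with
  | empty => simpa using Nice.const 0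
  | insert a S ha ih =>
    simp only [Finset.sum_insert ha]
    exact (hF a (by simp)).add (ih fun i hi => hF i (by simp [hi]))

lemma Nice.cont {h : ℝ → ℝ} (hc : Continuous h) (i : ℤ) : Nice (fun T => h (T i)) := by
  refine ⟨hc.measurable.comp (measurable_pi_apply i), ?_⟩
  obtain ⟨C, hC⟩ := (isCompact_Icc (a := (0:ℝ)) (b := 1)).exists_bound_of_continuousOn
    hc.continuousOn
  exact ⟨C, fun T hT => hC _ (hT i)⟩

open Classical in
/-- Real-valued indicator of a proposition. -/
noncomputable def ind (p : Prop) : ℝ := if p then 1 else 0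

lemma ind_true {p : Prop} (h : p) : ind p = 1 := by simp [ind, h]
lemma ind_false {p : Prop} (h : ¬ p) : ind p = 0 := by simp [ind, h]
lemma ind_and (p q : Prop) : ind (p ∧ q) = ind p * ind q := by
  by_cases hp : p <;> by_cases hq : q <;> simp [ind, hp, hq]
lemma ind_not (p : Prop) : ind (¬ p) = 1 - ind p := by
  by_cases hp : p <;> simp [ind, hp]
lemma abs_ind (p : Prop) : |ind p| ≤ 1 := by
  by_cases hp : p <;> simp [ind, hp]

lemma Nice.ind {p : (ℤ → ℝ) → Prop} (hp : MeasurableSet {T | p T}) : Nice (fun T => ind (p T)) := by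
  refine ⟨?_, 1, fun T _ => abs_ind _⟩
  unfold _root_.ind
  exact Measurable.ite hp measurable_const measurable_const

lemma resample (P : Measure (ℤ → ℝ)) (hP : IsUniformProduct P) (i : ℤ) {F : (ℤ → ℝ) → ℝ}
    (hF : Nice F) : ∫ T, F T ∂P = ∫ T, ∫ x, F (Function.update T i x) ∂mu ∂P := by
  have := isProb P hP
  have hm : Measurable (fun p : (ℤ → ℝ) × ℝ => Function.update p.1 i p.2) := by
    rw [measurable_pi_iff]
    intro j
    by_cases h : j = i
    · subst h; simpa using measurable_snd
    · simp only [Function.update_of_ne h]; fun_prop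
  have hI := hF.integrable hP
  rw [← resample_map P hP i] at hI
  conv_lhs => rw [← resample_map P hP i]
  rw [integral_map hm.aemeasurable hI.aestronglyMeasurable]
  exact integral_prod _ (hI.comp_measurable hm)


/-- `F` does not depend on coordinate `i`. -/
def Ins (F : (ℤ → ℝ) → ℝ) (i : ℤ) : Prop := ∀ T x, F (Function.update T i x) = F T

lemma Ins.mul {F H : (ℤ → ℝ) → ℝ} {i : ℤ} (hF : Ins F i) (hH : Ins H i) :
    Ins (fun T => F T * H T) i := fun T x => by simp only [hF T x, hH T x]

lemma Ins.sub {F H : (ℤ → ℝ) → ℝ} {i : ℤ} (hF : Ins F i) (hH : Ins H i) :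
    Ins (fun T => F T - H T) i := fun T x => by simp only [hF T x, hH T x]

lemma Ins.const (c : ℝ) (i : ℤ) : Ins (fun _ => c) i := fun _ _ => rfl

lemma Ins.sum {ι : Type*} (S : Finset ι) {F : ι → (ℤ → ℝ) → ℝ} {i : ℤ}
    (hF : ∀ k ∈ S, Ins (F k) i) : Ins (fun T => ∑ k ∈ S, F k T) i :=
  fun T x => Finset.sum_congr rfl fun k hk => hF k hk T x

lemma Ins.coord (h : ℝ → ℝ) {i j : ℤ} (hij : j ≠ i) : Ins (fun T => h (T j)) i :=
  fun T x => by simp only [Function.update_of_ne hij]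

lemma step (P : Measure (ℤ → ℝ)) (hP : IsUniformProduct P) {i j : ℤ} (hij : j ≠ i)
    {F : (ℤ → ℝ) → ℝ} (hI : Ins F i) {k : ℝ → ℝ → ℝ} {K : ℝ → ℝ}
    (hk : Nice (fun T => F T * k (T i) (T j)))
    (hK : ∀ y ∈ Icc (0 : ℝ) 1, ∫ x, k x y ∂mu = K y) :
    ∫ T, F T * k (T i) (T j) ∂P = ∫ T, F T * K (T j) ∂P := by
  rw [resample P hP i hk]
  apply integral_congr_ae
  filter_upwards [ae_mem P hP] with T hT
  have : ∀ x, F (Function.update T i x) * k (Function.update T i x i) (Function.update T i x j)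
      = F T * k x (T j) := by
    intro x
    rw [hI T x, Function.update_self, Function.update_of_ne hij]
  simp only [this]
  rw [integral_const_mul, hK _ (hT j)]

lemma step0 (P : Measure (ℤ → ℝ)) (hP : IsUniformProduct P) {i : ℤ}
    {F : (ℤ → ℝ) → ℝ} (hI : Ins F i) {k : ℝ → ℝ} 
    (hk : Nice (fun T => F T * k (T i))) :
    ∫ T, F T * k (T i) ∂P = (∫ T, F T ∂P) * ∫ x, k x ∂mu := by
  rw [step P hP (i := i) (j := i + 1) (by omega) hI (k := fun x _ => k x)
    (K := fun _ => ∫ x, k x ∂mu) hk (fun _ _ => rfl), integral_mul_const]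

lemma mu_ind (S : Set ℝ) (hS : MeasurableSet S) (h : ℝ → ℝ) :
    ∫ x, ind (x ∈ S) * h x ∂mu = ∫ x in S ∩ Icc 0 1, h x := by
  rw [← Measure.restrict_restrict hS, ← integral_indicator hS]
  apply integral_congr_ae
  filter_upwards with x
  by_cases hx : x ∈ S <;> simp [ind, hx]

lemma mu_lt {y : ℝ} (hy : y ∈ Icc (0 : ℝ) 1) (h : ℝ → ℝ) :
    ∫ x, ind (x < y) * h x ∂mu = ∫ x in (0:ℝ)..y, h x := by
  have := mu_ind (Iio y) measurableSet_Iio h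
  simp only [mem_Iio] at this
  rw [this, intervalIntegral.integral_of_le hy.1, ← integral_Ico_eq_integral_Ioc]
  congr 2
  ext x
  simp only [mem_inter_iff, mem_Iio, mem_Icc, mem_Ico]
  constructor
  · rintro ⟨h1, h2, h3⟩; exact ⟨h2, h1⟩
  · rintro ⟨h1, h2⟩; exact ⟨h2, h1, by linarith [hy.2]⟩

lemma mu_between {y t : ℝ} (hy : y ∈ Icc (0 : ℝ) 1) (ht : t ∈ Icc (0 : ℝ) 1) (h : ℝ → ℝ) :
    ∫ x, ind (y < x) * (ind (x < t) * h x) ∂mu = ind (y < t) * ∫ x in y..t, h x := by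
  have := mu_ind (Ioo y t) measurableSet_Ioo h
  simp only [mem_Ioo, ind_and, mul_assoc] at this
  rw [this]
  by_cases hyt : y < t
  · rw [ind_true hyt, one_mul, intervalIntegral.integral_of_le hyt.le,
      integral_Ioc_eq_integral_Ioo]
    congr 2
    rw [inter_eq_left]
    intro x hx
    exact ⟨hy.1.trans hx.1.le, hx.2.le.trans ht.2⟩
  · rw [ind_false hyt, Ioo_eq_empty hyt]; simp

/-- Descending chain of length `k` along the sequence of sites `c`. -/
def Chain (c : ℕ → ℤ) (k : ℕ) (T : ℤ → ℝ) : Prop := ∀ i < k, T (c (i + 1)) < T (c i)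

lemma chain_succ (c : ℕ → ℤ) (k : ℕ) (T : ℤ → ℝ) :
    Chain c (k + 1) T ↔ Chain c k T ∧ T (c (k + 1)) < T (c k) := by
  constructor
  · intro h; exact ⟨fun i hi => h i (by omega), h k (by omega)⟩
  · rintro ⟨h1, h2⟩ i hi
    rcases Nat.lt_succ_iff_lt_or_eq.mp hi with h | rfl
    · exact h1 i h
    · exact h2

lemma chain_succ' (c : ℕ → ℤ) (k : ℕ) (T : ℤ → ℝ) :
    Chain c (k + 1) T ↔ T (c 1) < T (c 0) ∧ Chain (fun i => c (i + 1)) k T := by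
  constructor
  · intro h; exact ⟨h 0 (by omega), fun i hi => h (i + 1) (by omega)⟩
  · rintro ⟨h1, h2⟩ i hi
    rcases i with _ | i
    · exact h1
    · exact h2 i (by omega)

lemma meas_lt (i j : ℤ) : MeasurableSet {T : ℤ → ℝ | T i < T j} :=
  measurableSet_lt (measurable_pi_apply i) (measurable_pi_apply j)

lemma meas_lt_c (i : ℤ) (t : ℝ) : MeasurableSet {T : ℤ → ℝ | T i < t} :=
  measurableSet_lt (measurable_pi_apply i) measurable_const

lemma meas_chain (c : ℕ → ℤ) (k : ℕ) : MeasurableSet {T | Chain c k T} := by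
  induction k with
  | zero => simp [Chain]
  | succ k ih =>
    simp only [chain_succ]
    exact ih.inter (meas_lt _ _)

lemma Nice.chain (c : ℕ → ℤ) (k : ℕ) : Nice (fun T => _root_.ind (Chain c k T)) :=
  Nice.ind (meas_chain c k)

lemma Ins.chain {c : ℕ → ℤ} {k : ℕ} {i : ℤ} (h : ∀ j ≤ k, c j ≠ i) :
    Ins (fun T => ind (Chain c k T)) i := by
  intro T x
  have : Chain c k (Function.update T i x) ↔ Chain c k T := by
    refine forall₂_congr fun j hj => ?_
    rw [Function.update_of_ne (h _ (by omega)), Function.update_of_ne (h _ (by omega))]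
  simp only [this]

lemma desc (P : Measure (ℤ → ℝ)) (hP : IsUniformProduct P) {c : ℕ → ℤ}
    (hc : Function.Injective c) {H : ℕ → ℝ → ℝ} (hH : ∀ j, Continuous (H j))
    (hH' : ∀ j, ∀ y ∈ Icc (0 : ℝ) 1, ∫ x in (0:ℝ)..y, H j x = H (j + 1) y)
    {F : (ℤ → ℝ) → ℝ} (hF : Nice F) (k : ℕ) :
    ∀ p, (∀ i, 1 ≤ i → i ≤ k → Ins F (c i)) →
    ∫ T, F T * (ind (Chain c k T) * H p (T (c k))) ∂P = ∫ T, F T * H (p + k) (T (c 0)) ∂P := by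
  induction k with
  | zero => intro p _; simp [Chain, ind]
  | succ k ih =>
    intro p hI
    rw [show p + (k + 1) = (p + 1) + k by ring, ← ih (p + 1) (fun i h1 h2 => hI i h1 (by omega))]
    have e : ∀ T, F T * (ind (Chain c (k + 1) T) * H p (T (c (k + 1)))) =
      (F T * ind (Chain c k T)) * (ind (T (c (k + 1)) < T (c k)) * H p (T (c (k + 1)))) := by
      intro T; rw [chain_succ, ind_and]; ring
    simp only [e, ← mul_assoc (F _) (ind _) (H (p + 1) _)]
    apply step P hP (i := c (k + 1)) (j := c k) (F := fun T => F T * ind (Chain c k T))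
      (k := fun x y => ind (x < y) * H p x) (K := H (p + 1))
    · intro h; have := hc h; omega
    · refine (hI _ (by omega) le_rfl).mul (Ins.chain fun j hj h => ?_)
      have := hc h; omega
    · exact (hF.mul (Nice.chain _ _)).mul ((Nice.ind (meas_lt _ _)).mul (Nice.cont (hH p) _))
    · intro y hy
      rw [mu_lt hy, hH' p y hy]

lemma pow_fact_integral (p : ℕ) (y : ℝ) :
    ∫ x in (0:ℝ)..y, x ^ p / (p.factorial : ℝ) = y ^ (p + 1) / ((p + 1).factorial : ℝ) := by
  rw [intervalIntegral.integral_div, integral_pow, Nat.factorial_succ]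
  push_cast
  field_simp
  simp

lemma pow_fact_integral' (p : ℕ) (y t : ℝ) :
    ∫ x in y..t, (t - x) ^ p / (p.factorial : ℝ) = (t - y) ^ (p + 1) / ((p + 1).factorial : ℝ) := by
  rw [intervalIntegral.integral_comp_sub_left (fun x => x ^ p / (p.factorial : ℝ)) t]
  rw [sub_self, pow_fact_integral]

lemma desc_pow (P : Measure (ℤ → ℝ)) (hP : IsUniformProduct P) {c : ℕ → ℤ}
    (hc : Function.Injective c) {F : (ℤ → ℝ) → ℝ} (hF : Nice F) (k : ℕ)
    (hI : ∀ i, 1 ≤ i → i ≤ k → Ins F (c i)) :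
    ∫ T, F T * ind (Chain c k T) ∂P = ∫ T, F T * ((T (c 0)) ^ k / (k.factorial : ℝ)) ∂P := by
  have := desc P hP hc (H := fun p x => x ^ p / (p.factorial : ℝ)) (fun j => by fun_prop)
    (fun j y _ => pow_fact_integral j y) hF k 0 hI
  simpa using this

lemma asc (P : Measure (ℤ → ℝ)) (hP : IsUniformProduct P) {t : ℝ} (ht : t ∈ Icc (0 : ℝ) 1)
    {F : (ℤ → ℝ) → ℝ} (hF : Nice F) (m : ℕ) :
    ∀ (p : ℕ) (c : ℕ → ℤ), Function.Injective c → (∀ i < m, Ins F (c i)) →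
    ∫ T, F T * (ind (Chain c m T) * (ind (T (c 0) < t) *
      ((t - T (c 0)) ^ p / (p.factorial : ℝ)))) ∂P =
    ∫ T, F T * (ind (T (c m) < t) * ((t - T (c m)) ^ (p + m) / ((p + m).factorial : ℝ))) ∂P := by
  induction m with
  | zero => intro p c _ _; simp [Chain, ind]
  | succ m ih =>
    intro p c hc hI
    have h2 := ih (p + 1) (fun i => c (i + 1)) (fun a b h => by have := hc h; omega)
      (fun i hi => hI (i + 1) (by omega))
    rw [show p + (m + 1) = (p + 1) + m by ring, ← h2]
    have e : ∀ T, F T * (ind (Chain c (m + 1) T) * (ind (T (c 0) < t) *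
      ((t - T (c 0)) ^ p / (p.factorial : ℝ)))) =
      (F T * ind (Chain (fun i => c (i + 1)) m T)) * (ind (T (c 1) < T (c 0)) *
        (ind (T (c 0) < t) * ((t - T (c 0)) ^ p / (p.factorial : ℝ)))) := by
      intro T; rw [chain_succ', ind_and]; ring
    simp only [e, ← mul_assoc (F _) (ind _) (ind (_ < t) * _)]
    apply step P hP (i := c 0) (j := c 1) (F := fun T => F T * ind (Chain (fun i => c (i + 1)) m T))
      (k := fun x y => ind (y < x) * (ind (x < t) * ((t - x) ^ p / (p.factorial : ℝ))))
      (K := fun y => ind (y < t) * ((t - y) ^ (p + 1) / ((p + 1).factorial : ℝ)))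
    · intro h; have := hc h; omega
    · refine (hI _ (by omega)).mul (Ins.chain fun j hj h => ?_)
      have := hc h; omega
    · exact (hF.mul (Nice.chain _ _)).mul ((Nice.ind (meas_lt _ _)).mul
        ((Nice.ind (meas_lt_c _ _)).mul (Nice.cont (h := fun x => (t - x) ^ p / (p.factorial : ℝ))
        (by fun_prop) _)))
    · intro y hy
      rw [mu_between hy ht, pow_fact_integral']


/-- The descending run along `c` has length exactly `r`. -/
def Run (c : ℕ → ℤ) (r : ℕ) (T : ℤ → ℝ) : Prop := Chain c r T ∧ T (c r) < T (c (r + 1))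

/-- The descending run along `c` has finite even length. -/
def Ev (c : ℕ → ℤ) (T : ℤ → ℝ) : Prop := ∃ k, Run c (2 * k) T

lemma Run.chain_iff {c : ℕ → ℤ} {r : ℕ} {T : ℤ → ℝ} (h : Run c r T) (k : ℕ) :
    Chain c k T ↔ k ≤ r := by
  constructor
  · intro hk
    by_contra hlt
    exact lt_asymm h.2 (hk r (by omega))
  · intro hk i hi
    exact h.1 i (by omega)

lemma Run.unique {c : ℕ → ℤ} {r r' : ℕ} {T : ℤ → ℝ} (h : Run c r T) (h' : Run c r' T) :
    r = r' := by
  apply le_antisymm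
  · exact (h'.chain_iff r).1 h.1
  · exact (h.chain_iff r').1 h'.1

lemma Run.ev_iff {c : ℕ → ℤ} {r : ℕ} {T : ℤ → ℝ} (h : Run c r T) : Ev c T ↔ Even r := by
  constructor
  · rintro ⟨k, hk⟩
    rw [h.unique hk]; exact even_two_mul k
  · rintro ⟨k, hk⟩
    exact ⟨k, by rwa [two_mul, ← hk]⟩

lemma exists_run {c : ℕ → ℤ} {T : ℤ → ℝ} (h1 : ∀ i, T (c i) ≠ T (c (i + 1)))
    (h2 : ∃ k, ¬ Chain c k T) : ∃ r, Run c r T := by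
  classical
  have hs := Nat.find_spec h2
  have hm := fun m => Nat.find_min h2 (m := m)
  rcases hk : Nat.find h2 with _ | r
  · rw [hk] at hs; exact absurd (fun i hi => by omega) hs
  · rw [hk] at hs
    have hr : Chain c r T := not_not.1 (hm r (by omega))
    refine ⟨r, hr, ?_⟩
    rw [chain_succ] at hs
    have := fun h => hs ⟨hr, h⟩
    exact lt_of_le_of_ne (not_lt.1 this) (h1 r)

lemma alt_sum (r s : ℕ) :
    ∑ k ∈ Finset.range (s + 1), (-1 : ℝ) ^ k * ind (k ≤ r) = ind (Even (min r s)) := by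
  induction s with
  | zero => simp [ind]
  | succ s ih =>
    rw [Finset.sum_range_succ, ih]
    by_cases h : s + 1 ≤ r
    · rw [ind_true h, min_eq_right (by omega), min_eq_right h]
      by_cases hs : Even s
      · rw [ind_true hs, ind_false (by simpa [Nat.even_add_one] using hs), pow_succ, hs.neg_one_pow]
        norm_num
      · rw [ind_false hs, ind_true (by simpa [Nat.even_add_one] using hs), pow_succ,
          (Nat.not_even_iff_odd.1 hs).neg_one_pow]
        norm_num
    · rw [ind_false h, min_eq_left (by omega), min_eq_left (by omega)]; simp

lemma Run.alt_sum {c : ℕ → ℤ} {r : ℕ} {T : ℤ → ℝ} (h : Run c r T) (s : ℕ) :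
    ∑ k ∈ Finset.range (s + 1), (-1 : ℝ) ^ k * ind (Chain c k T) = ind (Even (min r s)) := by
  rw [← _root_.alt_sum]
  simp only [h.chain_iff]

lemma integral_ind (P : Measure (ℤ → ℝ)) {p : (ℤ → ℝ) → Prop} (hp : MeasurableSet {T | p T}) :
    ∫ T, ind (p T) ∂P = (P {T | p T}).toReal := by
  have : (fun T => ind (p T)) = {T | p T}.indicator (fun _ => (1 : ℝ)) := by
    funext T
    by_cases h : p T <;> simp [ind, h]
  rw [this, integral_indicator hp]
  simp [Measure.real]

lemma ae_ne (P : Measure (ℤ → ℝ)) (hP : IsUniformProduct P) {i j : ℤ} (hij : j ≠ i) :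
    ∀ᵐ T ∂P, T i ≠ T j := by
  have := isProb P hP
  have hm : MeasurableSet {T : ℤ → ℝ | T i = T j} :=
    measurableSet_eq_fun (measurable_pi_apply i) (measurable_pi_apply j)
  have h := step P hP hij (Ins.const 1 i) (k := fun x y => ind (x = y)) (K := fun _ => 0)
    ((Nice.const 1).mul (Nice.ind hm)) (by
      intro y _
      rw [integral_eq_zero_of_ae]
      have : ∀ᵐ x ∂mu, x ≠ y := by
        apply ae_restrict_of_ae
        exact Measure.ae_ne volume y
      filter_upwards [this] with x hx
      exact ind_false hx)
  simp only [one_mul, mul_zero, integral_zero] at h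
  rw [integral_ind P hm, ENNReal.toReal_eq_zero_iff] at h
  rw [ae_iff]
  simpa using h.resolve_right (measure_ne_top _ _)

lemma ae_finite (P : Measure (ℤ → ℝ)) (hP : IsUniformProduct P) {c : ℕ → ℤ}
    (hc : Function.Injective c) : ∀ᵐ T ∂P, ∃ k, ¬ Chain c k T := by
  have := isProb P hP
  rw [ae_iff]
  simp only [not_exists, not_not]
  have hb : ∀ k : ℕ, (P {T | ∀ k, Chain c k T}).toReal ≤ 1 / (k.factorial : ℝ) := by
    intro k
    calc (P {T | ∀ k, Chain c k T}).toReal ≤ (P {T | Chain c k T}).toReal := by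
          apply ENNReal.toReal_mono (measure_ne_top _ _)
          exact measure_mono fun T hT => hT k
      _ = ∫ T, (1:ℝ) * ind (Chain c k T) ∂P := by
          simp only [one_mul]; rw [integral_ind P (meas_chain c k)]
      _ = ∫ T, (1:ℝ) * ((T (c 0)) ^ k / (k.factorial : ℝ)) ∂P :=
          desc_pow P hP hc (Nice.const 1) k (fun _ _ _ => Ins.const _ _)
      _ ≤ ∫ T, 1 / (k.factorial : ℝ) ∂P := by
          apply integral_mono_ae
          · exact ((Nice.const 1).mul (Nice.cont (h := fun x => x ^ k / (k.factorial : ℝ))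
              (by fun_prop) _)).integrable hP
          · exact integrable_const _
          · filter_upwards [ae_mem P hP] with T hT
            rw [one_mul]
            gcongr
            exact pow_le_one₀ (hT _).1 (hT _).2
      _ = 1 / (k.factorial : ℝ) := by simp
  have hl : Tendsto (fun k : ℕ => 1 / (k.factorial : ℝ)) atTop (𝓝 0) := by
    simpa using FloorSemiring.tendsto_pow_div_factorial_atTop (1:ℝ)
  have h0 := ge_of_tendsto' hl hb
  have h1 := le_antisymm h0 ENNReal.toReal_nonneg
  rw [ENNReal.toReal_eq_zero_iff] at h1
  exact h1.resolve_right (measure_ne_top _ _)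

lemma ae_run (P : Measure (ℤ → ℝ)) (hP : IsUniformProduct P) {c : ℕ → ℤ}
    (hc : Function.Injective c) : ∀ᵐ T ∂P, ∃ r, Run c r T := by
  have h : ∀ᵐ T ∂P, ∀ i, T (c i) ≠ T (c (i + 1)) := by
    rw [ae_all_iff]
    intro i
    apply ae_ne P hP
    intro h; have := hc h; omega
  filter_upwards [h, ae_finite P hP hc] with T h1 h2
  exact exists_run h1 h2

lemma meas_ev (c : ℕ → ℤ) : MeasurableSet {T | Ev c T} := by
  have : {T | Ev c T} = ⋃ k, ({T | Chain c (2 * k) T} ∩ {T | T (c (2 * k)) < T (c (2 * k + 1))}) := by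
    ext T; simp [Ev, Run]
  rw [this]
  exact MeasurableSet.iUnion fun k => (meas_chain _ _).inter (meas_lt _ _)

lemma ev_exp (P : Measure (ℤ → ℝ)) (hP : IsUniformProduct P) {c : ℕ → ℤ}
    (hc : Function.Injective c) {F : (ℤ → ℝ) → ℝ} (hF : Nice F)
    (hI : ∀ i, 1 ≤ i → Ins F (c i)) :
    ∫ T, F T * ind (Ev c T) ∂P = ∫ T, F T * Real.exp (-T (c 0)) ∂P := by
  have hpr := isProb P hP
  have hnice : ∀ k, Nice (fun T => F T * ((-1 : ℝ) ^ k * ind (Chain c k T))) := fun k =>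
    hF.mul ((Nice.const _).mul (Nice.chain c k))
  have hnice' : ∀ k : ℕ, Nice (fun T => F T * ((-T (c 0)) ^ k / (k.factorial : ℝ))) := fun k =>
    hF.mul (Nice.cont (h := fun x => (-x) ^ k / (k.factorial : ℝ)) (by fun_prop) _)
  have l1 : Tendsto (fun K => ∫ T, F T * ∑ k ∈ Finset.range (K + 1),
      (-1 : ℝ) ^ k * ind (Chain c k T) ∂P) atTop (𝓝 (∫ T, F T * ind (Ev c T) ∂P)) := by
    apply tendsto_integral_of_dominated_convergence (fun T => |F T|)
    · intro K
      simp only [Finset.mul_sum]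
      exact (Nice.sum _ fun k _ => hnice k).1.aestronglyMeasurable
    · exact (hF.integrable hP).abs
    · intro K
      filter_upwards [ae_run P hP hc] with T ⟨r, hr⟩
      rw [hr.alt_sum, Real.norm_eq_abs, abs_mul]
      exact mul_le_of_le_one_right (abs_nonneg _) (abs_ind _)
    · filter_upwards [ae_run P hP hc] with T ⟨r, hr⟩
      apply tendsto_const_nhds.congr'
      filter_upwards [eventually_ge_atTop r] with K hK
      rw [hr.alt_sum, min_eq_left hK, hr.ev_iff]
  have l2 : Tendsto (fun K => ∫ T, F T * ∑ k ∈ Finset.range (K + 1),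
      (-T (c 0)) ^ k / (k.factorial : ℝ) ∂P) atTop
      (𝓝 (∫ T, F T * Real.exp (-T (c 0)) ∂P)) := by
    apply tendsto_integral_of_dominated_convergence (fun T => |F T| * Real.exp 1)
    · intro K
      simp only [Finset.mul_sum]
      exact (Nice.sum _ fun k _ => hnice' k).1.aestronglyMeasurable
    · exact (hF.integrable hP).abs.mul_const _
    · intro K
      filter_upwards [ae_mem P hP] with T hT
      rw [Real.norm_eq_abs, abs_mul]
      gcongr
      calc |∑ k ∈ Finset.range (K + 1), (-T (c 0)) ^ k / (k.factorial : ℝ)|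
          ≤ ∑ k ∈ Finset.range (K + 1), |(-T (c 0)) ^ k / (k.factorial : ℝ)| :=
            Finset.abs_sum_le_sum_abs _ _
        _ ≤ ∑ k ∈ Finset.range (K + 1), (1:ℝ) ^ k / (k.factorial : ℝ) := by
            gcongr with k hk
            rw [abs_div, abs_pow, abs_neg, abs_of_nonneg (hT _).1, Nat.abs_cast]
            have := (hT (c 0)).1
            have := (hT (c 0)).2
            gcongr
        _ ≤ Real.exp 1 := Real.sum_le_exp_of_nonneg (by norm_num) _
    · filter_upwards with T
      apply Tendsto.const_mul
      have := (NormedSpace.expSeries_div_hasSum_exp (-T (c 0))).tendsto_sum_nat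
      rw [← Real.exp_eq_exp_ℝ] at this
      exact this.comp (tendsto_add_atTop_nat 1)
  refine tendsto_nhds_unique l1 (l2.congr fun K => ?_)
  simp only [Finset.mul_sum]
  rw [integral_finsetSum _ fun k _ => (hnice k).integrable hP,
    integral_finsetSum _ fun k _ => (hnice' k).integrable hP]
  refine Finset.sum_congr rfl fun k _ => ?_
  have := desc_pow P hP hc hF k (fun i h _ => hI i h)
  have e1 : ∀ T : ℤ → ℝ, F T * ((-T (c 0)) ^ k / (k.factorial : ℝ)) =
    (-1) ^ k * (F T * ((T (c 0)) ^ k / (k.factorial : ℝ))) := by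
    intro T; rw [neg_pow]; ring
  have e2 : ∀ T : ℤ → ℝ, F T * ((-1) ^ k * ind (Chain c k T)) =
    (-1) ^ k * (F T * ind (Chain c k T)) := by
    intro T; ring
  simp only [e1, e2]
  rw [integral_const_mul, integral_const_mul, this]


/-- Sites to the right of `a`. -/
def rgt (a : ℤ) (i : ℕ) : ℤ := a + i
/-- Sites to the left of `a`. -/
def lft (a : ℤ) (i : ℕ) : ℤ := a - i

lemma rgt_inj (a : ℤ) : Function.Injective (rgt a) := fun i j h => by
  simp only [rgt] at h; omega
lemma lft_inj (a : ℤ) : Function.Injective (lft a) := fun i j h => by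
  simp only [lft] at h; omega

lemma mem_O (t : ℝ) (s : ℤ) (T : ℤ → ℝ) :
    T ∈ O t s ↔ T s < t ∧ Ev (lft s) T ∧ Ev (rgt s) T := by
  have hL : ∀ j : ℕ, Run (lft s) (2 * j) T ↔
      (∀ i : ℕ, i < 2 * j → T (s - i - 1) < T (s - i)) ∧ T (s - 2 * j) < T (s - 2 * j - 1) := by
    intro j
    simp only [Run, Chain, lft]
    push_cast
    simp only [sub_sub]
  have hR : ∀ j : ℕ, Run (rgt s) (2 * j) T ↔
      (∀ i : ℕ, i < 2 * j → T (s + i + 1) < T (s + i)) ∧ T (s + 2 * j) < T (s + 2 * j + 1) := by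
    intro j
    simp only [Run, Chain, rgt]
    push_cast
    simp only [add_assoc]
  simp only [O, G, mem_iUnion, Ev, hL, hR]
  constructor
  · rintro ⟨j, k, h1, h2, h3, h4, h5⟩
    exact ⟨h1, ⟨j, h2, h3⟩, ⟨k, h4, h5⟩⟩
  · rintro ⟨h1, ⟨j, h2, h3⟩, ⟨k, h4, h5⟩⟩
    exact ⟨j, k, h1, h2, h3, h4, h5⟩

lemma ev_step {c : ℕ → ℤ} {T : ℤ → ℝ} {r : ℕ} (hr : Run (fun i => c (i + 1)) r T)
    (hne : T (c 0) ≠ T (c 1)) :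
    Ev c T ↔ ¬ (T (c 1) < T (c 0) ∧ Ev (fun i => c (i + 1)) T) := by
  by_cases h : T (c 1) < T (c 0)
  · have : Run c (r + 1) T := ⟨(chain_succ' c r T).2 ⟨h, hr.1⟩, hr.2⟩
    rw [this.ev_iff, hr.ev_iff, Nat.even_add_one]
    simp [h]
  · have : Run c 0 T := ⟨fun i hi => by omega, lt_of_le_of_ne (not_lt.1 h) hne⟩
    rw [this.ev_iff]
    simp [h]

lemma chain_le {c : ℕ → ℤ} {T : ℤ → ℝ} {k : ℕ} (h : Chain c k T) : T (c k) ≤ T (c 0) := by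
  induction k with
  | zero => exact le_rfl
  | succ k ih =>
    rw [chain_succ] at h
    exact h.2.le.trans (ih h.1)

/-- Signed count describing that site `0` is vacant in the half line. -/
noncomputable def MB (t : ℝ) (s : ℕ) (T : ℤ → ℝ) : ℝ :=
  1 - ind (T 0 < t) * ∑ m ∈ Finset.range (s + 1), (-1 : ℝ) ^ m * ind (Chain (rgt 0) m T)

/-- Signed count describing the left run from site `s`. -/
noncomputable def ML (t : ℝ) (s : ℕ) (T : ℤ → ℝ) : ℝ :=
  ind (T s < t) * ∑ n ∈ Finset.range (s + 1), (-1 : ℝ) ^ n * ind (Chain (lft s) n T)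

lemma vacant_iff {t : ℝ} {T : ℤ → ℝ} {l r : ℕ} (hl : Run (lft (-1)) l T) (hr : Run (rgt 0) r T)
    (hne : T 0 ≠ T (-1)) :
    (T ∉ O t (-1) ∧ T ∉ O t 0) ↔
      ¬ (T (-1) < t ∧ Ev (lft (-1)) T) ∧ ¬ (T 0 < t ∧ Ev (rgt 0) T) := by
  have eL : (fun i => lft 0 (i + 1)) = lft (-1) := by
    funext i; simp only [lft]; push_cast; ring
  have eR : (fun i => rgt (-1) (i + 1)) = rgt 0 := by
    funext i; simp only [rgt]; push_cast; ring
  have h1 := ev_step (c := lft 0) (r := l) (T := T) (by rw [eL]; exact hl) (by simpa [lft] using hne)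
  have h2 := ev_step (c := rgt (-1)) (r := r) (T := T) (by rw [eR]; exact hr)
    (by simpa [rgt] using hne.symm)
  rw [eL] at h1
  rw [eR] at h2
  simp only [lft, rgt, Nat.cast_zero, Nat.cast_one, sub_zero, add_zero, zero_sub,
    neg_add_cancel] at h1 h2
  rw [mem_O, mem_O]
  change Ev (lft 0) T ↔ ¬ (T (-1) < T 0 ∧ Ev (lft (-1)) T) at h1
  change Ev (rgt (-1)) T ↔ ¬ (T 0 < T (-1) ∧ Ev (rgt 0) T) at h2
  rw [h1, h2]
  rcases lt_or_gt_of_ne hne with h | h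
  · have h3 : T (-1) < t → T 0 < t := fun h' => h.trans h'
    have h4 : ¬ (T (-1) < T 0) := not_lt.2 h.le
    tauto
  · have h3 : T 0 < t → T (-1) < t := fun h' => h.trans h'
    have h4 : ¬ (T 0 < T (-1)) := not_lt.2 h.le
    tauto

lemma pointwise {t : ℝ} {T : ℤ → ℝ} {s l r q p : ℕ} (hs : 2 ≤ s) (hse : Even s)
    (hl : Run (lft (-1)) l T) (hr : Run (rgt 0) r T)
    (hq : Run (lft s) q T) (hp : Run (rgt s) p T)
    (hne : T 0 ≠ T (-1)) :
    ind (T ∈ (O t (-1))ᶜ ∩ (O t 0)ᶜ ∩ O t s) =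
      (MB t s T * ML t s T * ind (Ev (rgt s) T)) *
        (1 - ind (T (-1) < t) * ind (Ev (lft (-1)) T)) := by
  have hev : T ∈ (O t (-1))ᶜ ∩ (O t 0)ᶜ ∩ O t s ↔
      (¬ (T (-1) < t ∧ Ev (lft (-1)) T) ∧ ¬ (T 0 < t ∧ Ev (rgt 0) T)) ∧
      (T s < t ∧ Ev (lft s) T ∧ Ev (rgt s) T) := by
    rw [← vacant_iff hl hr hne, ← mem_O]; rfl
  rw [hev, ind_and, ind_and, ind_not, ind_and, ind_and, ind_and]
  by_cases hpe : Ev (rgt s) T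
  swap
  · rw [ind_false hpe]; ring
  have hMB : MB t s T = ind (¬ (T 0 < t ∧ Ev (rgt 0) T)) := by
    rw [MB, hr.alt_sum, ind_not, ind_and, hr.ev_iff]
    have : Even (min r s) ↔ Even r := by
      rcases le_total r s with h | h
      · rw [min_eq_left h]
      · rw [min_eq_right h]
        have hrun : Run (rgt 0) (s + p) T := by
          constructor
          · intro i hi
            by_cases his : i < s
            · exact (hr.chain_iff s).2 h i his
            · have := hp.1 (i - s) (by omega)
              simp only [rgt] at this ⊢
              convert this using 2 <;> push_cast [Nat.cast_sub (not_lt.1 his)] <;> ring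
          · have := hp.2
            simp only [rgt] at this ⊢
            convert this using 2 <;> push_cast <;> ring
        rw [hr.unique hrun, Nat.even_add]
        have := hp.ev_iff.1 hpe
        tauto
    rw [this]
  rw [hMB]
  by_cases hB : T 0 < t ∧ Ev (rgt 0) T
  · rw [ind_false (not_not.2 hB)]; ring
  by_cases hst : T s < t
  swap
  · rw [ML, ind_false hst]; ring
  have hqs : q < s := by
    by_contra hge
    have hch := (hq.chain_iff s).2 (not_lt.1 hge)
    apply hB
    have h1 := chain_le hch
    simp only [lft, sub_self, Nat.cast_zero, sub_zero] at h1
    refine ⟨h1.trans_lt hst, ?_⟩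
    have h2 := hch (s - 1) (by omega)
    simp only [lft] at h2
    have h0 : Run (rgt 0) 0 T := by
      refine ⟨fun i hi => by omega, ?_⟩
      simp only [rgt]
      convert h2 using 2
      · push_cast [Nat.cast_sub (show 1 ≤ s by omega)]; ring
      · push_cast [Nat.cast_sub (show 1 ≤ s by omega)]; ring
    rw [h0.ev_iff]; simp
  rw [ML, hq.alt_sum, min_eq_left hqs.le, hq.ev_iff]
  ring

lemma Nice.MB (t : ℝ) (s : ℕ) : Nice (MB t s) :=
  (Nice.const 1).sub ((Nice.ind (meas_lt_c 0 t)).mul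
    (Nice.sum _ fun _ _ => (Nice.const _).mul (Nice.chain _ _)))

lemma Nice.ML (t : ℝ) (s : ℕ) : Nice (ML t s) :=
  (Nice.ind (meas_lt_c s t)).mul
    (Nice.sum _ fun _ _ => (Nice.const _).mul (Nice.chain _ _))

lemma Ins.MB (t : ℝ) (s : ℕ) {i : ℤ} (h : i < 0 ∨ (s : ℤ) < i) : Ins (MB t s) i := by
  refine (Ins.const 1 i).sub ((Ins.coord (fun x => ind (x < t)) (by omega)).mul
    (Ins.sum _ fun m hm => (Ins.const _ i).mul (Ins.chain fun j hj => ?_)))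
  rw [Finset.mem_range] at hm
  simp only [rgt]; omega

lemma Ins.ML (t : ℝ) (s : ℕ) {i : ℤ} (h : i < 0 ∨ (s : ℤ) < i) : Ins (ML t s) i := by
  refine ((Ins.coord (fun x => ind (x < t)) (by omega)).mul
    (Ins.sum _ fun m hm => (Ins.const _ i).mul (Ins.chain fun j hj => ?_)))
  rw [Finset.mem_range] at hm
  simp only [lft]; omega

lemma Ins.ev {c : ℕ → ℤ} {i : ℤ} (h : ∀ j, c j ≠ i) : Ins (fun T => ind (Ev c T)) i := by
  intro T x
  have : Ev c (Function.update T i x) ↔ Ev c T := by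
    simp only [Ev, Run, Chain, Function.update_of_ne (h _)]
  simp only [this]

lemma reduce (P : Measure (ℤ → ℝ)) (hP : IsUniformProduct P)
    (t : ℝ) (ht : t ∈ Icc (0 : ℝ) 1) (s : ℕ) (hs : 2 ≤ s) (hse : Even s) :
    (P ((O t (-1))ᶜ ∩ (O t 0)ᶜ ∩ O t s)).toReal =
      (∫ T, MB t s T * ML t s T * Real.exp (-T s) ∂P) * Real.exp (-t) := by
  have hO : ∀ a, MeasurableSet (O t a) := by
    intro a
    have : O t a = {T | T a < t} ∩ ({T | Ev (lft a) T} ∩ {T | Ev (rgt a) T}) := by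
      ext T; rw [mem_O]; rfl
    rw [this]
    exact (meas_lt_c _ _).inter ((meas_ev _).inter (meas_ev _))
  have h1 := integral_ind P (p := fun T => T ∈ (O t (-1))ᶜ ∩ (O t 0)ᶜ ∩ O t s)
    (((hO _).compl.inter (hO _).compl).inter (hO _))
  have h1' : (P ((O t (-1))ᶜ ∩ (O t 0)ᶜ ∩ O t s)).toReal =
    ∫ T, ind (T ∈ (O t (-1))ᶜ ∩ (O t 0)ᶜ ∩ O t s) ∂P := h1.symm
  have hN : Nice (fun T => MB t s T * ML t s T * ind (Ev (rgt s) T)) :=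
    ((Nice.MB t s).mul (Nice.ML t s)).mul (Nice.ind (meas_ev _))
  have hN2 : Nice (fun T => MB t s T * ML t s T * ind (Ev (rgt s) T) * ind (T (-1) < t)) :=
    hN.mul (Nice.ind (meas_lt_c _ _))
  have hIns : ∀ i : ℤ, i < 0 → Ins (fun T => MB t s T * ML t s T * ind (Ev (rgt s) T)) i := by
    intro i hi
    refine ((Ins.MB t s (Or.inl hi)).mul (Ins.ML t s (Or.inl hi))).mul (Ins.ev fun j => ?_)
    simp only [rgt]; omega
  rw [h1']
  have h2 : ∫ T, ind (T ∈ (O t (-1))ᶜ ∩ (O t 0)ᶜ ∩ O t s) ∂P =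
      ∫ T, (MB t s T * ML t s T * ind (Ev (rgt s) T)) -
        (MB t s T * ML t s T * ind (Ev (rgt s) T) * ind (T (-1) < t)) *
          ind (Ev (lft (-1)) T) ∂P := by
    apply integral_congr_ae
    filter_upwards [ae_run P hP (lft_inj (-1)), ae_run P hP (rgt_inj 0), ae_run P hP (lft_inj s),
      ae_run P hP (rgt_inj s), ae_ne P hP (i := 0) (j := -1) (by norm_num)] with
      T ⟨l, hl⟩ ⟨r, hr⟩ ⟨q, hq⟩ ⟨p, hp⟩ hne
    rw [pointwise hs hse hl hr hq hp hne]
    ring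
  rw [h2, integral_sub (hN.integrable hP) ((hN2.mul (Nice.ind (meas_ev _))).integrable hP),
    ev_exp P hP (lft_inj _) hN2]
  swap
  · intro i hi
    refine (hIns _ ?_).mul (Ins.coord (fun x => ind (x < t)) ?_) <;> simp only [lft] <;> omega
  have h3 := step0 P hP (hIns (-1) (by norm_num)) (k := fun x => ind (x < t) * Real.exp (-x))
    (hN.mul ((Nice.ind (meas_lt_c _ _)).mul (Nice.cont (h := fun x => Real.exp (-x))
      (by fun_prop) _)))
  have h4 : lft (-1) 0 = -1 := by simp [lft]
  simp only [← mul_assoc] at h3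
  rw [h4, h3, mu_lt ht]
  have h5 := ev_exp P hP (rgt_inj s) ((Nice.MB t s).mul (Nice.ML t s)) (fun i hi => by
    have : (s : ℤ) < rgt s i := by simp only [rgt]; omega
    exact (Ins.MB t s (Or.inr this)).mul (Ins.ML t s (Or.inr this)))
  have h6 : rgt s 0 = s := by simp [rgt]
  rw [h6] at h5
  rw [h5]
  have h7 : ∫ x in (0:ℝ)..t, Real.exp (-x) = 1 - Real.exp (-t) := by
    rw [intervalIntegral.integral_comp_neg (fun x => Real.exp x)]
    simp
  rw [h7]
  ring


/-- Iterated primitives. -/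
noncomputable def Hv (t : ℝ) (m : ℕ) : ℕ → ℝ → ℝ
  | 0 => fun x => (t - x) ^ m / (m.factorial : ℝ)
  | n + 1 => fun y => ∫ x in (0:ℝ)..y, Hv t m n x

lemma Hv_cont (t : ℝ) (m n : ℕ) : Continuous (Hv t m n) := by
  induction n with
  | zero => simp only [Hv]; fun_prop
  | succ n ih =>
    simp only [Hv]
    exact intervalIntegral.continuous_primitive (fun a b => ih.intervalIntegrable a b) 0

lemma Hv_sum (t : ℝ) (s : ℕ) : ∀ y, ∑ n ∈ Finset.range (s + 1), Hv t (s - n) n y =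
    ((t + y) ^ s + (t - y) ^ s) / (2 * (s.factorial : ℝ)) := by
  induction s with
  | zero => intro y; simp [Hv]
  | succ s ih =>
    intro y
    rw [Finset.sum_range_succ']
    simp only [Nat.add_sub_add_right, Hv, Nat.sub_zero]
    rw [← intervalIntegral.integral_finsetSum (fun n _ => (Hv_cont t _ n).intervalIntegrable _ _)]
    simp only [ih]
    have hd : ∀ x ∈ uIcc 0 y, HasDerivAt (fun x => ((t + x) ^ (s + 1) - (t - x) ^ (s + 1)) /
        (2 * ((s + 1).factorial : ℝ))) (((t + x) ^ s + (t - x) ^ s) / (2 * (s.factorial : ℝ))) x := by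
      intro x _
      have h1 := (((hasDerivAt_id x).const_add t).pow (s + 1)).sub
        (((hasDerivAt_id x).const_sub t).pow (s + 1))
      have h2 := h1.div_const (2 * ((s + 1).factorial : ℝ))
      refine HasDerivAt.congr_deriv h2 ?_
      rw [Nat.factorial_succ]
      push_cast
      simp only [id]
      field_simp
      ring
    rw [intervalIntegral.integral_eq_sub_of_hasDerivAt hd
      (Continuous.intervalIntegrable (by fun_prop) _ _)]
    field_simp
    simp
    ring

/-- Truncated exponential series. -/
noncomputable def Ex (n : ℕ) (x : ℝ) : ℝ := ∑ q ∈ Finset.range (n + 1), x ^ q / (q.factorial : ℝ)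

lemma Ex_succ (n : ℕ) (x : ℝ) :
    Ex (n + 1) x = Ex n x + x ^ (n + 1) / ((n + 1).factorial : ℝ) := by
  rw [Ex, Finset.sum_range_succ, ← Ex]

lemma Ex_zero (n : ℕ) : Ex n 0 = 1 := by
  induction n with
  | zero => simp [Ex]
  | succ n ih => rw [Ex_succ, ih]; simp

lemma Ex_deriv (n : ℕ) (x : ℝ) : HasDerivAt (Ex (n + 1)) (Ex n x) x := by
  induction n with
  | zero =>
    have : Ex 1 = fun x => 1 + x := by funext x; simp [Ex, Finset.sum_range_succ]
    have h2 : Ex 0 x = 1 := by simp [Ex]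
    rw [zero_add, this, h2]
    exact (hasDerivAt_id x).const_add 1
  | succ n ih =>
    have : Ex (n + 1 + 1) = fun x => Ex (n + 1) x + x ^ (n + 1 + 1) / ((n + 1 + 1).factorial : ℝ) := by
      funext x; exact Ex_succ _ _
    rw [this, Ex_succ]
    refine ih.add ?_
    refine HasDerivAt.congr_deriv
      ((hasDerivAt_pow (n + 1 + 1) x).div_const ((n + 1 + 1).factorial : ℝ)) ?_
    rw [Nat.factorial_succ (n + 1)]
    push_cast
    field_simp

lemma Ex_cauchy (a b : ℝ) (s : ℕ) :
    ∑ n ∈ Finset.range (s + 1), a ^ n / (n.factorial : ℝ) * Ex (s - n) b = Ex s (a + b) := by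
  induction s with
  | zero => simp [Ex]
  | succ s ih =>
    rw [Ex_succ, ← ih, Finset.sum_range_succ, add_pow, Finset.sum_div, Finset.sum_range_succ _ (s + 1),
      ← add_assoc, ← Finset.sum_add_distrib]
    congr 1
    · refine Finset.sum_congr rfl fun n hn => ?_
      rw [Finset.mem_range] at hn
      rw [show s + 1 - n = (s - n) + 1 by omega, Ex_succ, mul_add]
      congr 1
      rw [show s - n + 1 = s + 1 - n by omega, Nat.cast_choose ℝ (show n ≤ s + 1 by omega)]
      have := Nat.factorial_ne_zero (s + 1)
      field_simp
    · simp [Ex]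

lemma final_calc (t : ℝ) (s : ℕ) (hs : 2 ≤ s) (hse : Even s) :
    ∫ u in (0:ℝ)..t, Real.exp (-u) * (Ex s (-u + -t) -
      ((t + u) ^ s + (t - u) ^ s) / (2 * (s.factorial : ℝ))) =
    1 / 2 * Real.exp (-t) * (1 - Ex s (-2 * t)) := by
  obtain ⟨n, rfl⟩ : ∃ n, s = n + 1 := ⟨s - 1, by omega⟩
  have hd : ∀ u ∈ uIcc 0 t, HasDerivAt (fun u => 1 / 2 * (Real.exp (-u) *
      (Ex (n + 1) (u - t) - Ex (n + 1) (-u - t))))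
      (Real.exp (-u) * (Ex (n + 1) (-u + -t) -
      ((t + u) ^ (n + 1) + (t - u) ^ (n + 1)) / (2 * ((n + 1).factorial : ℝ)))) u := by
    intro u _
    have h1 : HasDerivAt (fun u => Ex (n + 1) (u - t)) (Ex n (u - t) * 1) u :=
      HasDerivAt.comp (h := fun u => u - t) u (Ex_deriv n (u - t)) ((hasDerivAt_id u).sub_const t)
    have h2 : HasDerivAt (fun u => Ex (n + 1) (-u - t)) (Ex n (-u - t) * (-1)) u :=
      HasDerivAt.comp (h := fun u => -u - t) u (Ex_deriv n (-u - t)) ((hasDerivAt_id u).neg.sub_const t)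
    have h3 : HasDerivAt (fun u => Real.exp (-u)) (Real.exp (-u) * (-1)) u :=
      (Real.hasDerivAt_exp (-u)).comp u (hasDerivAt_id u).neg
    refine HasDerivAt.congr_deriv ((h3.mul (h1.sub h2)).const_mul (1 / 2)) ?_
    rw [← sub_eq_add_neg]
    simp only [Pi.sub_apply, Ex_succ]
    rw [show u - t = -(t - u) by ring, show -u - t = -(t + u) by ring, hse.neg_pow, hse.neg_pow]
    field_simp
    ring
  have hc : ∀ n, Continuous (Ex n) := by
    intro n; unfold Ex; fun_prop
  have := hc (n + 1)
  rw [intervalIntegral.integral_eq_sub_of_hasDerivAt hd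
      (Continuous.intervalIntegrable (by fun_prop) _ _)]
  simp only [sub_self, Ex_zero]
  rw [show -t - t = -2 * t by ring]
  simp
  ring

/-- The weight at site `s`. -/
noncomputable def gw (t : ℝ) (s : ℕ) (T : ℤ → ℝ) : ℝ := ind (T s < t) * Real.exp (-T s)

lemma Nice.gw (t : ℝ) (s : ℕ) : Nice (gw t s) :=
  (Nice.ind (meas_lt_c _ _)).mul (Nice.cont (h := fun x => Real.exp (-x)) (by fun_prop) _)

lemma Ins.gw (t : ℝ) (s : ℕ) {i : ℤ} (h : (s : ℤ) ≠ i) : Ins (gw t s) i :=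
  Ins.coord (fun x => ind (x < t) * Real.exp (-x)) h

lemma J_eq (P : Measure (ℤ → ℝ)) (hP : IsUniformProduct P) {t : ℝ} (ht : t ∈ Icc (0 : ℝ) 1)
    (s : ℕ) {h : ℝ → ℝ} (hc : Continuous h) :
    ∫ T, gw t s T * h (T s) ∂P = ∫ u in (0:ℝ)..t, Real.exp (-u) * h u := by
  have := isProb P hP
  have h1 := step0 P hP (i := s) (Ins.const 1 _)
    (k := fun x => ind (x < t) * (Real.exp (-x) * h x))
    ((Nice.const 1).mul ((Nice.ind (meas_lt_c _ _)).mul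
      (Nice.cont (h := fun x => Real.exp (-x) * h x) (by fun_prop) _)))
  rw [mu_lt ht] at h1
  simp only [one_mul, integral_const, probReal_univ, smul_eq_mul, ← mul_assoc] at h1
  exact h1

lemma X_eq (P : Measure (ℤ → ℝ)) (hP : IsUniformProduct P) {t : ℝ} (ht : t ∈ Icc (0 : ℝ) 1)
    (s n : ℕ) :
    ∫ T, gw t s T * ind (Chain (lft s) n T) ∂P =
      ∫ u in (0:ℝ)..t, Real.exp (-u) * (u ^ n / (n.factorial : ℝ)) := by
  rw [desc_pow P hP (lft_inj s) (Nice.gw t s) n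
    (fun i h1 _ => Ins.gw t s (by simp only [lft]; omega)),
    ← J_eq P hP ht s (h := fun u => u ^ n / (n.factorial : ℝ)) (by fun_prop)]
  simp [lft]

lemma Y_small (P : Measure (ℤ → ℝ)) (hP : IsUniformProduct P) {t : ℝ} (ht : t ∈ Icc (0 : ℝ) 1)
    {s m n : ℕ} (h : m + n < s) :
    ∫ T, gw t s T * ind (Chain (lft s) n T) * ind (T 0 < t) * ind (Chain (rgt 0) m T) ∂P =
      (∫ u in (0:ℝ)..t, Real.exp (-u) * (u ^ n / (n.factorial : ℝ))) *
        (t ^ (m + 1) / ((m + 1).factorial : ℝ)) := by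
  have hN := (Nice.gw t s).mul (Nice.chain (lft s) n)
  have hI : ∀ i : ℤ, i ≤ m → Ins (fun T => gw t s T * ind (Chain (lft s) n T)) i := by
    intro i hi
    refine (Ins.gw t s (by omega)).mul (Ins.chain fun j hj => ?_)
    simp only [lft]; omega
  rw [desc_pow P hP (rgt_inj 0) (hN.mul (Nice.ind (meas_lt_c 0 t))) m (fun i h1 h2 => by
    refine (hI _ ?_).mul (Ins.coord (fun x => ind (x < t)) ?_) <;> simp only [rgt] <;> omega)]
  have h1 := step0 P hP (hI 0 (by omega))
    (k := fun x => ind (x < t) * (x ^ m / (m.factorial : ℝ)))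
    (hN.mul ((Nice.ind (meas_lt_c _ _)).mul (Nice.cont (h := fun x => x ^ m / (m.factorial : ℝ))
      (by fun_prop) _)))
  rw [mu_lt ht, pow_fact_integral, X_eq P hP ht] at h1
  simp only [← mul_assoc] at h1
  rw [← h1]
  simp [rgt]

lemma Y_eq (P : Measure (ℤ → ℝ)) (hP : IsUniformProduct P) {t : ℝ} (ht : t ∈ Icc (0 : ℝ) 1)
    {s m n : ℕ} (h : m + n = s) :
    ∫ T, gw t s T * ind (Chain (lft s) n T) * ind (T 0 < t) * ind (Chain (rgt 0) m T) ∂P =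
      ∫ u in (0:ℝ)..t, Real.exp (-u) * Hv t m n u := by
  have hN := (Nice.gw t s).mul (Nice.chain (lft s) n)
  have h1 := asc P hP ht hN m 0 (rgt 0) (rgt_inj 0) (fun i hi => by
    refine (Ins.gw t s ?_).mul (Ins.chain fun j hj => ?_)
    · simp only [rgt]; omega
    · simp only [lft, rgt]; omega)
  have e1 : ∀ T : ℤ → ℝ, gw t s T * ind (Chain (lft s) n T) * ind (T 0 < t) *
      ind (Chain (rgt 0) m T) = gw t s T * ind (Chain (lft s) n T) * (ind (Chain (rgt 0) m T) *
      (ind (T (rgt 0 0) < t) * ((t - T (rgt 0 0)) ^ 0 / (Nat.factorial 0 : ℝ)))) := by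
    intro T
    simp [rgt]
    ring
  simp only [e1]
  rw [h1]
  have e2 : ∀ T : ℤ → ℝ, gw t s T * ind (Chain (lft s) n T) * (ind (T (rgt 0 m) < t) *
      ((t - T (rgt 0 m)) ^ (0 + m) / ((0 + m).factorial : ℝ))) =
      gw t s T * (ind (Chain (lft s) n T) * Hv t m 0 (T (lft s n))) := by
    intro T
    have : rgt 0 m = lft s n := by simp only [rgt, lft]; omega
    rw [this, zero_add]
    simp only [Hv]
    by_cases hc : Chain (lft s) n T
    · by_cases hst : T s < t
      · have := chain_le hc
        simp only [lft, Nat.cast_zero, sub_zero] at this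
        rw [ind_true (p := T (lft s n) < t) (this.trans_lt hst)]
        ring
      · simp [gw, ind_false hst]
    · simp [ind_false hc]
  simp only [e2]
  rw [desc P hP (lft_inj s) (Hv_cont t m) (fun j y _ => by simp only [Hv]) (Nice.gw t s) n 0
    (fun i h1 _ => Ins.gw t s (by simp only [lft]; omega)), ← J_eq P hP ht s (Hv_cont t m n)]
  simp [lft]

lemma Y_big (P : Measure (ℤ → ℝ)) {t : ℝ}
    {s m n : ℕ} (hm : m ≤ s) (hn : n ≤ s) (h : s < m + n) :
    ∫ T, gw t s T * ind (Chain (lft s) n T) * ind (T 0 < t) * ind (Chain (rgt 0) m T) ∂P = 0 := by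
  have : ∀ T, gw t s T * ind (Chain (lft s) n T) * ind (T 0 < t) * ind (Chain (rgt 0) m T) = 0 := by
    intro T
    by_cases h1 : Chain (lft s) n T
    · by_cases h2 : Chain (rgt 0) m T
      · exfalso
        have a := h1 (n - 1) (by omega)
        have b := h2 (s - n) (by omega)
        have e1 : lft s (n - 1 + 1) = rgt 0 (s - n) := by simp only [lft, rgt]; omega
        have e2 : lft s (n - 1) = rgt 0 (s - n + 1) := by simp only [lft, rgt]; omega
        rw [e1, e2] at a
        exact lt_asymm a b
      · rw [ind_false h2]; ring
    · rw [ind_false h1]; ring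
  simp [this]

lemma Y_sum (P : Measure (ℤ → ℝ)) (hP : IsUniformProduct P) {t : ℝ} (ht : t ∈ Icc (0 : ℝ) 1)
    {s n : ℕ} (hn : n ≤ s) :
    ∑ m ∈ Finset.range (s + 1), (-1 : ℝ) ^ m *
      ∫ T, gw t s T * ind (Chain (lft s) n T) * ind (T 0 < t) * ind (Chain (rgt 0) m T) ∂P =
    (∫ u in (0:ℝ)..t, Real.exp (-u) * (u ^ n / (n.factorial : ℝ))) * (1 - Ex (s - n) (-t)) +
      (-1) ^ (s - n) * ∫ u in (0:ℝ)..t, Real.exp (-u) * Hv t (s - n) n u := by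
  have hsub : Finset.range (s - n + 1) ⊆ Finset.range (s + 1) :=
    Finset.range_subset_range.2 (by omega)
  rw [← Finset.sum_subset hsub, Finset.sum_range_succ, Y_eq P hP ht (by omega)]
  · congr 1
    rw [Ex, Finset.sum_range_succ']
    simp only [pow_zero, Nat.factorial_zero, Nat.cast_one, div_one]
    rw [sub_add_cancel_right, ← Finset.sum_neg_distrib, Finset.mul_sum]
    refine Finset.sum_congr rfl fun m hm => ?_
    rw [Finset.mem_range] at hm
    rw [Y_small P hP ht (by omega), neg_pow t, pow_succ (-1 : ℝ)]
    ring
  · intro m h1 h2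
    rw [Finset.mem_range] at h1 h2
    rw [Y_big P (by omega) hn (by omega), mul_zero]

lemma middle (P : Measure (ℤ → ℝ)) (hP : IsUniformProduct P) {t : ℝ} (ht : t ∈ Icc (0 : ℝ) 1)
    {s : ℕ} (hse : Even s) :
    ∫ T, MB t s T * ML t s T * Real.exp (-T s) ∂P =
    ∫ u in (0:ℝ)..t, Real.exp (-u) * (Ex s (-u + -t) -
      ((t + u) ^ s + (t - u) ^ s) / (2 * (s.factorial : ℝ))) := by
  have e : ∀ T, MB t s T * ML t s T * Real.exp (-T s) =
      ∑ n ∈ Finset.range (s + 1), ((-1 : ℝ) ^ n * (gw t s T * ind (Chain (lft s) n T)) -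
        ∑ m ∈ Finset.range (s + 1), (-1 : ℝ) ^ n * ((-1 : ℝ) ^ m * (gw t s T *
          ind (Chain (lft s) n T) * ind (T 0 < t) * ind (Chain (rgt 0) m T)))) := by
    intro T
    rw [MB, ML]
    have : ∀ a b c d f : ℝ, (1 - a * b) * (c * d) * f = d * (c * f * (1 - a * b)) := by
      intros; ring
    rw [this, Finset.sum_mul]
    refine Finset.sum_congr rfl fun n _ => ?_
    rw [mul_sub, mul_sub, Finset.mul_sum, Finset.mul_sum, Finset.mul_sum, gw]
    congr 1
    · ring
    · refine Finset.sum_congr rfl fun m _ => ?_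
      ring
  have hN : ∀ n, Nice (fun T => gw t s T * ind (Chain (lft s) n T)) := fun n =>
    (Nice.gw t s).mul (Nice.chain _ _)
  have hN2 : ∀ n m, Nice (fun T => gw t s T * ind (Chain (lft s) n T) * ind (T 0 < t) *
    ind (Chain (rgt 0) m T)) := fun n m =>
    ((hN n).mul (Nice.ind (meas_lt_c _ _))).mul (Nice.chain _ _)
  have hN3 : ∀ n m, Nice (fun T => (-1 : ℝ) ^ n * ((-1 : ℝ) ^ m * (gw t s T *
          ind (Chain (lft s) n T) * ind (T 0 < t) * ind (Chain (rgt 0) m T)))) := fun n m =>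
    (Nice.const _).mul ((Nice.const _).mul (hN2 n m))
  simp only [e]
  rw [integral_finsetSum _ fun n _ => (((Nice.const _).mul (hN n)).sub
    (Nice.sum _ fun m _ => hN3 n m)).integrable hP]
  have hv : ∀ u : ℝ, Real.exp (-u) * (Ex s (-u + -t) -
      ((t + u) ^ s + (t - u) ^ s) / (2 * (s.factorial : ℝ))) =
      ∑ n ∈ Finset.range (s + 1), ((-1 : ℝ) ^ n * Ex (s - n) (-t) *
        (Real.exp (-u) * (u ^ n / (n.factorial : ℝ))) - Real.exp (-u) * Hv t (s - n) n u) := by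
    intro u
    rw [← Hv_sum, ← Ex_cauchy, ← Finset.sum_sub_distrib, Finset.mul_sum]
    refine Finset.sum_congr rfl fun n _ => ?_
    rw [neg_pow u]
    ring
  simp only [hv]
  have c1 : ∀ n, Continuous fun u : ℝ => (-1 : ℝ) ^ n * Ex (s - n) (-t) *
        (Real.exp (-u) * (u ^ n / (n.factorial : ℝ))) := fun n => by fun_prop
  have c2 : ∀ n, Continuous fun u : ℝ => Real.exp (-u) * Hv t (s - n) n u := fun n => by
    have := Hv_cont t (s - n) n
    fun_prop
  have c3 : ∀ n, Continuous fun u : ℝ => (-1 : ℝ) ^ n * Ex (s - n) (-t) *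
        (Real.exp (-u) * (u ^ n / (n.factorial : ℝ))) - Real.exp (-u) * Hv t (s - n) n u :=
    fun n => (c1 n).sub (c2 n)
  rw [intervalIntegral.integral_finsetSum fun n _ => (c3 n).intervalIntegrable _ _]
  refine Finset.sum_congr rfl fun n hn => ?_
  rw [Finset.mem_range] at hn
  rw [integral_sub (((Nice.const _).mul (hN n)).integrable hP)
    ((Nice.sum _ fun m _ => hN3 n m).integrable hP), integral_const_mul,
    integral_finsetSum _ fun m _ => (hN3 n m).integrable hP,
    intervalIntegral.integral_sub ((c1 n).intervalIntegrable _ _) ((c2 n).intervalIntegrable _ _),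
    intervalIntegral.integral_const_mul, X_eq P hP ht]
  simp only [integral_const_mul]
  rw [← Finset.mul_sum, Y_sum P hP ht (by omega)]
  have hsgn : (-1 : ℝ) ^ n * (-1) ^ (s - n) = 1 := by
    rw [← pow_add, show n + (s - n) = s by omega, hse.neg_one_pow]
  linear_combination (-(∫ u in (0:ℝ)..t, Real.exp (-u) * Hv t (s - n) n u)) * hsgn

theorem gamma_even (P : Measure (ℤ → ℝ)) (hP : IsUniformProduct P)
    (t : ℝ) (ht : t ∈ Icc (0 : ℝ) 1) (s : ℕ) (hs : 2 ≤ s) (hse : Even s) :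
    (P ((O t (-1))ᶜ ∩ (O t 0)ᶜ ∩ O t s)).toReal =
      -(1 / 2) * Real.exp (-2 * t) *
        ∑ i ∈ Finset.Icc 1 s, (-2 * t) ^ i / (Nat.factorial i) := by
  rw [reduce P hP t ht s hs hse, middle P hP ht hse, final_calc t s hs hse]
  have h1 : ∑ i ∈ Finset.Icc 1 s, (-2 * t) ^ i / (Nat.factorial i : ℝ) = Ex s (-2 * t) - 1 := by
    rw [Ex, Finset.range_eq_Ico, Finset.sum_eq_sum_Ico_succ_bot (by omega)]
    simp only [zero_add, pow_zero, Nat.factorial_zero, Nat.cast_one, div_one, add_sub_cancel_left]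
    rfl
  rw [h1, show -2 * t = -t + -t by ring, Real.exp_add]
  ring
end

section
/- For every t ∈ [0,1] and every even integer r ≥ 2, writing φ(t) = ℙ(O_0(t)) and p_s(t) = ℙ(O_0(t) ∩ O_s(t)), one has p_{r+1}(t) + p_r(t) = 2 φ(t)² − (1/2) e^{−2t} ∑_{i=r+1}^{∞} (−2t)^i/i!. -/
open MeasureTheory Set

open ProbabilityTheory

noncomputable section

/-- uniform law on [0,1] -/
def Uu : Measure ℝ := volume.restrict (Icc (0 : ℝ) 1)

instance instUu : IsProbabilityMeasure Uu := ⟨by simp [Uu]⟩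

/-- law of one-sided sequences -/
def muN : Measure (ℕ → ℝ) := Measure.infinitePi (fun _ : ℕ => Uu)

instance instMuN : IsProbabilityMeasure muN := by unfold muN; infer_instance

lemma eq_pi_of_isUniform {P : Measure (ℤ → ℝ)} (hP : IsUniformProduct P) :
    P = Measure.infinitePi (fun _ : ℤ => Uu) := by
  apply Measure.eq_infinitePi
  intro s t ht
  exact hP s t (fun i _ => ht i)

lemma split_indep {ι α β : Type*} {f : α → ι} {g : β → ι}
    (hd : Disjoint (range f) (range g)) :
    IndepFun (fun (ω : ι → ℝ) a => ω (f a)) (fun ω b => ω (g b))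
      (Measure.infinitePi (fun _ : ι => Uu)) := by
  have h : iIndepFun (fun i (ω : ι → ℝ) => ω i) (Measure.infinitePi (fun _ : ι => Uu)) :=
    iIndepFun_infinitePi (P := fun _ : ι => Uu) (X := fun _ x => x) (fun _ => measurable_id)
  have h2 := indep_iSup_of_disjoint (fun i => (measurable_pi_apply i).comap_le) h.iIndep hd
  refine indep_of_indep_of_le_left (indep_of_indep_of_le_right h2 ?_) ?_
  · rw [← measurable_iff_comap_le, @measurable_pi_iff]
    intro b
    rw [measurable_iff_comap_le]
    exact le_iSup₂_of_le (g b) (mem_range_self b) le_rfl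
  · rw [← measurable_iff_comap_le, @measurable_pi_iff]
    intro b
    rw [measurable_iff_comap_le]
    exact le_iSup₂_of_le (f b) (mem_range_self b) le_rfl

lemma map_inj {ι : Type*} {f : ℕ → ι} (hf : Function.Injective f) :
    (Measure.infinitePi (fun _ : ι => Uu)).map (fun ω n => ω (f n)) = muN :=
  Measure.map_infinitePi_infinitePi_of_inj hf

/-- cons -/
def cns (u : ℝ) (w : ℕ → ℝ) : ℕ → ℝ := fun n => Nat.casesOn n u w

@[simp] lemma cns_zero (u : ℝ) (w : ℕ → ℝ) : cns u w 0 = u := rfl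
@[simp] lemma cns_succ (u : ℝ) (w : ℕ → ℝ) (n : ℕ) : cns u w (n + 1) = w n := rfl

lemma cns_eta (w : ℕ → ℝ) : cns (w 0) (fun n => w (n + 1)) = w := by
  funext n; cases n <;> rfl

@[fun_prop]
lemma measurable_cns : Measurable (fun p : ℝ × (ℕ → ℝ) => cns p.1 p.2) := by
  rw [measurable_pi_iff]
  intro n
  cases n with
  | zero => exact measurable_fst
  | succ n => exact (measurable_pi_apply n).comp measurable_snd

lemma map_cns : (Uu.prod muN).map (fun p : ℝ × (ℕ → ℝ) => cns p.1 p.2) = muN := by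
  have h : IndepFun (fun (ω : ℕ → ℝ) => ω 0) (fun ω (n : ℕ) => ω (n + 1)) muN := by
    have := split_indep (f := fun _ : Unit => (0:ℕ)) (g := fun n : ℕ => n + 1)
      (by rw [Set.disjoint_left]; rintro _ ⟨_, rfl⟩ ⟨b, hb⟩; simp at hb)
    have hu : Measurable (fun x : Unit → ℝ => x ()) := by fun_prop
    exact this.comp (ψ := id) hu measurable_id
  have h1 := h.map_prod_eq_prod_map_map (Measurable.aemeasurable (by fun_prop))
    (Measurable.aemeasurable (by fun_prop))
  have e1 : muN.map (fun ω => ω 0) = Uu := Measure.infinitePi_map_eval (fun _ : ℕ => Uu) 0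
  have e2 : muN.map (fun ω (n : ℕ) => ω (n + 1)) = muN :=
    map_inj (ι := ℕ) (f := fun n => n + 1) (fun a b h => by simpa using h)
  rw [e1, e2] at h1
  rw [← h1, Measure.map_map (by fun_prop) (by fun_prop)]
  convert Measure.map_id
  funext w
  exact cns_eta w

/-- section probability -/
def sec (A : Set (ℕ → ℝ)) (u : ℝ) : ℝ := muN.real {w | cns u w ∈ A}

lemma measurableSet_sec {A : Set (ℕ → ℝ)} (hA : MeasurableSet A) (u : ℝ) :
    MeasurableSet {w | cns u w ∈ A} :=
  (measurable_cns.comp (measurable_const.prodMk measurable_id)) hA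

lemma measurable_sec' {A : Set (ℕ → ℝ)} (hA : MeasurableSet A) :
    Measurable (fun u => muN {w | cns u w ∈ A}) :=
  measurable_measure_prodMk_left (measurable_cns hA)

lemma measurable_sec {A : Set (ℕ → ℝ)} (hA : MeasurableSet A) : Measurable (sec A) :=
  (measurable_sec' hA).ennreal_toReal

lemma sec_nonneg (A : Set (ℕ → ℝ)) (u : ℝ) : 0 ≤ sec A u := measureReal_nonneg
lemma sec_le_one (A : Set (ℕ → ℝ)) (u : ℝ) : sec A u ≤ 1 := measureReal_le_one

lemma mu_eq_lintegral {A : Set (ℕ → ℝ)} (hA : MeasurableSet A) :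
    muN A = ∫⁻ u, muN {w | cns u w ∈ A} ∂Uu := by
  conv_lhs => rw [← map_cns]
  rw [Measure.map_apply measurable_cns hA, Measure.prod_apply (measurable_cns hA)]
  rfl

lemma mu_eq_integral {A : Set (ℕ → ℝ)} (hA : MeasurableSet A) :
    muN.real A = ∫ u, sec A u ∂Uu := by
  rw [Measure.real, mu_eq_lintegral hA]
  exact (integral_toReal (measurable_sec' hA).aemeasurable (by simp)).symm

/-- half-lines -/
def past (k : ℤ) (T : ℤ → ℝ) : ℕ → ℝ := fun i => T (k - i)
def fut (k : ℤ) (T : ℤ → ℝ) : ℕ → ℝ := fun i => T (k + i)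

@[fun_prop] lemma measurable_past (k : ℤ) : Measurable (past k) := by unfold past; fun_prop
@[fun_prop] lemma measurable_fut (k : ℤ) : Measurable (fut k) := by unfold fut; fun_prop

lemma isProb_s9 {P : Measure (ℤ → ℝ)} (hP : P = Measure.infinitePi (fun _ : ℤ => Uu))
    : IsProbabilityMeasure P := by rw [hP]; infer_instance

lemma map_past {P : Measure (ℤ → ℝ)} (hP : P = Measure.infinitePi (fun _ : ℤ => Uu))
    (k : ℤ) : P.map (past k) = muN := by
  rw [hP]; exact map_inj (f := fun i : ℕ => k - i) (fun a b h => by simpa using h)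

lemma map_fut {P : Measure (ℤ → ℝ)} (hP : P = Measure.infinitePi (fun _ : ℤ => Uu))
    (k : ℤ) : P.map (fut k) = muN := by
  rw [hP]; exact map_inj (f := fun i : ℕ => k + i) (fun a b h => by simpa using h)

lemma indep_pf {P : Measure (ℤ → ℝ)} (hP : P = Measure.infinitePi (fun _ : ℤ => Uu))
    {k m : ℤ} (h : k < m) : IndepFun (past k) (fut m) P := by
  rw [hP]
  apply split_indep
  rw [Set.disjoint_left]
  rintro _ ⟨a, rfl⟩ ⟨b, hb⟩
  simp only at hb
  omega

lemma prob_sep {P : Measure (ℤ → ℝ)} (hP : P = Measure.infinitePi (fun _ : ℤ => Uu))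
    {k m : ℤ} (h : k < m) {A B : Set (ℕ → ℝ)} (hA : MeasurableSet A)
    (hB : MeasurableSet B) :
    P.real {T | past k T ∈ A ∧ fut m T ∈ B} = muN.real A * muN.real B := by
  have := (indep_pf hP h).measure_inter_preimage_eq_mul A B hA hB
  have e1 : P (past k ⁻¹' A) = muN A := by
    rw [← Measure.map_apply (measurable_past k) hA, map_past hP]
  have e2 : P (fut m ⁻¹' B) = muN B := by
    rw [← Measure.map_apply (measurable_fut m) hB, map_fut hP]
  rw [e1, e2] at this
  simp only [Measure.real]
  rw [← ENNReal.toReal_mul, ← this]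
  rfl

lemma prob_site {P : Measure (ℤ → ℝ)} (hP : P = Measure.infinitePi (fun _ : ℤ => Uu))
    (k : ℤ) {A B : Set (ℕ → ℝ)} (hA : MeasurableSet A) (hB : MeasurableSet B) :
    P.real {T | past k T ∈ A ∧ fut k T ∈ B} = ∫ u, sec A u * sec B u ∂Uu := by
  have := isProb_s9 hP
  have h := (indep_pf hP (lt_add_one k)).map_prod_eq_prod_map_map
    (measurable_past k).aemeasurable (measurable_fut (k+1)).aemeasurable
  rw [map_past hP, map_fut hP] at h
  have hm : Measurable (fun p : (ℕ → ℝ) × (ℕ → ℝ) => cns (p.1 0) p.2) :=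
    measurable_cns.comp (f := fun p : (ℕ → ℝ) × (ℕ → ℝ) => (p.1 0, p.2)) (by fun_prop)
  have hS : MeasurableSet {p : (ℕ → ℝ) × (ℕ → ℝ) | p.1 ∈ A ∧ cns (p.1 0) p.2 ∈ B} :=
    (measurable_fst hA).inter (hm hB)
  have e : {T | past k T ∈ A ∧ fut k T ∈ B} =
      (fun T => (past k T, fut (k+1) T)) ⁻¹' {p | p.1 ∈ A ∧ cns (p.1 0) p.2 ∈ B} := by
    ext T
    have : fut k T = cns (past k T 0) (fut (k+1) T) := by
      funext n
      cases n with
      | zero => simp [fut, past]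
      | succ n => simp only [fut, cns_succ]; congr 1; push_cast; ring
    simp [this]
  have key : P {T | past k T ∈ A ∧ fut k T ∈ B} =
      ∫⁻ u, muN {w | cns u w ∈ A} * muN {w | cns u w ∈ B} ∂Uu := by
    rw [e, ← Measure.map_apply (by fun_prop) hS, h, Measure.prod_apply hS]
    have e3 : ∀ x : ℕ → ℝ, muN (Prod.mk x ⁻¹' {p | p.1 ∈ A ∧ cns (p.1 0) p.2 ∈ B}) =
        A.indicator (fun x => muN {w | cns (x 0) w ∈ B}) x := by
      intro x
      by_cases hx : x ∈ A <;> simp [hx]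
    simp_rw [e3]
    have hmB : Measurable (fun x : ℕ → ℝ => muN {w | cns (x 0) w ∈ B}) :=
      (measurable_sec' hB).comp (measurable_pi_apply 0)
    have hmu : ∀ F : (ℕ → ℝ) → ENNReal, ∫⁻ x, F x ∂muN =
        ∫⁻ x, F x ∂((Uu.prod muN).map (fun p : ℝ × (ℕ → ℝ) => cns p.1 p.2)) := by
      intro F; rw [map_cns]
    rw [hmu, lintegral_map (hmB.indicator hA) measurable_cns,
      lintegral_prod (fun z : ℝ × (ℕ → ℝ) =>
        A.indicator (fun x => muN {w | cns (x 0) w ∈ B}) (cns z.1 z.2)) ((hmB.indicator hA).comp measurable_cns).aemeasurable]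
    refine lintegral_congr fun u => ?_
    have : ∀ y, A.indicator (fun x : ℕ → ℝ => muN {w | cns (x 0) w ∈ B}) (cns u y) =
        {w | cns u w ∈ A}.indicator (fun _ => muN {w | cns u w ∈ B}) y := by
      intro y
      simp [indicator]
    simp_rw [this]
    rw [lintegral_indicator_const (measurableSet_sec hA u), mul_comm]
  rw [Measure.real, key]
  rw [← integral_toReal]
  · simp [sec, Measure.real]
  · exact ((measurable_sec' hA).mul (measurable_sec' hB)).aemeasurable
  · refine ae_of_all _ fun u => ?_
    exact ENNReal.mul_lt_top (measure_lt_top _ _) (measure_lt_top _ _)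


lemma integral_Uu {F f : ℝ → ℝ} {a b : ℝ} (ha : 0 ≤ a) (hab : a ≤ b) (hb : b ≤ 1)
    (h : ∀ v ∈ Ioo (0:ℝ) 1, F v = (Ioo a b).indicator f v) :
    ∫ v, F v ∂Uu = ∫ v in a..b, f v := by
  rw [Uu, integral_Icc_eq_integral_Ioo, setIntegral_congr_fun measurableSet_Ioo h,
    setIntegral_indicator measurableSet_Ioo, intervalIntegral.integral_of_le hab,
    integral_Ioc_eq_integral_Ioo, inter_eq_right.2 (Ioo_subset_Ioo ha hb)]

lemma grow {h : ℝ → ℝ} (hm : Measurable h) {C : ℝ} (hC : ∀ u, |h u| ≤ C)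
    (hi : ∀ u ∈ Icc (0:ℝ) 1, |h u| ≤ ∫ v in (0:ℝ)..u, |h v|) :
    ∀ u ∈ Icc (0:ℝ) 1, h u = 0 := by
  have hIntv : ∀ a b : ℝ, IntervalIntegrable (fun v => |h v|) volume a b := by
    intro a b
    refine (intervalIntegrable_const (c := C)).mono_fun hm.abs.aestronglyMeasurable ?_
    refine ae_of_all _ fun x => ?_
    simpa using (hC x).trans (le_abs_self C)
  have key : ∀ n : ℕ, ∀ u ∈ Icc (0:ℝ) 1, |h u| ≤ C * (u ^ n / n.factorial) := by
    intro n
    induction n with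
    | zero => intro u _; simpa using hC u
    | succ n ih =>
      intro u hu
      refine (hi u hu).trans ?_
      refine (intervalIntegral.integral_mono_on hu.1 (hIntv 0 u)
        (Continuous.intervalIntegrable (by fun_prop) _ _)
        (fun x hx => ih x ⟨hx.1, hx.2.trans hu.2⟩)).trans (le_of_eq ?_)
      rw [intervalIntegral.integral_const_mul, intervalIntegral.integral_div, integral_pow]
      rw [Nat.factorial_succ]
      push_cast
      have : (n.factorial : ℝ) ≠ 0 := by positivity
      have : (n : ℝ) + 1 ≠ 0 := by positivity
      field_simp
      simp
  intro u hu
  have hl : Filter.Tendsto (fun n : ℕ => C * (u ^ n / n.factorial)) Filter.atTop (nhds (C * 0)) :=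
    (FloorSemiring.tendsto_pow_div_factorial_atTop u).const_mul C
  rw [mul_zero] at hl
  have := ge_of_tendsto' hl (fun n => key n u hu)
  exact abs_eq_zero.1 (le_antisymm this (abs_nonneg _))

/-- first ascent at an even place -/
def okS : Set (ℕ → ℝ) :=
  {v | ∃ j : ℕ, (∀ i : ℕ, i < 2 * j → v (i + 1) < v i) ∧ v (2 * j) < v (2 * j + 1)}

def desc_s9 : Set (ℕ → ℝ) := {v | ∀ i : ℕ, v (i + 1) < v i}

def shf (v : ℕ → ℝ) : ℕ → ℝ := fun n => v (n + 1)

@[fun_prop] lemma measurable_shf : Measurable shf := by unfold shf; fun_prop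

/-- rising chain of length `k` and then good -/
def WS (t : ℝ) : ℕ → Set (ℕ → ℝ)
  | 0 => {v | v 0 < t ∧ v ∈ okS}
  | k + 1 => {v | v 0 < v 1 ∧ shf v ∈ WS t k}

lemma mlt (i j : ℕ) : MeasurableSet {v : ℕ → ℝ | v i < v j} :=
  measurableSet_lt (measurable_pi_apply i) (measurable_pi_apply j)

lemma measurableSet_okS : MeasurableSet okS := by
  have : okS = ⋃ j : ℕ, ((⋂ i : ℕ, ⋂ _ : i < 2 * j, {v : ℕ → ℝ | v (i + 1) < v i}) ∩
      {v : ℕ → ℝ | v (2 * j) < v (2 * j + 1)}) := by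
    ext v; simp [okS]
  rw [this]
  exact MeasurableSet.iUnion fun j => (MeasurableSet.iInter fun i =>
    MeasurableSet.iInter fun _ => mlt _ _).inter (mlt _ _)

lemma measurableSet_desc : MeasurableSet desc_s9 := by
  have : desc_s9 = ⋂ i : ℕ, {v : ℕ → ℝ | v (i + 1) < v i} := by
    ext v; simp [desc_s9]
  rw [this]
  exact MeasurableSet.iInter fun i => mlt _ _

lemma measurableSet_WS (t : ℝ) (k : ℕ) : MeasurableSet (WS t k) := by
  induction k with
  | zero =>
    exact (measurableSet_lt (measurable_pi_apply 0) measurable_const).inter measurableSet_okS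
  | succ k ih => exact (mlt 0 1).inter (measurable_shf ih)

lemma WS_sub_okS (t : ℝ) (k : ℕ) : WS t k ⊆ okS := by
  cases k with
  | zero => exact fun v hv => hv.2
  | succ k => exact fun v hv => ⟨0, by simp, by simpa using hv.1⟩

lemma ok_rec1 {v : ℕ → ℝ} (h : v ∈ okS) : ¬ (v 1 < v 0 ∧ shf v ∈ okS) := by
  obtain ⟨j, h1, h2⟩ := h
  rintro ⟨h0, j', h3, h4⟩
  simp only [shf] at h3 h4
  rcases lt_trichotomy (2 * j) (2 * j' + 1) with h | h | h
  · rcases Nat.eq_zero_or_pos j with rfl | hj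
    · simp at h2; linarith
    · have := h3 (2 * j - 1) (by omega)
      rw [show 2 * j - 1 + 1 = 2 * j by omega] at this
      linarith
  · omega
  · have := h1 _ h
    linarith

lemma ok_rec2 {v : ℕ → ℝ} (hn : ∀ i, v i ≠ v (i + 1)) (hd : v ∉ desc_s9) (h : v ∉ okS) :
    v 1 < v 0 ∧ shf v ∈ okS := by
  have hex : ∃ i, v i < v (i + 1) := by
    by_contra hc
    push Not at hc
    exact hd fun i => lt_of_le_of_ne (hc i) (hn i).symm
  classical
  have hs := Nat.find_spec hex
  have hmn : ∀ i < Nat.find hex, v (i + 1) < v i := fun i hi =>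
    lt_of_le_of_ne (not_lt.1 (Nat.find_min hex hi)) (hn i).symm
  generalize Nat.find hex = n at hs hmn
  rcases Nat.even_or_odd' n with ⟨j, rfl | rfl⟩
  · exact absurd ⟨j, hmn, hs⟩ h
  · exact ⟨hmn 0 (by omega), j, fun i hi => hmn (i + 1) (by omega), hs⟩

lemma sec_lt (A : Set (ℕ → ℝ)) (u v : ℝ) :
    sec {w | w 0 < u ∧ w ∈ A} v = (Iio u).indicator (sec A) v := by
  by_cases h : v < u <;> simp [sec, h]

lemma sec_gt (A : Set (ℕ → ℝ)) (u v : ℝ) :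
    sec {w | u < w 0 ∧ w ∈ A} v = (Ioi u).indicator (sec A) v := by
  by_cases h : u < v <;> simp [sec, h]

lemma mu_lt_s9 {A : Set (ℕ → ℝ)} (hA : MeasurableSet A) {u : ℝ} (hu : u ∈ Icc (0:ℝ) 1) :
    muN.real {w | w 0 < u ∧ w ∈ A} = ∫ v in (0:ℝ)..u, sec A v := by
  have hm : MeasurableSet {w : ℕ → ℝ | w 0 < u ∧ w ∈ A} :=
    (measurableSet_lt (measurable_pi_apply 0) measurable_const).inter hA
  rw [mu_eq_integral hm]
  refine integral_Uu le_rfl hu.1 hu.2 fun v hv => ?_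
  rw [sec_lt]
  by_cases h : v < u <;> simp [h, hv.1]

lemma mu_desc : muN desc_s9 = 0 := by
  have hrec : ∀ u ∈ Icc (0:ℝ) 1, sec desc_s9 u = ∫ v in (0:ℝ)..u, sec desc_s9 v := by
    intro u hu
    rw [← mu_lt_s9 measurableSet_desc hu, sec]
    congr 1
    ext w
    constructor
    · intro h; exact ⟨h 0, fun i => h (i + 1)⟩
    · rintro ⟨h0, h⟩ i
      cases i with
      | zero => exact h0
      | succ i => exact h i
  have habs : ∀ v, |sec desc_s9 v| = sec desc_s9 v := fun v => abs_of_nonneg (sec_nonneg _ _)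
  have h0 := grow (measurable_sec measurableSet_desc) (C := 1)
    (fun u => by rw [habs]; exact sec_le_one _ _)
    (fun u hu => by simp only [habs]; exact (hrec u hu).le)
  have : muN.real desc_s9 = 0 := by
    rw [mu_eq_integral measurableSet_desc]
    rw [integral_Uu (f := fun _ => 0) le_rfl zero_le_one le_rfl]
    · simp
    · intro v hv
      rw [h0 v ⟨hv.1.le, hv.2.le⟩]; simp
  exact (measureReal_eq_zero_iff).1 this

lemma mu_eq_const (u : ℝ) : muN {w | w 0 = u} = 0 := by
  have e1 : muN.map (fun ω => ω 0) = Uu := Measure.infinitePi_map_eval (fun _ : ℕ => Uu) 0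
  have : muN ((fun w : ℕ → ℝ => w 0) ⁻¹' {u}) = 0 := by
    rw [← Measure.map_apply (measurable_pi_apply 0) (measurableSet_singleton u), e1, Uu]
    exact measure_mono_null (subset_refl _) (by simp)
  exact this

lemma mu_tie0 : muN {w | w 0 = w 1} = 0 := by
  rw [mu_eq_lintegral (measurableSet_eq_fun (measurable_pi_apply 0) (measurable_pi_apply 1))]
  rw [lintegral_eq_zero_iff (measurable_sec'
    (measurableSet_eq_fun (measurable_pi_apply 0) (measurable_pi_apply 1)))]
  refine ae_of_all _ fun u => ?_
  have := mu_eq_const u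
  simp only [Set.mem_ofPred_eq, Pi.zero_apply]
  convert this using 4
  exact eq_comm

lemma mu_tie (i : ℕ) : muN {w | w i = w (i + 1)} = 0 := by
  have e : muN.map (fun ω (n : ℕ) => ω (i + n)) = muN :=
    map_inj (ι := ℕ) (f := fun n => i + n) (fun a b h => by simpa using h)
  have := mu_tie0
  rw [← e, Measure.map_apply (by fun_prop)
    (measurableSet_eq_fun (measurable_pi_apply 0) (measurable_pi_apply 1))] at this
  exact this

lemma ae_good : ∀ᵐ w ∂muN, (∀ i, w i ≠ w (i + 1)) ∧ w ∉ desc_s9 := by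
  refine Filter.Eventually.and ?_ ?_
  · rw [ae_all_iff]
    intro i
    rw [ae_iff]
    simpa using mu_tie i
  · rw [ae_iff]
    simpa using mu_desc

lemma ae_ok : ∀ᵐ v ∂muN, (v ∈ okS ↔ ¬ (v 1 < v 0 ∧ shf v ∈ okS)) := by
  filter_upwards [ae_good] with v hv
  exact ⟨ok_rec1, fun h => by by_contra hc; exact h (ok_rec2 hv.1 hv.2 hc)⟩

lemma ae_ok_cns (u : ℝ) : ∀ᵐ w ∂muN, (cns u w ∈ okS ↔ ¬ (w 0 < u ∧ w ∈ okS)) := by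
  have h0 : ∀ᵐ w ∂muN, w 0 ≠ u := by
    rw [ae_iff]; simpa using mu_eq_const u
  filter_upwards [ae_good, h0] with w hw hw0
  refine ⟨ok_rec1, fun h => by
    by_contra hc
    refine h (ok_rec2 ?_ ?_ hc)
    · intro i
      cases i with
      | zero => exact hw0.symm
      | succ i => exact hw.1 i
    · exact fun hd => hw.2 fun i => hd (i + 1)⟩

lemma sec_ok {u : ℝ} (hu : u ∈ Icc (0:ℝ) 1) : sec okS u = Real.exp (-u) := by
  have hrec : ∀ u ∈ Icc (0:ℝ) 1, sec okS u = 1 - ∫ v in (0:ℝ)..u, sec okS v := by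
    intro u hu
    have hm : MeasurableSet {w : ℕ → ℝ | w 0 < u ∧ w ∈ okS} :=
      (measurableSet_lt (measurable_pi_apply 0) measurable_const).inter measurableSet_okS
    rw [← mu_lt_s9 measurableSet_okS hu, ← probReal_compl_eq_one_sub hm, sec]
    refine measureReal_congr ?_
    filter_upwards [ae_ok_cns u] with w hw
    exact propext hw
  have hIntv : ∀ a b : ℝ, IntervalIntegrable (sec okS) volume a b := by
    intro a b
    refine (intervalIntegrable_const (c := (1:ℝ))).mono_fun
      (measurable_sec measurableSet_okS).aestronglyMeasurable ?_
    refine ae_of_all _ fun x => ?_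
    simpa [abs_of_nonneg (sec_nonneg _ _)] using sec_le_one okS x
  have hexp : ∀ u : ℝ, Real.exp (-u) = 1 - ∫ v in (0:ℝ)..u, Real.exp (-v) := by
    intro u
    rw [intervalIntegral.integral_comp_neg (fun x => Real.exp x), integral_exp]; simp
  let h : ℝ → ℝ := fun u => (Icc (0:ℝ) 1).indicator (fun u => sec okS u - Real.exp (-u)) u
  have hm : Measurable h :=
    ((measurable_sec measurableSet_okS).sub (by fun_prop)).indicator measurableSet_Icc
  have hval : ∀ u ∈ Icc (0:ℝ) 1, h u = sec okS u - Real.exp (-u) := fun u hu => by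
    simp only [h]; rw [indicator_of_mem hu]
  have := grow hm (C := 2) (fun u => ?_) (fun u hu => ?_) u hu
  · rw [hval u hu] at this; linarith
  · by_cases hu : u ∈ Icc (0:ℝ) 1
    · rw [hval u hu, abs_le]
      have h1 := sec_nonneg okS u
      have h2 := sec_le_one okS u
      have h3 := Real.exp_pos (-u)
      have h4 : Real.exp (-u) ≤ 1 := Real.exp_le_one_iff.2 (by linarith [hu.1])
      constructor <;> linarith
    · simp [h, hu]
  · have e : h u = -∫ v in (0:ℝ)..u, h v := by
      rw [hval u hu, hrec u hu, hexp u]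
      have : ∫ v in (0:ℝ)..u, h v = ∫ v in (0:ℝ)..u, (sec okS v - Real.exp (-v)) := by
        refine intervalIntegral.integral_congr fun v hv => ?_
        rw [uIcc_of_le hu.1] at hv
        exact hval v ⟨hv.1, hv.2.trans hu.2⟩
      rw [this, intervalIntegral.integral_sub (hIntv _ _)
        (Continuous.intervalIntegrable (by fun_prop) _ _)]
      ring
    rw [e, abs_neg]
    exact intervalIntegral.abs_integral_le_integral_abs hu.1

/-- explicit section function -/
def gk (t : ℝ) (k : ℕ) (u : ℝ) : ℝ :=
  Real.exp (-u) - Real.exp (-t) * ∑ m ∈ Finset.range k, (t - u) ^ m / m.factorial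

lemma gk_cont (t : ℝ) (k : ℕ) : Continuous (gk t k) := by unfold gk; fun_prop

lemma gk_top (t : ℝ) (k : ℕ) : gk t (k + 1) t = 0 := by
  simp [gk, Finset.sum_range_succ']

lemma gk_deriv (t : ℝ) (k : ℕ) (u : ℝ) : HasDerivAt (gk t (k + 1)) (-(gk t k u)) u := by
  have h1 : ∀ m : ℕ, HasDerivAt (fun u : ℝ => (t - u) ^ (m + 1) / (m + 1).factorial)
      (-((t - u) ^ m / m.factorial)) u := by
    intro m
    have := (((hasDerivAt_id u).const_sub t).pow (m + 1)).div_const ((m + 1).factorial : ℝ)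
    refine HasDerivAt.congr_deriv (f := fun u : ℝ => (t - u) ^ (m + 1) / (m + 1).factorial) this ?_
    simp only [id, Nat.factorial_succ]
    push_cast
    have : (m.factorial : ℝ) ≠ 0 := by positivity
    have : (m : ℝ) + 1 ≠ 0 := by positivity
    field_simp
  have h2 := HasDerivAt.fun_sum (u := Finset.range k) (fun m _ => h1 m)
  have h3 := ((hasDerivAt_neg u).exp).sub ((h2.add_const (1:ℝ)).const_mul (Real.exp (-t)))
  have e : gk t (k + 1) = (fun x => Real.exp (-x)) - fun x => Real.exp (-t) *
      (∑ m ∈ Finset.range k, (t - x) ^ (m + 1) / (m + 1).factorial + 1) := by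
    funext x
    simp [gk, Finset.sum_range_succ']
  rw [e]
  refine h3.congr_deriv ?_
  simp only [gk, Finset.sum_neg_distrib]
  ring

lemma gk_int (t : ℝ) (k : ℕ) (u : ℝ) : ∫ v in u..t, gk t k v = gk t (k + 1) u := by
  have := intervalIntegral.integral_eq_sub_of_hasDerivAt (a := u) (b := t)
    (f := fun x => - gk t (k+1) x) (f' := gk t k)
    (fun x _ => by rw [← neg_neg (gk t k x)]; exact (gk_deriv t k x).neg) ((gk_cont t k).intervalIntegrable _ _)
  rw [this, gk_top]; ring

lemma sec_WS {t : ℝ} (ht : t ∈ Icc (0:ℝ) 1) (k : ℕ) {u : ℝ} (hu : u ∈ Icc (0:ℝ) 1) :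
    sec (WS t k) u = (Iio t).indicator (gk t k) u := by
  induction k generalizing u with
  | zero =>
    have : WS t 0 = {w | w 0 < t ∧ w ∈ okS} := rfl
    rw [this, sec_lt]
    by_cases h : u < t
    · simp [h, sec_ok hu, gk]
    · simp [h]
  | succ k ih =>
    have e : sec (WS t (k + 1)) u = muN.real {w | u < w 0 ∧ w ∈ WS t k} := rfl
    have hm : MeasurableSet {w : ℕ → ℝ | u < w 0 ∧ w ∈ WS t k} :=
      (measurableSet_lt measurable_const (measurable_pi_apply 0)).inter (measurableSet_WS t k)
    rw [e, mu_eq_integral hm]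
    simp_rw [sec_gt]
    by_cases h : u < t
    · rw [integral_Uu (f := gk t k) hu.1 h.le ht.2, gk_int]
      · simp [h]
      · intro v hv
        have := ih (u := v) ⟨hv.1.le, hv.2.le⟩
        by_cases h1 : u < v <;> by_cases h2 : v < t <;> simp_all
    · rw [integral_Uu (f := fun _ => 0) le_rfl zero_le_one le_rfl]
      · simp [h]
      · intro v hv
        have := ih (u := v) ⟨hv.1.le, hv.2.le⟩
        have h2 : u < v → ¬ v < t := fun h1 h2 => h (h1.trans h2)
        by_cases h1 : u < v <;> simp_all

lemma mu_WS {t : ℝ} (ht : t ∈ Icc (0:ℝ) 1) (k : ℕ) : muN.real (WS t k) = gk t (k + 1) 0 := by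
  rw [mu_eq_integral (measurableSet_WS t k), ← gk_int]
  refine integral_Uu le_rfl ht.1 ht.2 fun v hv => ?_
  rw [sec_WS ht k ⟨hv.1.le, hv.2.le⟩]
  by_cases h : v < t <;> simp [h, hv.1]

lemma O_eq (t : ℝ) (s : ℤ) :
    O t s = {T | T s < t ∧ past s T ∈ okS ∧ fut s T ∈ okS} := by
  have hp : ∀ (T : ℤ → ℝ) (i : ℕ), past s T (i + 1) = T (s - i - 1) := by
    intro T i; simp only [past]; congr 1; push_cast; ring
  have hf : ∀ (T : ℤ → ℝ) (i : ℕ), fut s T (i + 1) = T (s + i + 1) := by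
    intro T i; simp only [fut]; congr 1; push_cast; ring
  ext T
  simp only [O, G, okS, Set.mem_iUnion, Set.mem_ofPred_eq, hp, hf]
  simp only [past, fut]
  push_cast
  constructor
  · rintro ⟨j, k, h1, h2, h3, h4, h5⟩
    exact ⟨h1, ⟨j, h2, h3⟩, ⟨k, h4, h5⟩⟩
  · rintro ⟨h1, ⟨j, h2, h3⟩, ⟨k, h4, h5⟩⟩
    exact ⟨j, k, h1, h2, h3, h4, h5⟩

lemma mem_WS_zero {t : ℝ} {v : ℕ → ℝ} : v ∈ WS t 0 ↔ v 0 < t ∧ v ∈ okS := Iff.rfl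
lemma mem_WS_succ {t : ℝ} {k : ℕ} {v : ℕ → ℝ} :
    v ∈ WS t (k + 1) ↔ v 0 < v 1 ∧ shf v ∈ WS t k := Iff.rfl

lemma shf_past (k : ℤ) (T : ℤ → ℝ) : shf (past k T) = past (k - 1) T := by
  funext n; simp only [shf, past]; congr 1; push_cast; ring
lemma shf_fut (k : ℤ) (T : ℤ → ℝ) : shf (fut k T) = fut (k + 1) T := by
  funext n; simp only [shf, fut]; congr 1; push_cast; ring
lemma past_zero (k : ℤ) (T : ℤ → ℝ) : past k T 0 = T k := by simp [past]
lemma fut_zero (k : ℤ) (T : ℤ → ℝ) : fut k T 0 = T k := by simp [fut]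
lemma past_one (k : ℤ) (T : ℤ → ℝ) : past k T 1 = T (k - 1) := by simp [past]
lemma fut_one (k : ℤ) (T : ℤ → ℝ) : fut k T 1 = T (k + 1) := by simp [fut]

lemma ae_fut {P : Measure (ℤ → ℝ)} (hP : P = Measure.infinitePi (fun _ : ℤ => Uu)) (k : ℤ) :
    ∀ᵐ T ∂P, (fut k T ∈ okS ↔ ¬ (T (k + 1) < T k ∧ fut (k + 1) T ∈ okS)) := by
  have h := ae_ok
  rw [← map_fut hP k] at h
  have := ae_of_ae_map (measurable_fut k).aemeasurable h
  simpa only [shf_fut, fut_zero, fut_one] using this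

lemma ae_past {P : Measure (ℤ → ℝ)} (hP : P = Measure.infinitePi (fun _ : ℤ => Uu)) (k : ℤ) :
    ∀ᵐ T ∂P, (past k T ∈ okS ↔ ¬ (T (k - 1) < T k ∧ past (k - 1) T ∈ okS)) := by
  have h := ae_ok
  rw [← map_past hP k] at h
  have := ae_of_ae_map (measurable_past k).aemeasurable h
  simpa only [shf_past, past_zero, past_one] using this

/-- separated event probability -/
def Sp (P : Measure (ℤ → ℝ)) (t : ℝ) (s k l : ℕ) : ℝ :=
  P.real {T | past k T ∈ WS t k ∧ fut ((s : ℤ) - l) T ∈ WS t l}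
def Np (P : Measure (ℤ → ℝ)) (t : ℝ) (s k l : ℕ) : ℝ :=
  P.real {T | past k T ∈ WS t k ∧ past ((s : ℤ) - l) T ∈ okS ∧ fut ((s : ℤ) - l) T ∈ WS t l}
def Qp (P : Measure (ℤ → ℝ)) (t : ℝ) (s k l : ℕ) : ℝ :=
  P.real {T | past k T ∈ WS t k ∧ fut k T ∈ okS ∧ past ((s : ℤ) - l) T ∈ okS ∧
    fut ((s : ℤ) - l) T ∈ WS t l}

lemma Sp_rec {P : Measure (ℤ → ℝ)} (hP : P = Measure.infinitePi (fun _ : ℤ => Uu))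
    (t : ℝ) (s k l : ℕ) : Sp P t s k l = Np P t s k l + Np P t s k (l + 1) := by
  have := isProb_s9 hP
  have hm : MeasurableSet {T : ℤ → ℝ | past ((s : ℤ) - l) T ∈ okS} :=
    measurable_past _ measurableSet_okS
  rw [Sp, ← measureReal_inter_add_sdiff hm]
  congr 1
  · rw [Np]; congr 1; ext T; simp only [mem_inter_iff, Set.mem_ofPred_eq]; tauto
  · rw [Np]
    refine measureReal_congr ?_
    filter_upwards [ae_past hP ((s : ℤ) - l)] with T hT
    refine propext ?_
    change (_ ∧ _) ∧ ¬ (_ ∈ okS) ↔ _ ∧ _ ∧ _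
    rw [mem_WS_succ, shf_fut, fut_zero, fut_one, hT]
    have e : ((s : ℤ) - (l + 1 : ℕ)) = (s : ℤ) - l - 1 := by push_cast; ring
    rw [e, sub_add_cancel]
    tauto

lemma Np_rec {P : Measure (ℤ → ℝ)} (hP : P = Measure.infinitePi (fun _ : ℤ => Uu))
    (t : ℝ) (s k l : ℕ) : Np P t s k l = Qp P t s k l + Qp P t s (k + 1) l := by
  have := isProb_s9 hP
  have hm : MeasurableSet {T : ℤ → ℝ | fut (k : ℤ) T ∈ okS} :=
    measurable_fut _ measurableSet_okS
  rw [Np, ← measureReal_inter_add_sdiff hm]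
  congr 1
  · rw [Qp]; congr 1; ext T; simp only [mem_inter_iff, Set.mem_ofPred_eq]; tauto
  · rw [Qp]
    refine measureReal_congr ?_
    filter_upwards [ae_fut hP (k : ℤ)] with T hT
    refine propext ?_
    change (_ ∧ _ ∧ _) ∧ ¬ (_ ∈ okS) ↔ _ ∧ _ ∧ _ ∧ _
    rw [mem_WS_succ, shf_past, past_zero, past_one, hT]
    have e : ((k + 1 : ℕ) : ℤ) = (k : ℤ) + 1 := by push_cast; ring
    rw [e, add_sub_cancel_right]
    tauto

/-- overlap integrals -/
def Jk (t : ℝ) (k l : ℕ) : ℝ := ∫ u in (0:ℝ)..t, gk t k u * gk t l u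

lemma Sp_sep {P : Measure (ℤ → ℝ)} (hP : P = Measure.infinitePi (fun _ : ℤ => Uu))
    {t : ℝ} (ht : t ∈ Icc (0:ℝ) 1) {s k l : ℕ} (h : k + l < s) :
    Sp P t s k l = gk t (k + 1) 0 * gk t (l + 1) 0 := by
  rw [Sp, prob_sep hP (by omega) (measurableSet_WS t k) (measurableSet_WS t l), mu_WS ht, mu_WS ht]

lemma Sp_bd {P : Measure (ℤ → ℝ)} (hP : P = Measure.infinitePi (fun _ : ℤ => Uu))
    {t : ℝ} (ht : t ∈ Icc (0:ℝ) 1) {s k l : ℕ} (h : k + l = s) :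
    Sp P t s k l = Jk t k l := by
  have e : (s : ℤ) - l = k := by omega
  rw [Sp, e, prob_site hP _ (measurableSet_WS t k) (measurableSet_WS t l)]
  refine integral_Uu le_rfl ht.1 ht.2 fun v hv => ?_
  rw [sec_WS ht k ⟨hv.1.le, hv.2.le⟩, sec_WS ht l ⟨hv.1.le, hv.2.le⟩]
  by_cases h : v < t <;> simp [h, hv.1]

lemma Np_bd {P : Measure (ℤ → ℝ)} (hP : P = Measure.infinitePi (fun _ : ℤ => Uu))
    {t : ℝ} (ht : t ∈ Icc (0:ℝ) 1) {s k l : ℕ} (h : k + l = s) :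
    Np P t s k l = Jk t k l := by
  have e : (s : ℤ) - l = k := by omega
  rw [← Sp_bd hP ht h, Np, Sp, e]
  congr 1
  ext T
  exact ⟨fun h => ⟨h.1, h.2.2⟩, fun h => ⟨h.1, WS_sub_okS t k h.1, h.2⟩⟩

lemma Qp_bd {P : Measure (ℤ → ℝ)} (hP : P = Measure.infinitePi (fun _ : ℤ => Uu))
    {t : ℝ} (ht : t ∈ Icc (0:ℝ) 1) {s k l : ℕ} (h : k + l = s) :
    Qp P t s k l = Jk t k l := by
  have e : (s : ℤ) - l = k := by omega
  rw [← Sp_bd hP ht h, Qp, Sp, e]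
  congr 1
  ext T
  exact ⟨fun h => ⟨h.1, h.2.2.2⟩, fun h => ⟨h.1, WS_sub_okS t l h.2, WS_sub_okS t k h.1, h.2⟩⟩

lemma alt_sum_s9 {a b : ℕ → ℝ} (h : ∀ i, b i = a i + a (i + 1)) (n : ℕ) :
    a 0 = ∑ i ∈ Finset.range n, (-1) ^ i * b i + (-1) ^ n * a n := by
  induction n with
  | zero => simp
  | succ n ih => rw [Finset.sum_range_succ, ih, h n, pow_succ]; ring

/-- convolution of the separated weights -/
def Bm (t : ℝ) (m : ℕ) : ℝ := ∑ k ∈ Finset.range (m + 1), gk t (k + 1) 0 * gk t (m - k + 1) 0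
def Ss (t : ℝ) (s : ℕ) : ℝ := ∑ k ∈ Finset.range (s + 1), Jk t k (s - k)

lemma Qp_formula {P : Measure (ℤ → ℝ)} (hP : P = Measure.infinitePi (fun _ : ℤ => Uu))
    {t : ℝ} (ht : t ∈ Icc (0:ℝ) 1) (s : ℕ) :
    Qp P t s 0 0 = ∑ m ∈ Finset.range s, (-1) ^ m * Bm t m + (-1) ^ s * Ss t s := by
  rw [alt_sum_s9 (a := fun k => Qp P t s k 0) (fun k => Np_rec hP t s k 0) s]
  rw [Qp_bd hP ht (add_zero s)]
  have hN : ∀ i ∈ Finset.range s, (-1 : ℝ) ^ i * Np P t s i 0 =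
      ∑ j ∈ Finset.range (s - i), (-1) ^ (i + j) * (gk t (i + 1) 0 * gk t (j + 1) 0) +
        (-1) ^ s * Jk t i (s - i) := by
    intro i hi
    have hi' : i < s := Finset.mem_range.1 hi
    rw [alt_sum_s9 (a := fun l => Np P t s i l) (fun l => Sp_rec hP t s i l) (s - i)]
    rw [Np_bd hP ht (show i + (s - i) = s by omega), mul_add, ← mul_assoc, ← pow_add,
      show i + (s - i) = s by omega, Finset.mul_sum]
    congr 1
    refine Finset.sum_congr rfl fun j hj => ?_
    have hj' : j < s - i := Finset.mem_range.1 hj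
    rw [Sp_sep hP ht (by omega), pow_add]; ring
  rw [Finset.sum_congr rfl hN, Finset.sum_add_distrib,
    ← Finset.sum_range_diag_flip s (fun i j => (-1 : ℝ) ^ (i + j) * (gk t (i + 1) 0 * gk t (j + 1) 0)),
    Ss, Finset.sum_range_succ, ← Finset.mul_sum, Nat.sub_self, add_assoc, ← mul_add]
  congr 1
  refine Finset.sum_congr rfl fun m _ => ?_
  rw [Bm, Finset.mul_sum]
  refine Finset.sum_congr rfl fun k hk => ?_
  have : k < m + 1 := Finset.mem_range.1 hk
  rw [show k + (m - k) = m by omega]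

lemma pair_eq {P : Measure (ℤ → ℝ)} (t : ℝ) (s : ℕ) :
    (P (O t 0 ∩ O t (s : ℤ))).toReal = Qp P t s 0 0 := by
  rw [Qp, Measure.real]
  congr 2
  rw [O_eq, O_eq]
  ext T
  simp only [mem_inter_iff, Set.mem_ofPred_eq, mem_WS_zero, Nat.cast_zero, sub_zero,
    past_zero, fut_zero]
  tauto

lemma one_eq {P : Measure (ℤ → ℝ)} (hP : P = Measure.infinitePi (fun _ : ℤ => Uu))
    {t : ℝ} (ht : t ∈ Icc (0:ℝ) 1) :
    (P (O t 0)).toReal = (1 - Real.exp (-2 * t)) / 2 := by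
  have e : O t 0 = {T | past 0 T ∈ WS t 0 ∧ fut 0 T ∈ okS} := by
    rw [O_eq]
    ext T
    simp only [Set.mem_ofPred_eq, mem_WS_zero, past_zero]
    tauto
  rw [e]
  change P.real _ = _
  rw [prob_site hP _ (measurableSet_WS t 0) measurableSet_okS,
    integral_Uu (f := fun u => Real.exp (-2 * u)) le_rfl ht.1 ht.2]
  · rw [intervalIntegral.integral_comp_mul_left (fun x => Real.exp x) (by norm_num), integral_exp]
    simp; ring
  · intro v hv
    rw [sec_WS ht 0 ⟨hv.1.le, hv.2.le⟩, sec_ok ⟨hv.1.le, hv.2.le⟩]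
    by_cases h : v < t
    · simp [h, hv.1, gk, ← Real.exp_add]; ring
    · simp [h]

def Ee (n : ℕ) (x : ℝ) : ℝ := ∑ i ∈ Finset.range n, x ^ i / i.factorial
def lam (k : ℕ) (x : ℝ) : ℝ := Real.exp (-x) * Ee (k + 1) x
def kap (m : ℕ) (x : ℝ) : ℝ := ∑ j ∈ Finset.range (m + 1), lam j x

lemma Ee_zero (k : ℕ) : Ee (k + 1) 0 = 1 := by
  simp [Ee, Finset.sum_range_succ']

lemma Ee_conv (t : ℝ) (m : ℕ) :
    ∑ k ∈ Finset.range (m + 1), Ee (k + 1) t * Ee (m - k + 1) t =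
      ∑ j ∈ Finset.range (m + 1), Ee (j + 1) (2 * t) := by
  have hc : ∀ (a : ℝ) (n : ℕ), PowerSeries.coeff n (PowerSeries.rescale a (PowerSeries.exp ℝ)) =
      a ^ n / n.factorial := by
    intro a n
    simp [PowerSeries.coeff_rescale, PowerSeries.coeff_exp, div_eq_mul_inv]
  have h1 : ∀ a : ℝ, PowerSeries.mk (fun k => Ee (k + 1) a) =
      PowerSeries.rescale a (PowerSeries.exp ℝ) * PowerSeries.mk (fun _ => (1:ℝ)) := by
    intro a
    ext n
    rw [PowerSeries.coeff_mul, Finset.Nat.sum_antidiagonal_eq_sum_range_succ_mk]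
    simp only [PowerSeries.coeff_mk, hc, mul_one]
    rfl
  have h2 : PowerSeries.mk (fun k => Ee (k + 1) t) * PowerSeries.mk (fun k => Ee (k + 1) t) =
      PowerSeries.mk (fun k => Ee (k + 1) (2 * t)) * PowerSeries.mk (fun _ => (1:ℝ)) := by
    rw [h1, h1, two_mul, ← PowerSeries.exp_mul_exp_eq_exp_add]; ring
  have h3 := congrArg (PowerSeries.coeff m) h2
  rw [PowerSeries.coeff_mul, PowerSeries.coeff_mul,
    Finset.Nat.sum_antidiagonal_eq_sum_range_succ_mk,
    Finset.Nat.sum_antidiagonal_eq_sum_range_succ_mk] at h3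
  simpa only [PowerSeries.coeff_mk, mul_one] using h3

lemma gk_zero_eq (t : ℝ) (k : ℕ) : gk t (k + 1) 0 = 1 - lam k t := by
  simp [gk, lam, Ee]

lemma Bm_eq (t : ℝ) (m : ℕ) : Bm t m = kap m (2 * t) - 2 * kap m t + kap m 0 := by
  have h0 : kap m 0 = m + 1 := by
    simp [kap, lam, Ee_zero]
  have h2 : kap m (2 * t) = ∑ k ∈ Finset.range (m + 1), lam k t * lam (m - k) t := by
    have : ∀ k, lam k t * lam (m - k) t =
        Real.exp (-(2 * t)) * (Ee (k + 1) t * Ee (m - k + 1) t) := by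
      intro k
      rw [lam, lam, show -(2 * t) = -t + -t by ring, Real.exp_add]; ring
    simp only [this]
    rw [← Finset.mul_sum, Ee_conv, kap, Finset.mul_sum]
    rfl
  have h3 : ∑ k ∈ Finset.range (m + 1), lam (m - k) t = kap m t := by
    have := Finset.sum_range_reflect (fun k => lam k t) (m + 1)
    simpa [kap] using this
  rw [h0, h2, Bm]
  simp only [gk_zero_eq]
  have : ∀ k, (1 - lam k t) * (1 - lam (m - k) t) =
      lam k t * lam (m - k) t - lam k t - lam (m - k) t + 1 := fun k => by ring
  simp only [this, Finset.sum_add_distrib, Finset.sum_sub_distrib, h3]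
  simp [kap]
  ring

lemma Z_kap (x : ℝ) (p : ℕ) :
    2 * ∑ m ∈ Finset.range (2 * p + 2), (-1) ^ m * kap m x + 1 / 2 * kap (2 * p + 2) x +
      1 / 2 * kap (2 * p + 1) x = 1 / 2 * Real.exp (-x) * Ee (2 * p + 3) (-x) := by
  induction p with
  | zero =>
    simp [Finset.sum_range_succ, kap, lam, Ee, Nat.factorial]
    ring
  | succ p ih =>
    have e1 : ∀ n, kap (n + 1) x = kap n x + lam (n + 1) x := fun n => by
      rw [kap, Finset.sum_range_succ]; rfl
    have e2 : ∀ n, lam (n + 1) x = lam n x + Real.exp (-x) * (x ^ (n + 1) / (n + 1).factorial) :=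
      fun n => by rw [lam, lam, Ee, Finset.sum_range_succ]; simp only [Ee]; ring
    have e3 : Ee (2 * (p + 1) + 3) (-x) = Ee (2 * p + 3) (-x) +
        (-(x ^ (2 * p + 3) / (2 * p + 3).factorial)) + x ^ (2 * p + 4) / (2 * p + 4).factorial := by
      rw [show 2 * (p + 1) + 3 = 2 * p + 3 + 1 + 1 by ring, Ee, Finset.sum_range_succ,
        Finset.sum_range_succ, Odd.neg_pow ⟨p + 1, by ring⟩,
        Even.neg_pow (n := 2 * p + 3 + 1) ⟨p + 2, by ring⟩, neg_div]
      rfl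
    rw [show 2 * (p + 1) + 2 = 2 * p + 2 + 1 + 1 by ring,
      show 2 * (p + 1) + 1 = 2 * p + 2 + 1 by ring, Finset.sum_range_succ, Finset.sum_range_succ,
      e3, Odd.neg_one_pow (n := 2 * p + 2 + 1) ⟨p + 1, by ring⟩,
      Even.neg_one_pow (n := 2 * p + 2) ⟨p + 1, by ring⟩]
    have a1 := e1 (2 * p + 2 + 1)
    have a2 := e1 (2 * p + 2)
    have a3 := e1 (2 * p + 1)
    have b1 := e2 (2 * p + 2 + 1)
    have b2 := e2 (2 * p + 2)
    rw [show 2 * p + 1 + 1 = 2 * p + 2 by ring] at a3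
    rw [show 2 * p + 2 + 1 = 2 * p + 3 by ring] at *
    rw [show 2 * p + 3 + 1 = 2 * p + 4 by ring] at *
    linear_combination ih + (1 / 2) * a1 - a2 + 1 / 2 * a3 + 1 / 2 * b1 - 1 / 2 * b2

lemma Jk_comm (t : ℝ) (k l : ℕ) : Jk t k l = Jk t l k := by
  simp only [Jk, mul_comm]

lemma Jk_parts (t : ℝ) (k l : ℕ) :
    Jk t k (l + 1) + Jk t (k + 1) l = gk t (k + 1) 0 * gk t (l + 1) 0 := by
  have c := gk_cont t
  have hi : ∀ k l, IntervalIntegrable (fun u => gk t k u * gk t l u) volume 0 t :=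
    fun k l => ((c k).mul (c l)).intervalIntegrable _ _
  rw [Jk, Jk, ← intervalIntegral.integral_add (hi _ _) (hi _ _)]
  have h := intervalIntegral.integral_eq_sub_of_hasDerivAt (a := 0) (b := t)
    (f := fun u => -(gk t (k + 1) u * gk t (l + 1) u))
    (f' := fun u => gk t k u * gk t (l + 1) u + gk t (k + 1) u * gk t l u)
    (fun x _ => (((gk_deriv t k x).mul (gk_deriv t l x)).neg).congr_deriv (by ring))
    ((hi _ _).add (hi _ _))
  rw [h, gk_top]; ring

lemma Ss_eq (t : ℝ) (s : ℕ) : 2 * Ss t (s + 1) = Bm t s + 2 * Jk t 0 (s + 1) := by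
  have h1 : Bm t s = ∑ k ∈ Finset.range (s + 1), (Jk t k (s + 1 - k) + Jk t (k + 1) (s - k)) := by
    rw [Bm]
    refine Finset.sum_congr rfl fun k hk => ?_
    have : k < s + 1 := Finset.mem_range.1 hk
    rw [← Jk_parts, show s + 1 - k = s - k + 1 by omega]
  have h2 : Ss t (s + 1) = ∑ k ∈ Finset.range (s + 1), Jk t k (s + 1 - k) + Jk t 0 (s + 1) := by
    rw [Ss, Finset.sum_range_succ, Nat.sub_self, Jk_comm t (s + 1) 0]
  have h3 : Ss t (s + 1) = ∑ k ∈ Finset.range (s + 1), Jk t (k + 1) (s - k) + Jk t 0 (s + 1) := by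
    rw [Ss, Finset.sum_range_succ']
    simp
  rw [h1, Finset.sum_add_distrib]
  linarith

lemma Ee_deriv (n : ℕ) (x : ℝ) : HasDerivAt (Ee (n + 1)) (Ee n x) x := by
  have h1 : ∀ m : ℕ, HasDerivAt (fun u : ℝ => u ^ (m + 1) / (m + 1).factorial)
      (x ^ m / m.factorial) x := by
    intro m
    refine ((hasDerivAt_pow (m + 1) x).div_const ((m + 1).factorial : ℝ)).congr_deriv ?_
    rw [Nat.factorial_succ]
    push_cast
    have : (m.factorial : ℝ) ≠ 0 := by positivity
    have : (m : ℝ) + 1 ≠ 0 := by positivity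
    field_simp
  have h2 := (HasDerivAt.fun_sum (u := Finset.range n) (fun m _ => h1 m)).add_const (1:ℝ)
  have e : Ee (n + 1) = fun x : ℝ => ∑ m ∈ Finset.range n, x ^ (m + 1) / ((m + 1).factorial : ℝ) + 1 := by
    funext x
    simp [Ee, Finset.sum_range_succ']
  rw [e]
  exact h2

lemma Jk_diff (t : ℝ) (r : ℕ) (hr : Even r) : Jk t 0 r - Jk t 0 (r + 1) =
    Real.exp (-t) * (Ee (r + 1) (-t) - Real.exp (-t)) := by
  have c := gk_cont t
  have hi : ∀ k l, IntervalIntegrable (fun u => gk t k u * gk t l u) volume 0 t :=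
    fun k l => ((c k).mul (c l)).intervalIntegrable _ _
  rw [Jk, Jk, ← intervalIntegral.integral_sub (hi _ _) (hi _ _)]
  have h := intervalIntegral.integral_eq_sub_of_hasDerivAt (a := 0) (b := t)
    (f := fun u => Real.exp (-t) * (-(Real.exp (-u) * Ee (r + 1) (u - t))))
    (f' := fun u => gk t 0 u * gk t r u - gk t 0 u * gk t (r + 1) u)
    (fun x _ => by
      have d1 := (hasDerivAt_neg x).exp
      have d2 := (Ee_deriv r (x - t)).comp x ((hasDerivAt_id x).sub_const t)
      refine (((d1.mul d2).neg).const_mul (Real.exp (-t))).congr_deriv ?_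
      have e1 : Ee (r + 1) (x - t) = Ee r (x - t) + (t - x) ^ r / r.factorial := by
        rw [Ee, Finset.sum_range_succ, ← hr.neg_pow (x - t), neg_sub]; rfl
      simp only [Function.comp, id, e1, gk, Finset.sum_range_succ, Finset.sum_range_zero]
      ring)
    ((hi _ _).sub (hi _ _))
  rw [h]
  simp [Ee_zero]
  ring

lemma tail_eq (x : ℝ) (r : ℕ) :
    ∑' n : ℕ, x ^ (n + r + 1) / (Nat.factorial (n + r + 1)) = Real.exp x - Ee (r + 1) x := by
  have hs := Real.summable_pow_div_factorial x
  have h := hs.sum_add_tsum_nat_add (r + 1)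
  have he : Real.exp x = ∑' n : ℕ, x ^ n / n.factorial := by
    rw [Real.exp_eq_exp_ℝ, NormedSpace.exp_eq_tsum_div]
  rw [he, ← h, Ee]
  simp only [add_assoc]
  ring

end

theorem pair_prob_sum (P : Measure (ℤ → ℝ)) (hP : IsUniformProduct P)
    (t : ℝ) (ht : t ∈ Icc (0 : ℝ) 1) (r : ℕ) (hr : 2 ≤ r) (hre : Even r) :
    (P (O t 0 ∩ O t (r + 1))).toReal + (P (O t 0 ∩ O t r)).toReal =
      2 * (P (O t 0)).toReal ^ 2 -
        (1 / 2) * Real.exp (-2 * t) *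
          ∑' n : ℕ, (-2 * t) ^ (n + r + 1) / (Nat.factorial (n + r + 1)) := by
  
  have hP' := eq_pi_of_isUniform hP
  have e1 : (P (O t 0 ∩ O t (r + 1))).toReal = Qp P t (r + 1) 0 0 := by
    rw [← pair_eq]; push_cast; rfl
  rw [e1, pair_eq, Qp_formula hP' ht, Qp_formula hP' ht, one_eq hP' ht, tail_eq]
  obtain ⟨q, rfl⟩ : ∃ q, r = 2 * q + 2 := by
    obtain ⟨a, ha⟩ := hre
    exact ⟨a - 1, by omega⟩
  have hev : Even (2 * q + 2) := ⟨q + 1, by ring⟩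
  have s1 := Ss_eq t (2 * q + 2)
  have s2 := Ss_eq t (2 * q + 1)
  rw [show 2 * q + 1 + 1 = 2 * q + 2 by ring] at s2
  have j1 := Jk_diff t (2 * q + 2) hev
  have hB : 2 * ∑ m ∈ Finset.range (2 * q + 2), (-1) ^ m * Bm t m + 1 / 2 * Bm t (2 * q + 2) +
      1 / 2 * Bm t (2 * q + 1) =
      1 / 2 * Real.exp (-(2 * t)) * Ee (2 * q + 3) (-(2 * t)) -
      2 * (1 / 2 * Real.exp (-t) * Ee (2 * q + 3) (-t)) + 1 / 2 := by
    have z0 := Z_kap 0 q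
    rw [neg_zero, Ee_zero, Real.exp_zero] at z0
    rw [← Z_kap (2 * t) q, ← Z_kap t q]
    have : ∀ m, (-1 : ℝ) ^ m * Bm t m = (-1) ^ m * kap m (2 * t) - 2 * ((-1) ^ m * kap m t) +
        (-1) ^ m * kap m 0 := fun m => by rw [Bm_eq]; ring
    simp only [this, Finset.sum_add_distrib, Finset.sum_sub_distrib, ← Finset.mul_sum]
    rw [Bm_eq t (2 * q + 2), Bm_eq t (2 * q + 1)]
    linear_combination z0
  rw [Finset.sum_range_succ, Odd.neg_one_pow (n := 2 * q + 2 + 1) ⟨q + 1, by ring⟩,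
    hev.neg_one_pow]
  have x1 : Real.exp (-2 * t) = Real.exp (-t) * Real.exp (-t) := by
    rw [← Real.exp_add]; ring_nf
  rw [show -(2 * t) = -2 * t by ring] at hB
  rw [show 2 * q + 2 + 1 = 2 * q + 3 by ring] at *
  rw [x1] at hB ⊢
  linear_combination hB - 1 / 2 * s1 + 1 / 2 * s2 + j1
end
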